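/- arXiv:2009.03981 — 7 statements merged into one kernel-verified Lean document; each statement's English description precedes it below -/
import Mathlib

section
/- Let 1 ≤ k ≤ n−1, let V ⊆ ℝ^n be a k-dimensional linear subspace, and let w ∈ ℝ^n ∖ V represent η ∈ ℝ^n/V. Then the arrangement (V,η) is cyclic if and only if the (k+1)-dimensional subspace (φ,id)(V + span(w)) = {(t, v + t·w) : v ∈ V, t ∈ ℝ} of ℝ^{n+1} is totally positive, i.e. lies in Gr^{>0}_{k+1,n+1}. -/
open scoped BigOperators

/-- `W` lies in the totally positive Grassmannian `Gr^{>0}_{d,m}`: there is an `m × d` real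
matrix whose columns span `W` and all of whose `d × d` minors (determinants of the square
submatrices on any `d` rows taken in increasing order) are strictly positive. -/
def IsTotallyPositive (d m : ℕ) (W : Set (Fin m → ℝ)) : Prop :=
  ∃ M : Matrix (Fin m) (Fin d) ℝ,
    (Submodule.span ℝ (Set.range fun j i => M i j) : Set (Fin m → ℝ)) = W ∧
    ∀ s : Fin d → Fin m, StrictMono s → 0 < (M.submatrix s id).det

/-- `η` (represented by `w ∈ ℝ^n`) is positively oriented with respect to `V`: the first
coordinate of the orthogonal projection `u` of `w` onto `V^⊥` is strictly positive. -/
def PosOriented {n : ℕ} (V : Set (Fin n → ℝ)) (w : Fin n → ℝ) : Prop :=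
  ∃ u : Fin n → ℝ, w - u ∈ V ∧ (∀ v ∈ V, ∑ i, u i * v i = 0) ∧
    ∀ i : Fin n, (i : ℕ) = 0 → 0 < u i

/-- The arrangement `(V, η)` of `n` hyperplanes in `k`-space, with `η` represented by `w`,
is cyclic: `V ∈ Gr^{>0}_{k,n}`, `V + ⟨w⟩ ∈ Gr^{>0}_{k+1,n}`, and `η` is positively
oriented with respect to `V`. -/
def IsCyclicArr (n k : ℕ) (V : Set (Fin n → ℝ)) (w : Fin n → ℝ) : Prop :=
  IsTotallyPositive k n V ∧
  IsTotallyPositive (k + 1) n {y | ∃ v ∈ V, ∃ t : ℝ, y = v + t • w} ∧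
  PosOriented V w

/-- The polarized arrangement `(V, η, ξ)` (with `η` represented by `w`) is left cyclic. -/
def IsLeftCyclic (n k : ℕ) (V : Set (Fin n → ℝ)) (w : Fin n → ℝ)
    (ξ : (Fin n → ℝ) → ℝ) : Prop :=
  IsTotallyPositive (k + 1) n {y | ∃ v ∈ V, ∃ t : ℝ, y = v + t • w} ∧
  IsTotallyPositive k (n + 1) {y | ∃ v ∈ V, y = Fin.cons (ξ v) v} ∧
  PosOriented V w

/-- The polarized arrangement `(V, η, ξ)` (with `η` represented by `w`) is right cyclic. -/
def IsRightCyclic (n k : ℕ) (V : Set (Fin n → ℝ)) (w : Fin n → ℝ)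
    (ξ : (Fin n → ℝ) → ℝ) : Prop :=
  IsTotallyPositive (k + 1) n {y | ∃ v ∈ V, ∃ t : ℝ, y = v + t • w} ∧
  IsTotallyPositive k (n + 1) {y | ∃ v ∈ V, y = Fin.snoc v ((-1) ^ k * ξ v)} ∧
  PosOriented V w

namespace Matrix

/-- A symmetrized form of the Cauchy–Binet formula. -/
theorem factorial_mul_det_transpose_mul {d n : ℕ} (A B : Matrix (Fin n) (Fin d) ℝ) :
    (d.factorial : ℝ) * (Aᵀ * B).det =
      ∑ f : Fin d → Fin n, (A.submatrix f id).det * (B.submatrix f id).det := by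
  have hexp : (Aᵀ * B).det =
      ∑ f : Fin d → Fin n, (∏ i, A (f i) i) * (B.submatrix f id).det := by
    have h := (detRowAlternating (n := Fin d) (R := ℝ)).toMultilinearMap.map_sum
      (fun (i : Fin d) (j : Fin n) => A j i • B j)
    have hrow : (Aᵀ * B) = fun i => ∑ j, A j i • B j := by
      ext i k
      simp [mul_apply, Finset.sum_apply]
    rw [hrow]
    refine h.trans (Finset.sum_congr rfl fun f _ => ?_)
    exact (detRowAlternating (n := Fin d) (R := ℝ)).map_smul_univ
      (fun i => A (f i) i) (fun i => B (f i))
  have hperm (σ : Equiv.Perm (Fin d)) :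
      ∑ f : Fin d → Fin n, (Equiv.Perm.sign σ : ℝ) * (∏ i, A (f (σ i)) i) *
        (B.submatrix f id).det = (Aᵀ * B).det := by
    rw [hexp, ← Equiv.sum_comp (Equiv.arrowCongr σ (Equiv.refl (Fin n)))]
    refine Finset.sum_congr rfl fun f _ => ?_
    have hf : (B.submatrix (f ∘ σ.symm) id).det =
        (Equiv.Perm.sign σ : ℝ) * (B.submatrix f id).det := by
      rw [← Equiv.Perm.sign_symm σ]
      exact det_permute σ.symm (B.submatrix f id)
    have hs : (Equiv.Perm.sign σ : ℝ) * (Equiv.Perm.sign σ : ℝ) = 1 := by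
      rcases Int.units_eq_one_or (Equiv.Perm.sign σ) with h | h <;> simp [h]
    have he : (Equiv.arrowCongr σ (Equiv.refl (Fin n))) f = f ∘ σ.symm := rfl
    rw [he, hf]
    simp only [Function.comp_apply, Equiv.symm_apply_apply]
    linear_combination ((∏ i, A (f i) i) * (B.submatrix f id).det) * hs
  calc (d.factorial : ℝ) * (Aᵀ * B).det
      = ∑ σ : Equiv.Perm (Fin d), (Aᵀ * B).det := by simp [Fintype.card_perm]
    _ = _ := by
      rw [Finset.sum_congr rfl fun σ _ => (hperm σ).symm, Finset.sum_comm]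
      refine Finset.sum_congr rfl fun f _ => ?_
      rw [← Finset.sum_mul]
      exact congrArg (· * _) (det_apply' (A.submatrix f id)).symm

theorem det_transpose_mul_pos {d n : ℕ} (A B : Matrix (Fin n) (Fin d) ℝ) (c : ℝ)
    (h : ∀ s : Fin d → Fin n, StrictMono s →
      0 ≤ c * ((A.submatrix s id).det * (B.submatrix s id).det))
    (s₀ : Fin d → Fin n) (hs₀ : 0 < c * ((A.submatrix s₀ id).det * (B.submatrix s₀ id).det)) :
    0 < c * (Aᵀ * B).det := by
  have hnonneg (f : Fin d → Fin n) :
      0 ≤ c * ((A.submatrix f id).det * (B.submatrix f id).det) := by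
    by_cases hf : Function.Injective f
    · have hmono : StrictMono (f ∘ Tuple.sort f) :=
        (Tuple.monotone_sort f).strictMono_of_injective (hf.comp (Equiv.injective _))
      have hA := det_permute (Tuple.sort f) (A.submatrix f id)
      have hB := det_permute (Tuple.sort f) (B.submatrix f id)
      have := h _ hmono
      rw [submatrix_submatrix, Function.comp_id] at hA hB
      rw [hA, hB] at this
      rcases Int.units_eq_one_or (Equiv.Perm.sign (Tuple.sort f)) with h | h <;>
        simpa [h] using this
    · obtain ⟨i, j, hij, hne⟩ : ∃ i j, f i = f j ∧ i ≠ j := by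
        simpa [Function.Injective] using hf
      have : (A.submatrix f id).det = 0 := det_zero_of_row_eq hne (by ext; simp [hij])
      simp [this]
  have hsum : 0 < ∑ f : Fin d → Fin n, c * ((A.submatrix f id).det * (B.submatrix f id).det) :=
    Finset.sum_pos' (fun f _ => hnonneg f) ⟨s₀, Finset.mem_univ _, hs₀⟩
  rw [← Finset.mul_sum, ← factorial_mul_det_transpose_mul, mul_left_comm] at hsum
  exact pos_of_mul_pos_right hsum (by positivity)

/-- The matrix obtained from `M` by adding `a` as a new first column. -/
def consCol {m d : ℕ} (a : Fin m → ℝ) (M : Matrix (Fin m) (Fin d) ℝ) :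
    Matrix (Fin m) (Fin (d + 1)) ℝ :=
  of fun i => Fin.cons (a i) (M i)

/-- The matrix obtained from `M` by adding a zero row on top. -/
def consZeroRow {m d : ℕ} (M : Matrix (Fin m) (Fin d) ℝ) : Matrix (Fin (m + 1)) (Fin d) ℝ :=
  of (Fin.cons 0 M)

theorem span_col_consCol {m d : ℕ} (a : Fin m → ℝ) (M : Matrix (Fin m) (Fin d) ℝ) :
    Submodule.span ℝ (Set.range (consCol a M).col) =
      Submodule.span ℝ (insert a (Set.range M.col)) := by
  congr 1
  ext y
  simp only [Set.mem_range, Set.mem_insert_iff, Fin.exists_fin_succ]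
  refine or_congr ?_ Iff.rfl
  exact eq_comm

theorem mem_span_col_consZeroRow {m d : ℕ} (M : Matrix (Fin m) (Fin d) ℝ)
    (y : Fin (m + 1) → ℝ) :
    y ∈ Submodule.span ℝ (Set.range M.consZeroRow.col) ↔
      ∃ v ∈ Submodule.span ℝ (Set.range M.col), (Fin.cons 0 v : Fin (m + 1) → ℝ) = y := by
  let L : (Fin m → ℝ) →ₗ[ℝ] (Fin (m + 1) → ℝ) :=
    { toFun := fun v => Fin.cons 0 v
      map_add' := fun v w => by
        ext i; refine Fin.cases ?_ (fun j => ?_) i <;> simp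
      map_smul' := fun c v => by
        ext i; refine Fin.cases ?_ (fun j => ?_) i <;> simp }
  have : Set.range M.consZeroRow.col = L '' Set.range M.col := by
    rw [← Set.range_comp]
    congr 1
    ext j i
    refine Fin.cases ?_ (fun i => ?_) i <;> rfl
  rw [this, ← Submodule.map_span]
  rfl

theorem span_col_graph {m d : ℕ} (a : Fin m → ℝ) (M : Matrix (Fin m) (Fin d) ℝ) :
    (Submodule.span ℝ (Set.range (consCol (Fin.cons 1 a) M.consZeroRow).col) :
      Set (Fin (m + 1) → ℝ)) =
      {y | ∃ v ∈ Submodule.span ℝ (Set.range M.col), ∃ t : ℝ, y = Fin.cons t (v + t • a)} := by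
  have hcons (t : ℝ) (v : Fin m → ℝ) : (t • (Fin.cons 1 a : Fin (m + 1) → ℝ) + Fin.cons 0 v :
      Fin (m + 1) → ℝ) = Fin.cons t (v + t • a) := by
    ext i
    refine Fin.cases ?_ (fun i => ?_) i <;> simp [add_comm]
  ext y
  rw [SetLike.mem_coe, span_col_consCol, Submodule.mem_span_insert]
  simp only [mem_span_col_consZeroRow, Set.mem_ofPred_eq]
  constructor
  · rintro ⟨t, _, ⟨v, hv, rfl⟩, rfl⟩
    exact ⟨v, hv, t, hcons t v⟩
  · rintro ⟨v, hv, t, rfl⟩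
    exact ⟨t, _, ⟨v, hv, rfl⟩, (hcons t v).symm⟩

theorem det_submatrix_graph_cons {m d : ℕ} (a : Fin m → ℝ) (M : Matrix (Fin m) (Fin d) ℝ)
    (s : Fin d → Fin m) :
    ((consCol (Fin.cons 1 a) M.consZeroRow).submatrix
      (Fin.cons 0 (Fin.succ ∘ s) : Fin (d + 1) → Fin (m + 1)) id).det =
      (M.submatrix s id).det := by
  rw [det_succ_row_zero, Fin.sum_univ_succ, Finset.sum_eq_zero]
  · rw [add_zero]
    simp only [Fin.val_zero, pow_zero, one_mul]
    exact one_mul _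
  · intro j _
    exact mul_eq_zero_of_left (mul_eq_zero_of_right _ rfl) _

theorem det_submatrix_graph_succ {m d : ℕ} (a : Fin m → ℝ) (M : Matrix (Fin m) (Fin d) ℝ)
    (s : Fin (d + 1) → Fin m) :
    ((consCol (Fin.cons 1 a) M.consZeroRow).submatrix (Fin.succ ∘ s) id).det =
      ((consCol a M).submatrix s id).det := rfl

theorem forall_strictMono_graph {m d : ℕ} (a : Fin m → ℝ) (M : Matrix (Fin m) (Fin d) ℝ)
    (p : ℝ → Prop) :
    (∀ s : Fin (d + 1) → Fin (m + 1), StrictMono s →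
      p ((consCol (Fin.cons 1 a) M.consZeroRow).submatrix s id).det) ↔
    (∀ s : Fin d → Fin m, StrictMono s → p (M.submatrix s id).det) ∧
      ∀ s : Fin (d + 1) → Fin m, StrictMono s → p ((consCol a M).submatrix s id).det := by
  constructor
  · refine fun h => ⟨fun s hs => ?_, fun s hs => ?_⟩
    · rw [← det_submatrix_graph_cons a]
      refine h _ fun i j hij => ?_
      obtain ⟨j, rfl⟩ := Fin.exists_succ_eq.2 (Fin.ne_zero_of_lt hij)
      rcases Fin.eq_zero_or_eq_succ i with rfl | ⟨i, rfl⟩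
      · exact Fin.succ_pos _
      · exact Fin.succ_lt_succ_iff.2 (hs (Fin.succ_lt_succ_iff.1 hij))
    · exact h _ ((Fin.strictMono_succ).comp hs)
  · rintro ⟨h₁, h₂⟩ s hs
    have hpos (i : Fin d) : s i.succ ≠ 0 :=
      ((Fin.zero_le _).trans_lt (hs (Fin.succ_pos i))).ne'
    by_cases h0 : s 0 = 0
    · obtain ⟨s', rfl⟩ : ∃ s' : Fin d → Fin m, s = Fin.cons 0 (Fin.succ ∘ s') := by
        refine ⟨fun i => (s i.succ).pred (hpos i), ?_⟩
        ext i
        refine Fin.cases ?_ (fun i => ?_) i <;> simp [h0]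
      rw [det_submatrix_graph_cons]
      refine h₁ _ fun i j hij => ?_
      have := hs (Fin.succ_lt_succ_iff.2 hij)
      simpa using this
    · have hne (i : Fin (d + 1)) : s i ≠ 0 :=
        ((Fin.pos_of_ne_zero h0).trans_le (hs.monotone (Fin.zero_le i))).ne'
      obtain ⟨s', rfl⟩ : ∃ s' : Fin (d + 1) → Fin m, s = Fin.succ ∘ s' :=
        ⟨fun i => (s i).pred (hne i), by ext i; simp⟩
      exact h₂ _ fun i j hij => Fin.succ_lt_succ_iff.1 (hs hij)

theorem det_submatrix_consCol_single {m d : ℕ} (i₀ : Fin m) (hi₀ : (i₀ : ℕ) = 0)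
    (M : Matrix (Fin m) (Fin d) ℝ) (s : Fin (d + 1) → Fin m) (hs : StrictMono s) :
    ((consCol (Pi.single i₀ 1) M).submatrix s id).det =
      if s 0 = i₀ then (M.submatrix (s ∘ Fin.succ) id).det else 0 := by
  have hne (i : Fin d) : s i.succ ≠ i₀ := by
    have := hs (Fin.succ_pos i)
    intro h
    rw [h, Fin.lt_def, hi₀] at this
    omega
  rw [det_succ_column_zero, Fin.sum_univ_succ, Finset.sum_eq_zero]
  · simp only [consCol, submatrix_apply, of_apply, id, Fin.cons_zero, Pi.single_apply]
    split_ifs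
    · simp
      rfl
    · simp
  · intro i _
    simp [consCol, Pi.single_apply, hne i]

theorem det_transpose_consCol_single_mul {m d : ℕ} (i₀ : Fin m) (u : Fin m → ℝ)
    (M : Matrix (Fin m) (Fin d) ℝ) (hu : ∀ j, ∑ i, u i * M i j = 0) :
    ((consCol (Pi.single i₀ 1) M)ᵀ * consCol u M).det = u i₀ * (Mᵀ * M).det := by
  rw [det_succ_column_zero, Fin.sum_univ_succ, Finset.sum_eq_zero]
  · have h : ((consCol (Pi.single i₀ 1) M)ᵀ * consCol u M) 0 0 = u i₀ := by
      simp [mul_apply, consCol, Pi.single_apply]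
    rw [h]
    simp
    left; rfl
  · intro j _
    have h : ((consCol (Pi.single i₀ 1) M)ᵀ * consCol u M) j.succ 0 = 0 := by
      rw [← hu j]
      simp [mul_apply, consCol, mul_comm]
    rw [h]; simp

/-- The first coordinate of a vector orthogonal to the columns of `M` has the sign
determined by the maximal minors of `M` and of `M` extended by that vector. -/
theorem pos_of_minors {m d : ℕ} (hd : d < m) (i₀ : Fin m) (hi₀ : (i₀ : ℕ) = 0) (u : Fin m → ℝ)
    (M : Matrix (Fin m) (Fin d) ℝ) (hu : ∀ j, ∑ i, u i * M i j = 0) (b c : ℝ)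
    (hM : ∀ s : Fin d → Fin m, StrictMono s → 0 < b * (M.submatrix s id).det)
    (huM : ∀ s : Fin (d + 1) → Fin m, StrictMono s →
      0 < c * ((consCol u M).submatrix s id).det) :
    0 < b * c * u i₀ := by
  have hgram : 0 < (Mᵀ * M).det := by
    rw [← one_mul (det _)]
    refine det_transpose_mul_pos M M 1 (fun s _ => ?_) (Fin.castLE hd.le) ?_
    · rw [one_mul]; exact mul_self_nonneg _
    · rw [one_mul]
      exact mul_self_pos.2 (right_ne_zero_of_mul (hM _ (Fin.strictMono_castLE hd.le)).ne')
  have h := det_transpose_mul_pos (consCol (Pi.single i₀ 1) M) (consCol u M) (b * c)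
    (fun s hs => ?_) (Fin.castLE hd) ?_
  · rw [det_transpose_consCol_single_mul i₀ u M hu, ← mul_assoc] at h
    exact pos_of_mul_pos_left h hgram.le
  · rw [det_submatrix_consCol_single i₀ hi₀ M s hs]
    split_ifs
    · have := mul_pos (hM _ (hs.comp Fin.strictMono_succ)) (huM s hs)
      linarith
    · simp
  · have hs := Fin.strictMono_castLE (show d + 1 ≤ m from hd)
    rw [det_submatrix_consCol_single i₀ hi₀ M _ hs,
      if_pos (Fin.ext (by simp [hi₀]))]
    have := mul_pos (hM _ (hs.comp Fin.strictMono_succ)) (huM _ hs)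
    linarith

end Matrix

open Matrix

theorem isTotallyPositive_of_minors {d m : ℕ} (hd : 0 < d) (M : Matrix (Fin m) (Fin d) ℝ)
    (c : ℝ) (hc : c ≠ 0)
    (h : ∀ s : Fin d → Fin m, StrictMono s → 0 < c * (M.submatrix s id).det) :
    IsTotallyPositive d m (Submodule.span ℝ (Set.range M.col) : Set (Fin m → ℝ)) := by
  let D : Matrix (Fin d) (Fin d) ℝ := diagonal (Function.update 1 ⟨0, hd⟩ c)
  have hD : D.det = c := by
    simp [D, det_diagonal, Finset.prod_update_of_mem]
  refine ⟨M * D, ?_, fun s hs => ?_⟩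
  · congr 1
    change Submodule.span ℝ (Set.range (M * D).col) = _
    rw [← range_mulVecLin, ← range_mulVecLin, mulVecLin_mul]
    refine LinearMap.range_comp_of_range_eq_top _ (LinearMap.range_eq_top.2 ?_)
    exact (mulVec_surjective_iff_isUnit.2 ((isUnit_iff_isUnit_det _).2 (hD.symm ▸ hc.isUnit :)))
  · have : (M * D).submatrix s id = M.submatrix s id * D := rfl
    rw [this, det_mul, hD, mul_comm]
    exact h s hs

theorem IsTotallyPositive.exists_mul_minors_pos {d m : ℕ} {W : Set (Fin m → ℝ)}
    (hW : IsTotallyPositive d m W) (M : Matrix (Fin m) (Fin d) ℝ)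
    (hM : W ⊆ (Submodule.span ℝ (Set.range M.col) : Set (Fin m → ℝ))) :
    ∃ c : ℝ, ∀ s : Fin d → Fin m, StrictMono s → 0 < c * (M.submatrix s id).det := by
  obtain ⟨N, rfl, hN⟩ := hW
  have hcol (j : Fin d) : ∃ q, M *ᵥ q = N.col j := by
    have := hM (Submodule.subset_span ⟨j, rfl⟩)
    rw [← range_mulVecLin] at this
    exact this
  choose q hq using hcol
  refine ⟨(of q)ᵀ.det, fun s hs => ?_⟩
  have hNM : N = M * (of q)ᵀ := by
    ext i j
    exact (congrFun (hq j) i).symm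
  have : N.submatrix s id = M.submatrix s id * (of q)ᵀ := by rw [hNM]; rfl
  have h := hN s hs
  rwa [this, det_mul, mul_comm] at h

theorem exists_sub_mem_and_orthogonal {n : ℕ} (V : Submodule ℝ (Fin n → ℝ)) (w : Fin n → ℝ) :
    ∃ u : Fin n → ℝ, w - u ∈ V ∧ ∀ v ∈ V, ∑ i, u i * v i = 0 := by
  let K : Submodule ℝ (EuclideanSpace ℝ (Fin n)) :=
    V.comap (WithLp.linearEquiv 2 ℝ (Fin n → ℝ)).toLinearMap
  refine ⟨w - (K.starProjection (WithLp.toLp 2 w)).ofLp, ?_, fun v hv => ?_⟩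
  · rw [sub_sub_cancel]
    exact K.starProjection_apply_mem (WithLp.toLp 2 w)
  · have hvK : WithLp.toLp 2 v ∈ K := hv
    have := K.starProjection_inner_eq_zero (WithLp.toLp 2 w) _ hvK
    simpa [PiLp.inner_apply, mul_comm] using this

theorem exists_matrix_span_col_eq {n k : ℕ} (V : Submodule ℝ (Fin n → ℝ))
    (hV : Module.finrank ℝ V = k) :
    ∃ M : Matrix (Fin n) (Fin k) ℝ, Submodule.span ℝ (Set.range M.col) = V := by
  let b := Module.finBasisOfFinrankEq ℝ V hV
  refine ⟨of fun i j => (b j : Fin n → ℝ) i, ?_⟩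
  have : Set.range (of fun i j => (b j : Fin n → ℝ) i).col = V.subtype '' Set.range b := by
    rw [← Set.range_comp]; rfl
  rw [this, ← Submodule.map_span, b.span_eq, Submodule.map_top, Submodule.range_subtype]

/-- Proposition 3.7 / `AlternateCyclicDef`: for `1 ≤ k ≤ n-1`, a
`k`-dimensional subspace `V ⊆ ℝ^n` and a representative `w ∈ ℝ^n ∖ V` of `η`, the arrangement
`(V, η)` is cyclic if and only if the graph subspace
`(φ, id)(V + ⟨w⟩) = {(t, v + t·w) : v ∈ V, t ∈ ℝ} ⊆ ℝ^{n+1}` is totally positive. -/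
theorem cyclic_iff_cons_graph_totallyPositive
    (n k : ℕ) (hk1 : 1 ≤ k) (hkn : k ≤ n - 1)
    (V : Submodule ℝ (Fin n → ℝ)) (hV : Module.finrank ℝ V = k)
    (w : Fin n → ℝ) (hw : w ∉ V) :
    IsCyclicArr n k (V : Set (Fin n → ℝ)) w ↔
      IsTotallyPositive (k + 1) (n + 1)
        {y : Fin (n + 1) → ℝ | ∃ v ∈ V, ∃ t : ℝ, y = Fin.cons t (v + t • w)} := by
  have hk : k < n := by omega
  have hset {u : Fin n → ℝ} (hwu : w - u ∈ V) (t : ℝ) {v : Fin n → ℝ} (hv : v ∈ V) :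
      v + t • (w - u) ∈ V := V.add_mem hv (V.smul_mem t hwu)
  have hgraph {u : Fin n → ℝ} (hwu : w - u ∈ V) :
      {y : Fin (n + 1) → ℝ | ∃ v ∈ V, ∃ t : ℝ, y = Fin.cons t (v + t • w)} =
        {y | ∃ v ∈ V, ∃ t : ℝ, y = Fin.cons t (v + t • u)} := by
    ext y
    constructor
    · rintro ⟨v, hv, t, rfl⟩
      exact ⟨_, hset hwu t hv, t, by congr 1; module⟩
    · rintro ⟨v, hv, t, rfl⟩
      exact ⟨_, hset hwu (-t) hv, t, by congr 1; module⟩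
  have hsum {u : Fin n → ℝ} (hwu : w - u ∈ V) (M : Matrix (Fin n) (Fin k) ℝ)
      (hM : Submodule.span ℝ (Set.range M.col) = V) :
      {y : Fin n → ℝ | ∃ v ∈ (V : Set (Fin n → ℝ)), ∃ t : ℝ, y = v + t • w} =
        (Submodule.span ℝ (Set.range (consCol u M).col) : Set (Fin n → ℝ)) := by
    ext y
    rw [SetLike.mem_coe, span_col_consCol, Submodule.mem_span_insert, hM]
    constructor
    · rintro ⟨v, hv, t, rfl⟩
      exact ⟨t, _, hset hwu t hv, by module⟩
    · rintro ⟨t, v, hv, rfl⟩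
      exact ⟨_, hset hwu (-t) hv, t, by module⟩
  have horth {u : Fin n → ℝ} (hu : ∀ v ∈ V, ∑ i, u i * v i = 0) (M : Matrix (Fin n) (Fin k) ℝ)
      (hM : Submodule.span ℝ (Set.range M.col) = V) (j : Fin k) : ∑ i, u i * M i j = 0 :=
    hu (M.col j) (hM ▸ Submodule.subset_span ⟨j, rfl⟩)
  constructor
  · rintro ⟨⟨M, hMV, hMpos⟩, hVw, u, hwu, hu, hu0⟩
    have hM : Submodule.span ℝ (Set.range M.col) = V := SetLike.coe_injective hMV
    rw [hsum hwu M hM] at hVw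
    obtain ⟨c, hc⟩ := hVw.exists_mul_minors_pos (consCol u M) subset_rfl
    have hcpos : 0 < c := by
      have := pos_of_minors hk ⟨0, by omega⟩ rfl u M (horth hu M hM) 1 c
        (fun s hs => by simpa using hMpos s hs) hc
      rw [one_mul] at this
      exact pos_of_mul_pos_left this (hu0 ⟨0, by omega⟩ rfl).le
    refine ⟨consCol (Fin.cons 1 u) M.consZeroRow, ?_, ?_⟩
    · rw [hgraph hwu, ← hM]
      exact span_col_graph u M
    · exact (forall_strictMono_graph u M (0 < ·)).2
        ⟨hMpos, fun s hs => pos_of_mul_pos_right (hc s hs) hcpos.le⟩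
  · intro h
    obtain ⟨u, hwu, hu⟩ := exists_sub_mem_and_orthogonal V w
    obtain ⟨M, hM⟩ := exists_matrix_span_col_eq V hV
    obtain ⟨c, hc⟩ := h.exists_mul_minors_pos (consCol (Fin.cons 1 u) M.consZeroRow)
      (by rw [span_col_graph, hM, hgraph hwu])
    obtain ⟨hc₁, hc₂⟩ := (forall_strictMono_graph u M (0 < c * ·)).1 hc
    have hc0 : c ≠ 0 := left_ne_zero_of_mul (hc₁ _ (Fin.strictMono_castLE hk.le)).ne'
    refine ⟨hM ▸ isTotallyPositive_of_minors hk1 M c hc0 hc₁, ?_, u, hwu, hu, fun i hi => ?_⟩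
    · rw [hsum hwu M hM]
      exact isTotallyPositive_of_minors (Nat.succ_pos k) _ c hc0 hc₂
    · exact pos_of_mul_pos_right
        (pos_of_minors hk i hi u M (horth hu M hM) c c hc₁ hc₂) (mul_self_nonneg c)
end

section
/- Let 1 ≤ k ≤ n−1, let V ⊆ ℝ^n be a k-dimensional linear subspace, and let w ∈ ℝ^n ∖ V represent η ∈ ℝ^n/V. Then the arrangement (V,η) is cyclic if and only if the (k+1)-dimensional subspace (id,(−1)^k φ)(V + span(w)) = {(v + t·w, (−1)^k·t) : v ∈ V, t ∈ ℝ} of ℝ^{n+1} is totally positive, i.e. lies in Gr^{>0}_{k+1,n+1}. -/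
open scoped BigOperators

namespace Matrix

section CauchyBinet

variable {ι κ R : Type*} [Fintype ι] [Fintype κ] [DecidableEq κ] [CommRing R]

theorem det_transpose_mul_eq_sum (X Y : Matrix ι κ R) :
    (Xᵀ * Y).det = ∑ f : κ → ι, (∏ i, X (f i) i) * (Y.submatrix f id).det := by
  rw [← det_transpose, transpose_mul, transpose_transpose]
  simp only [det_apply', mul_apply, Finset.prod_univ_sum, Finset.mul_sum, Fintype.piFinset_univ]
  rw [Finset.sum_comm]
  refine Finset.sum_congr rfl fun f _ => ?_
  rw [← Finset.mul_sum, ← det_apply', ← det_transpose, det_apply', Finset.mul_sum]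
  refine Finset.sum_congr rfl fun σ _ => ?_
  simp only [transpose_apply, submatrix_apply, id, Finset.prod_mul_distrib]
  ring

/-- The Cauchy–Binet formula, summed over all functions `κ → ι` instead of all subsets. -/
theorem card_factorial_mul_det_transpose_mul (X Y : Matrix ι κ R) :
    ((Fintype.card κ).factorial : R) * (Xᵀ * Y).det =
      ∑ f : κ → ι, (X.submatrix f id).det * (Y.submatrix f id).det := by
  have key (σ : Equiv.Perm κ) : (Xᵀ * Y).det =
      ∑ f : κ → ι, (Equiv.Perm.sign σ * ∏ i, X (f (σ i)) i) * (Y.submatrix f id).det := by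
    rw [det_transpose_mul_eq_sum, ← Equiv.sum_comp (σ.symm.arrowCongr (Equiv.refl ι))]
    refine Finset.sum_congr rfl fun f _ => ?_
    have := det_permute σ (Y.submatrix f id)
    rw [submatrix_submatrix] at this
    change (∏ i, X (f (σ i)) i) * (Y.submatrix (f ∘ σ) (id ∘ id)).det = _
    rw [this]
    ring
  calc ((Fintype.card κ).factorial : R) * (Xᵀ * Y).det
      = ∑ _σ : Equiv.Perm κ, (Xᵀ * Y).det := by
        simp [Finset.card_univ, Fintype.card_perm]
    _ = _ := by
        rw [Finset.sum_congr rfl fun σ _ => key σ, Finset.sum_comm]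
        refine Finset.sum_congr rfl fun f _ => ?_
        rw [← Finset.sum_mul, det_apply' (X.submatrix f id)]
        rfl

end CauchyBinet

theorem det_submatrix_mul_det_submatrix_perm {ι κ R : Type*} [Fintype κ] [DecidableEq κ]
    [CommRing R] (X Y : Matrix ι κ R) (f : κ → ι) (σ : Equiv.Perm κ) :
    (X.submatrix (f ∘ σ) id).det * (Y.submatrix (f ∘ σ) id).det =
      (X.submatrix f id).det * (Y.submatrix f id).det := by
  have h (Z : Matrix ι κ R) :
      (Z.submatrix (f ∘ σ) id).det = Equiv.Perm.sign σ * (Z.submatrix f id).det := by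
    rw [← det_permute, submatrix_submatrix]; rfl
  rw [h X, h Y]
  rcases Int.units_eq_one_or (Equiv.Perm.sign σ) with hs | hs <;> simp [hs]

theorem det_transpose_mul_pos_s1 {m d : ℕ} (X Y : Matrix (Fin m) (Fin d) ℝ) (c : ℝ)
    (hnonneg : ∀ s : Fin d → Fin m, StrictMono s →
      0 ≤ c * ((X.submatrix s id).det * (Y.submatrix s id).det))
    (hpos : ∃ s : Fin d → Fin m,
      0 < c * ((X.submatrix s id).det * (Y.submatrix s id).det)) :
    0 < c * (Xᵀ * Y).det := by
  have hall (f : Fin d → Fin m) :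
      0 ≤ c * ((X.submatrix f id).det * (Y.submatrix f id).det) := by
    by_cases hf : Function.Injective f
    · rw [← det_submatrix_mul_det_submatrix_perm X Y f (Tuple.sort f)]
      exact hnonneg _ ((Tuple.monotone_sort f).strictMono_of_injective
        (hf.comp (Tuple.sort f).injective))
    · obtain ⟨i, j, hij, hne⟩ : ∃ i j, f i = f j ∧ i ≠ j := by
        simpa [Function.Injective] using hf
      rw [det_zero_of_row_eq (M := X.submatrix f id) hne (by ext; simp [hij])]
      simp
  have hsum : 0 < c * ∑ f : Fin d → Fin m,
      (X.submatrix f id).det * (Y.submatrix f id).det := by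
    rw [Finset.mul_sum]
    obtain ⟨s, hs⟩ := hpos
    exact Finset.sum_pos' (fun f _ => hall f) ⟨s, Finset.mem_univ _, hs⟩
  rw [← card_factorial_mul_det_transpose_mul, mul_left_comm] at hsum
  exact pos_of_mul_pos_right hsum (Nat.cast_nonneg _)

/-- The matrix `M` with the column `w` appended on the right. -/
def snocCol {ι R : Type*} {d : ℕ} (M : Matrix ι (Fin d) R) (w : ι → R) :
    Matrix ι (Fin (d + 1)) R :=
  of fun i => Fin.snoc (M i) (w i)

section SnocCol

variable {ι R : Type*} {d : ℕ} (M : Matrix ι (Fin d) R) (w : ι → R)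

@[simp]
theorem snocCol_castSucc (i : ι) (j : Fin d) : M.snocCol w i j.castSucc = M i j := by
  simp [snocCol]

@[simp]
theorem snocCol_last (i : ι) : M.snocCol w i (Fin.last d) = w i := by
  simp [snocCol]

theorem snocCol_submatrix {κ : Type*} (f : κ → ι) :
    (M.snocCol w).submatrix f id = (M.submatrix f id).snocCol (w ∘ f) := rfl

theorem snocCol_mulVec [NonUnitalNonAssocSemiring R] (x : Fin (d + 1) → R) :
    M.snocCol w *ᵥ x = M *ᵥ (Fin.init x) + fun i => w i * x (Fin.last d) := by
  ext i
  simp [mulVec, dotProduct, Fin.sum_univ_castSucc, Fin.init]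

theorem det_snocCol_add_mulVec [CommRing R] (M : Matrix (Fin (d + 1)) (Fin d) R)
    (w : Fin (d + 1) → R) (x : Fin d → R) :
    (M.snocCol (w + M *ᵥ x)).det = (M.snocCol w).det := by
  have h := det_updateCol_sum (M.snocCol w) (Fin.last d) (Fin.snoc x 1)
  rw [Fin.snoc_last, one_smul] at h
  rw [← h]
  congr 1
  ext i j
  refine Fin.lastCases ?_ (fun j => ?_) j
  · simp [Fin.sum_univ_castSucc, mulVec, dotProduct, mul_comm, add_comm]
  · simp

end SnocCol

/-- The matrix `M` with a zero row appended at the bottom. -/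
def snocZeroRow {κ R : Type*} [Zero R] {n : ℕ} (M : Matrix (Fin n) κ R) :
    Matrix (Fin (n + 1)) κ R :=
  of (Fin.snoc (α := fun _ => κ → R) (fun i => M i) 0)

section SnocZeroRow

variable {κ R : Type*} [Zero R] {n : ℕ} (M : Matrix (Fin n) κ R)

@[simp]
theorem snocZeroRow_castSucc (i : Fin n) (j : κ) : M.snocZeroRow i.castSucc j = M i j := by
  simp [snocZeroRow]

@[simp]
theorem snocZeroRow_last (j : κ) : M.snocZeroRow (Fin.last n) j = 0 := by
  simp [snocZeroRow]

end SnocZeroRow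

end Matrix

open Matrix

theorem Fin.exists_eq_castSucc_comp {ι : Type*} {m : ℕ} (s : ι → Fin (m + 1))
    (h : ∀ i, s i ≠ Fin.last m) : ∃ t : ι → Fin m, s = Fin.castSucc ∘ t :=
  ⟨fun i => (s i).castPred (h i), by ext; simp⟩

theorem isTotallyPositive_iff_exists_mul_det_pos {d m : ℕ} (hd : 0 < d) (hdm : d ≤ m)
    {W : Set (Fin m → ℝ)} (N : Matrix (Fin m) (Fin d) ℝ)
    (hN : ∀ y, y ∈ W ↔ ∃ x, N *ᵥ x = y) :
    IsTotallyPositive d m W ↔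
      ∃ c : ℝ, ∀ s : Fin d → Fin m, StrictMono s → 0 < c * (N.submatrix s id).det := by
  have hspan (M : Matrix (Fin m) (Fin d) ℝ) (y : Fin m → ℝ) :
      y ∈ Submodule.span ℝ (Set.range fun j i => M i j) ↔ ∃ x, M *ᵥ x = y := by
    rw [Submodule.mem_span_range_iff_exists_fun]
    refine exists_congr fun x => ?_
    rw [show ∑ j, x j • (fun i => M i j) = M *ᵥ x by
      ext i; simp [mulVec, dotProduct, mul_comm]]
  have hsub (P : Matrix (Fin d) (Fin d) ℝ) (s : Fin d → Fin m) :
      ((N * P).submatrix s id).det = P.det * (N.submatrix s id).det := by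
    rw [mul_comm, ← det_mul]; rfl
  constructor
  · rintro ⟨M, hM, hpos⟩
    have hcol (j : Fin d) : ∃ x, N *ᵥ x = fun i => M i j := by
      rw [← hN, ← hM]
      exact Submodule.subset_span ⟨j, rfl⟩
    choose P hP using hcol
    have hMP : M = N * (of P)ᵀ := by
      ext i j
      exact (congrFun (hP j) i).symm
    exact ⟨(of P)ᵀ.det, fun s hs => by rw [← hsub, ← hMP]; exact hpos s hs⟩
  · rintro ⟨c, hc⟩
    have hc0 : c ≠ 0 := by
      rintro rfl
      simpa using hc _ (Fin.strictMono_castLE hdm)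
    let P : Matrix (Fin d) (Fin d) ℝ := diagonal (Function.update 1 ⟨0, hd⟩ c)
    have hPdet : P.det = c := by simp [P, det_diagonal, Finset.prod_update_of_mem]
    have hPunit : IsUnit P.det := by rw [hPdet]; exact hc0.isUnit
    refine ⟨N * P, Set.ext fun y => ?_, fun s hs => by rw [hsub, hPdet]; exact hc s hs⟩
    rw [SetLike.mem_coe, hspan, hN]
    constructor
    · rintro ⟨x, rfl⟩
      exact ⟨P *ᵥ x, by rw [mulVec_mulVec]⟩
    · rintro ⟨x, rfl⟩
      exact ⟨P⁻¹ *ᵥ x, by rw [mulVec_mulVec, Matrix.mul_assoc, mul_nonsing_inv _ hPunit,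
        Matrix.mul_one]⟩

/-- If all maximal minors of `B` have one sign and all maximal minors of `[B | w]` have one sign,
then these signs determine the sign of the first coordinate of the part of `w` orthogonal to the
columns of `B`. -/
theorem orthogonal_part_zero_sign {m k : ℕ} (hkm : k ≤ m)
    (B : Matrix (Fin (m + 1)) (Fin k) ℝ) (u : Fin (m + 1) → ℝ) (x : Fin k → ℝ)
    (hu : Bᵀ *ᵥ u = 0) {c₁ c₂ : ℝ}
    (h₁ : ∀ s : Fin k → Fin (m + 1), StrictMono s → 0 < c₁ * (B.submatrix s id).det)
    (h₂ : ∀ s : Fin (k + 1) → Fin (m + 1), StrictMono s →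
      0 < c₂ * ((B.snocCol (u + B *ᵥ x)).submatrix s id).det)
    (hBB : 0 < (Bᵀ * B).det) :
    0 < c₁ * c₂ * (-1) ^ k * u 0 := by
  have hgram : ((B.snocCol (Pi.single 0 1))ᵀ * B.snocCol u).det = u 0 * (Bᵀ * B).det := by
    rw [det_succ_column _ (Fin.last k), Fin.sum_univ_castSucc]
    have h0 (i : Fin k) : ((B.snocCol (Pi.single 0 1))ᵀ * B.snocCol u) i.castSucc (Fin.last k)
        = 0 := by
      simpa [mul_apply, mulVec, dotProduct] using congrFun hu i
    have h1 : ((B.snocCol (Pi.single 0 1))ᵀ * B.snocCol u) (Fin.last k) (Fin.last k) = u 0 := by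
      simp [mul_apply, Pi.single_apply]
    have h2 : ((B.snocCol (Pi.single 0 1))ᵀ * B.snocCol u).submatrix
        (Fin.last k).succAbove (Fin.last k).succAbove = Bᵀ * B := by
      ext i j
      simp [mul_apply]
    rw [h1, h2]
    simp [h0, ← two_mul]
  have hterm (s : Fin (k + 1) → Fin (m + 1)) (hs : StrictMono s) :
      (s 0 ≠ 0 → ((B.snocCol (Pi.single 0 1)).submatrix s id).det = 0) ∧
      (s 0 = 0 → ((B.snocCol (Pi.single 0 1)).submatrix s id).det =
        (-1) ^ k * (B.submatrix (s ∘ Fin.succ) id).det) := by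
    have hne (i : Fin k) : s i.succ ≠ 0 :=
      ((Fin.zero_le _).trans_lt (hs (Fin.succ_pos i))).ne'
    constructor
    · intro h
      refine det_eq_zero_of_column_eq_zero (Fin.last k) fun i => ?_
      refine Fin.cases ?_ (fun i => ?_) i
      · simp [h]
      · simp [hne i]
    · intro h
      have hX : ((B.snocCol (Pi.single 0 1)).submatrix s id).submatrix
          (Fin.succAbove 0) (Fin.last k).succAbove = B.submatrix (s ∘ Fin.succ) id := by
        ext i j
        simp
      rw [det_succ_column _ (Fin.last k), Fin.sum_univ_succ, hX]
      simp [h, hne]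
  have hprod (s : Fin (k + 1) → Fin (m + 1)) (hs : StrictMono s) (h : s 0 = 0) :
      0 < c₁ * c₂ * (-1) ^ k * (((B.snocCol (Pi.single 0 1)).submatrix s id).det *
        ((B.snocCol u).submatrix s id).det) := by
    have ha := h₁ _ (hs.comp Fin.strictMono_succ)
    have hb := h₂ s hs
    have hw : ((u + B *ᵥ x) ∘ s) = u ∘ s + B.submatrix s id *ᵥ x := rfl
    rw [snocCol_submatrix, hw, det_snocCol_add_mulVec, ← snocCol_submatrix] at hb
    rw [(hterm s hs).2 h]
    have hsq : ((-1 : ℝ) ^ k) * (-1) ^ k = 1 := by rw [← mul_pow]; simp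
    calc 0 < _ := mul_pos ha hb
      _ = _ := by linear_combination (-(c₁ * (B.submatrix (s ∘ Fin.succ) id).det *
          (c₂ * ((B.snocCol u).submatrix s id).det))) * hsq
  have hmain := det_transpose_mul_pos_s1 (B.snocCol (Pi.single 0 1)) (B.snocCol u)
    (c₁ * c₂ * (-1) ^ k) (fun s hs => ?_) ⟨_, hprod _ (Fin.strictMono_castLE (by omega)) rfl⟩
  · rw [hgram, ← mul_assoc] at hmain
    exact pos_of_mul_pos_left hmain hBB.le
  · by_cases h : s 0 = 0
    · exact (hprod s hs h).le
    · simp [(hterm s hs).1 h]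

theorem snocCol_snoc_minors_pos_iff {n k : ℕ} (B : Matrix (Fin n) (Fin k) ℝ)
    (w : Fin n → ℝ) (c a : ℝ) :
    (∀ s : Fin (k + 1) → Fin (n + 1), StrictMono s →
        0 < c * ((B.snocZeroRow.snocCol (Fin.snoc w a)).submatrix s id).det) ↔
      (∀ s : Fin k → Fin n, StrictMono s → 0 < c * a * (B.submatrix s id).det) ∧
      (∀ s : Fin (k + 1) → Fin n, StrictMono s →
        0 < c * ((B.snocCol w).submatrix s id).det) := by
  set G := B.snocZeroRow.snocCol (Fin.snoc w a) with hG
  have hlow (s : Fin (k + 1) → Fin n) :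
      G.submatrix (Fin.castSucc ∘ s) id = (B.snocCol w).submatrix s id := by
    ext i j
    refine Fin.lastCases ?_ (fun j => ?_) j <;> simp [hG]
  have hhigh (s : Fin k → Fin n) :
      (G.submatrix (Fin.snoc (Fin.castSucc ∘ s) (Fin.last n) : Fin (k + 1) → Fin (n + 1)) id).det
        = a * (B.submatrix s id).det := by
    have hX : (G.submatrix (Fin.snoc (Fin.castSucc ∘ s) (Fin.last n) :
        Fin (k + 1) → Fin (n + 1)) id).submatrix (Fin.last k).succAbove (Fin.last k).succAbove =
        B.submatrix s id := by
      ext i j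
      simp [hG]
    rw [det_succ_row _ (Fin.last k), Fin.sum_univ_castSucc, hX]
    simp [hG, ← two_mul]
  constructor
  · intro h
    refine ⟨fun s hs => ?_, fun s hs => ?_⟩
    · rw [mul_assoc, ← hhigh]
      refine h _ fun i j hij => ?_
      induction j using Fin.lastCases with
      | last =>
        obtain ⟨i, rfl⟩ := Fin.exists_castSucc_eq.2 hij.ne
        simp
      | cast j =>
        obtain ⟨i, rfl⟩ := Fin.exists_castSucc_eq.2 (hij.trans (Fin.castSucc_lt_last j)).ne
        simpa using hs (by simpa using hij)
    · rw [← hlow]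
      exact h _ (Fin.strictMono_castSucc.comp hs)
  · rintro ⟨h₁, h₂⟩ s hs
    by_cases hlast : s (Fin.last k) = Fin.last n
    · obtain ⟨t, ht⟩ := Fin.exists_eq_castSucc_comp (s ∘ Fin.castSucc) fun i =>
        (((hs (Fin.castSucc_lt_last i)).trans_le (Fin.le_last _))).ne
      have hs' : s = Fin.snoc (Fin.castSucc ∘ t) (Fin.last n) := by
        rw [← ht, ← hlast]
        exact (Fin.snoc_init_self s).symm
      rw [hs', hhigh, ← mul_assoc]
      refine h₁ t fun i j hij => ?_
      have := hs (Fin.castSucc_lt_castSucc_iff.2 hij)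
      simpa [hs'] using this
    · obtain ⟨t, rfl⟩ := Fin.exists_eq_castSucc_comp s fun i h =>
        hlast (le_antisymm (Fin.le_last _) (h ▸ hs.monotone (Fin.le_last i)))
      rw [hlow]
      exact h₂ t fun i j hij => Fin.castSucc_lt_castSucc_iff.1 (hs hij)

/-- Corollary 3.9: for `1 ≤ k ≤ n-1`, a `k`-dimensional subspace `V ⊆ ℝ^n`
and a representative `w ∈ ℝ^n ∖ V` of `η`, the arrangement `(V, η)` is cyclic if and only if
the subspace `(id, (−1)^k φ)(V + ⟨w⟩) = {(v + t·w, (−1)^k·t) : v ∈ V, t ∈ ℝ} ⊆ ℝ^{n+1}`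
is totally positive. -/
theorem cyclic_iff_snoc_graph_totallyPositive
    (n k : ℕ) (hk1 : 1 ≤ k) (hkn : k ≤ n - 1)
    (V : Submodule ℝ (Fin n → ℝ)) (hV : Module.finrank ℝ V = k)
    (w : Fin n → ℝ) (hw : w ∉ V) :
    IsCyclicArr n k (V : Set (Fin n → ℝ)) w ↔
      IsTotallyPositive (k + 1) (n + 1)
        {y : Fin (n + 1) → ℝ | ∃ v ∈ V, ∃ t : ℝ, y = Fin.snoc (v + t • w) ((-1) ^ k * t)} := by
  obtain ⟨m, rfl⟩ : ∃ m, n = m + 1 := ⟨n - 1, by omega⟩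
  obtain ⟨B, hB⟩ : ∃ B : Matrix (Fin (m + 1)) (Fin k) ℝ, ∀ y, y ∈ V ↔ ∃ x, B *ᵥ x = y := by
    let b := Module.finBasisOfFinrankEq ℝ V hV
    refine ⟨of fun i j => (b j : Fin (m + 1) → ℝ) i, fun y => ?_⟩
    have hmul (x : Fin k → ℝ) : (of fun i j => (b j : Fin (m + 1) → ℝ) i) *ᵥ x =
        ((∑ j, x j • b j : V) : Fin (m + 1) → ℝ) := by
      ext i
      simp [mulVec, dotProduct, mul_comm]
    constructor
    · intro hy
      exact ⟨b.repr ⟨y, hy⟩, by rw [hmul, b.sum_repr]⟩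
    · rintro ⟨x, rfl⟩
      rw [hmul]
      exact Submodule.coe_mem _
  have hBmem (x : Fin k → ℝ) : B *ᵥ x ∈ V := (hB _).2 ⟨x, rfl⟩
  have hA (y : Fin (m + 1) → ℝ) :
      y ∈ {y | ∃ v ∈ (V : Set (Fin (m + 1) → ℝ)), ∃ t : ℝ, y = v + t • w} ↔
        ∃ x, B.snocCol w *ᵥ x = y := by
    constructor
    · rintro ⟨v, hv, t, rfl⟩
      obtain ⟨x, rfl⟩ := (hB v).1 hv
      refine ⟨Fin.snoc x t, ?_⟩
      rw [snocCol_mulVec]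
      ext i
      simp [mul_comm]
    · rintro ⟨x, rfl⟩
      refine ⟨_, hBmem (Fin.init x), x (Fin.last k), ?_⟩
      rw [snocCol_mulVec]
      ext i
      simp [mul_comm]
  have hG (y : Fin (m + 1 + 1) → ℝ) :
      y ∈ {y : Fin (m + 1 + 1) → ℝ | ∃ v ∈ V, ∃ t : ℝ,
          y = Fin.snoc (v + t • w) ((-1) ^ k * t)} ↔
        ∃ x, B.snocZeroRow.snocCol (Fin.snoc w ((-1) ^ k)) *ᵥ x = y := by
    have hmul (x : Fin (k + 1) → ℝ) :
        B.snocZeroRow.snocCol (Fin.snoc w ((-1) ^ k)) *ᵥ x =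
          Fin.snoc (B *ᵥ Fin.init x + x (Fin.last k) • w) ((-1) ^ k * x (Fin.last k)) := by
      rw [snocCol_mulVec]
      ext i
      refine Fin.lastCases ?_ (fun i => ?_) i <;> simp [mulVec, dotProduct, mul_comm]
    constructor
    · rintro ⟨v, hv, t, rfl⟩
      obtain ⟨x, rfl⟩ := (hB v).1 hv
      exact ⟨Fin.snoc x t, by simp [hmul]⟩
    · rintro ⟨x, rfl⟩
      exact ⟨_, hBmem (Fin.init x), x (Fin.last k), hmul x⟩
  have hsq : ((-1 : ℝ) ^ k) * (-1) ^ k = 1 := by rw [← mul_pow]; simp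
  have hgram (c : ℝ) (h : ∀ s : Fin k → Fin (m + 1), StrictMono s →
      0 < c * (B.submatrix s id).det) : 0 < (Bᵀ * B).det := by
    have h0 := h _ (Fin.strictMono_castLE (show k ≤ m + 1 by omega))
    simpa using det_transpose_mul_pos_s1 B B 1
      (fun s _ => by rw [one_mul]; exact mul_self_nonneg _)
      ⟨_, by rw [one_mul]; exact mul_self_pos.2 (right_ne_zero_of_mul h0.ne')⟩
  have horth (u : Fin (m + 1) → ℝ) :
      (∀ v ∈ (V : Set (Fin (m + 1) → ℝ)), ∑ i, u i * v i = 0) ↔ Bᵀ *ᵥ u = 0 := by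
    have hdot (x : Fin k → ℝ) : u ⬝ᵥ B *ᵥ x = (Bᵀ *ᵥ u) ⬝ᵥ x := by
      rw [dotProduct_mulVec, mulVec_transpose]
    constructor
    · intro h
      refine dotProduct_eq_zero _ fun x => ?_
      rw [← hdot]
      exact h _ (hBmem x)
    · intro h v hv
      obtain ⟨x, rfl⟩ := (hB v).1 hv
      exact (hdot x).trans (by rw [h, zero_dotProduct])
  rw [isTotallyPositive_iff_exists_mul_det_pos (by omega) (by omega) _ hG, IsCyclicArr,
    isTotallyPositive_iff_exists_mul_det_pos (by omega) (by omega) _ hA,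
    isTotallyPositive_iff_exists_mul_det_pos (by omega) (by omega) B hB]
  rw [exists_congr fun c => snocCol_snoc_minors_pos_iff B w c _]
  constructor
  · rintro ⟨⟨c₁, h₁⟩, ⟨c₂, h₂⟩, u, huV, hu, hu0⟩
    obtain ⟨x, hx⟩ := (hB _).1 huV
    obtain rfl : w = u + B *ᵥ x := by rw [hx]; abel
    have hsign := pos_of_mul_pos_left (orthogonal_part_zero_sign (by omega) B u x
      ((horth u).1 hu) h₁ h₂ (hgram c₁ h₁)) (hu0 0 rfl).le
    refine ⟨c₂, fun s hs => ?_, h₂⟩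
    refine pos_of_mul_pos_right (b := c₂ * (-1) ^ k * (B.submatrix s id).det) (a := c₁ ^ 2) ?_
      (sq_nonneg _)
    calc 0 < _ := mul_pos hsign (h₁ s hs)
      _ = _ := by ring
  · rintro ⟨c, h₁, h₂⟩
    have hunit : IsUnit (Bᵀ * B).det := (hgram _ h₁).ne'.isUnit
    set x := (Bᵀ * B)⁻¹ *ᵥ (Bᵀ *ᵥ w) with hx
    have hu : Bᵀ *ᵥ (w - B *ᵥ x) = 0 := by
      rw [mulVec_sub, mulVec_mulVec, hx, mulVec_mulVec, mul_nonsing_inv _ hunit, one_mulVec,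
        sub_self]
    refine ⟨⟨_, h₁⟩, ⟨c, h₂⟩, w - B *ᵥ x, by simpa using hBmem x, (horth _).2 hu, ?_⟩
    intro i hi
    obtain rfl : i = 0 := Fin.ext hi
    have hsign := orthogonal_part_zero_sign (by omega) B _ x hu h₁
      (by simpa using h₂) (hgram _ h₁)
    refine pos_of_mul_pos_right (a := c ^ 2) ?_ (sq_nonneg _)
    calc 0 < _ := hsign
      _ = _ := by linear_combination (c ^ 2 * (w - B *ᵥ x) 0) * hsq
end

section
/- Let 1 ≤ k ≤ n−1 and let (V,η) and (V',η') be two cyclic arrangements of n hyperplanes in k-space, with representatives w ∈ ℝ^n ∖ V of η and w' ∈ ℝ^n ∖ V' of η'. Let M and M' be any (n+1)×(k+1) real matrices whose columns span the (k+1)-dimensional subspaces {(v + t·w, t) : v ∈ V, t ∈ ℝ} and {(v' + t·w', t) : v' ∈ V', t ∈ ℝ} of ℝ^{n+1}, respectively. Then all (k+1)×(k+1) minors of M and of M' are nonzero, and there exists ε ∈ {+1,−1} such that for every (k+1)-element subset S of the rows, sign(det M_S) = ε · sign(det M'_S), where M_S denotes the square submatrix on the rows in S. In other words, the two lifted subspaces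 have the same projective sign pattern of Plücker coordinates, so for fixed (n,k) the cyclic arrangements form a single equivalence class of arrangements. -/
open scoped BigOperators

open Matrix Finset in
/-- An unordered form of the Cauchy–Binet formula. -/
theorem sum_det_submatrix_mul_det_submatrix {ι κ R : Type*} [Fintype ι] [Fintype κ]
    [DecidableEq κ] [CommRing R] (X Y : Matrix ι κ R) :
    ∑ f : κ → ι, (X.submatrix f id).det * (Y.submatrix f id).det =
      (Fintype.card κ).factorial * (Xᵀ * Y).det := by
  classical
  have expand : (Xᵀ * Y).det = ∑ f : κ → ι, (∏ i, X (f i) i) * (Y.submatrix f id).det := by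
    have hrow : Xᵀ * Y = fun i => ∑ j, X j i • Y j := by
      ext i l
      simp [Matrix.mul_apply, Finset.sum_apply]
    have h := (detRowAlternating : (κ → R) [⋀^κ]→ₗ[R] R).toMultilinearMap.map_sum
      (fun i (j : ι) => X j i • Y j)
    rw [hrow]
    refine h.trans (Finset.sum_congr rfl fun f _ => ?_)
    exact (detRowAlternating : (κ → R) [⋀^κ]→ₗ[R] R).toMultilinearMap.map_smul_univ
      (fun i => X (f i) i) (fun i => Y (f i))
  have hperm (σ : Equiv.Perm κ) :
      ∑ f : κ → ι, (Equiv.Perm.sign σ : R) * (∏ i, X (f (σ i)) i) * (Y.submatrix f id).det =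
        (Xᵀ * Y).det := by
    rw [expand]
    refine Fintype.sum_equiv (Equiv.arrowCongr σ.symm (Equiv.refl ι)) _ _ fun f => ?_
    have h := det_permute σ (Y.submatrix f id)
    have hf : (Equiv.arrowCongr σ.symm (Equiv.refl ι)) f = f ∘ σ := by
      ext; simp
    rw [hf]
    have h2 : Y.submatrix (f ∘ σ) id = (Y.submatrix f id).submatrix σ id := rfl
    rw [h2, h]
    simp only [Function.comp_apply]
    ring
  calc ∑ f : κ → ι, (X.submatrix f id).det * (Y.submatrix f id).det
      = ∑ f : κ → ι, ∑ σ : Equiv.Perm κ,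
          (Equiv.Perm.sign σ : R) * (∏ i, X (f (σ i)) i) * (Y.submatrix f id).det := by
        refine Finset.sum_congr rfl fun f _ => ?_
        rw [det_apply' (X.submatrix f id), Finset.sum_mul]
        rfl
    _ = ∑ _σ : Equiv.Perm κ, (Xᵀ * Y).det := by
        rw [Finset.sum_comm]
        exact Finset.sum_congr rfl fun σ _ => hperm σ
    _ = (Fintype.card κ).factorial * (Xᵀ * Y).det := by
        simp [Fintype.card_perm]

open Matrix in
/-- If the products of corresponding ordered maximal minors of `X` and `Y` all have the sign of `c`
or vanish, then so do those on arbitrary tuples of rows. -/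
theorem det_submatrix_mul_det_submatrix_nonneg {n d : ℕ} (X Y : Matrix (Fin n) (Fin d) ℝ) (c : ℝ)
    (h : ∀ s : Fin d → Fin n, StrictMono s →
      0 ≤ c * ((X.submatrix s id).det * (Y.submatrix s id).det)) (f : Fin d → Fin n) :
    0 ≤ c * ((X.submatrix f id).det * (Y.submatrix f id).det) := by
  by_cases hf : Function.Injective f
  · have hs : StrictMono (f ∘ Tuple.sort f) :=
      (Tuple.monotone_sort f).strictMono_of_injective (hf.comp (Tuple.sort f).injective)
    have key := h _ hs
    have hX := det_permute (Tuple.sort f) (X.submatrix f id)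
    have hY := det_permute (Tuple.sort f) (Y.submatrix f id)
    rw [submatrix_submatrix, Function.comp_id] at hX hY
    rw [hX, hY] at key
    rcases Int.units_eq_one_or (Equiv.Perm.sign (Tuple.sort f)) with h1 | h1 <;>
      simpa [h1] using key
  · obtain ⟨i, j, hij, hne⟩ : ∃ i j, f i = f j ∧ i ≠ j := by
      simpa [Function.Injective] using hf
    have : (X.submatrix f id).det = 0 :=
      det_zero_of_row_eq hne (by ext l; simp [hij])
    simp [this]

open Matrix in
theorem det_transpose_mul_nonneg {n d : ℕ} (X Y : Matrix (Fin n) (Fin d) ℝ) (c : ℝ)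
    (h : ∀ s : Fin d → Fin n, StrictMono s →
      0 ≤ c * ((X.submatrix s id).det * (Y.submatrix s id).det)) : 0 ≤ c * (Xᵀ * Y).det := by
  have hnn := Finset.sum_nonneg fun f (_ : f ∈ Finset.univ) =>
    det_submatrix_mul_det_submatrix_nonneg X Y c h f
  rw [← Finset.mul_sum, sum_det_submatrix_mul_det_submatrix, mul_left_comm] at hnn
  exact nonneg_of_mul_nonneg_right hnn (by positivity)

open Matrix in
theorem det_transpose_mul_self_pos {n d : ℕ} (X : Matrix (Fin n) (Fin d) ℝ)
    (s : Fin d → Fin n) (h : (X.submatrix s id).det ≠ 0) : 0 < (Xᵀ * X).det := by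
  have hsum := sum_det_submatrix_mul_det_submatrix X X
  have hpos : 0 < ∑ f : Fin d → Fin n, (X.submatrix f id).det * (X.submatrix f id).det :=
    Finset.sum_pos' (fun f _ => mul_self_nonneg _)
      ⟨s, Finset.mem_univ _, mul_self_pos.2 h⟩
  rw [hsum] at hpos
  exact pos_of_mul_pos_right hpos (by positivity)

/-- The matrix `[A | w]` obtained from `A` by appending the column `w`. -/
def appendCol {n k : ℕ} (A : Matrix (Fin n) (Fin k) ℝ) (w : Fin n → ℝ) :
    Matrix (Fin n) (Fin (k + 1)) ℝ :=
  Matrix.of fun i => Fin.snoc (A i) (w i)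

@[simp]
theorem appendCol_castSucc {n k : ℕ} (A : Matrix (Fin n) (Fin k) ℝ) (w : Fin n → ℝ)
    (i : Fin n) (j : Fin k) : appendCol A w i j.castSucc = A i j := by
  simp [appendCol]

@[simp]
theorem appendCol_last {n k : ℕ} (A : Matrix (Fin n) (Fin k) ℝ) (w : Fin n → ℝ)
    (i : Fin n) : appendCol A w i (Fin.last k) = w i := by
  simp [appendCol]

/-- The block matrix `[A w; 0 1]`. -/
def liftMatrix {n k : ℕ} (A : Matrix (Fin n) (Fin k) ℝ) (w : Fin n → ℝ) :
    Matrix (Fin (n + 1)) (Fin (k + 1)) ℝ :=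
  Matrix.of fun i j => Fin.snoc (α := fun _ => ℝ) (fun i => appendCol A w i j)
    (if j = Fin.last k then 1 else 0) i

@[simp]
theorem liftMatrix_castSucc {n k : ℕ} (A : Matrix (Fin n) (Fin k) ℝ) (w : Fin n → ℝ)
    (i : Fin n) (j : Fin (k + 1)) : liftMatrix A w i.castSucc j = appendCol A w i j := by
  simp [liftMatrix]

@[simp]
theorem liftMatrix_last {n k : ℕ} (A : Matrix (Fin n) (Fin k) ℝ) (w : Fin n → ℝ)
    (j : Fin (k + 1)) : liftMatrix A w (Fin.last n) j = if j = Fin.last k then 1 else 0 := by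
  simp [liftMatrix]

open Matrix in
/-- Only the corner contributes when the last row of a matrix vanishes off the diagonal. -/
theorem det_eq_of_last_row {k : ℕ} (A : Matrix (Fin (k + 1)) (Fin (k + 1)) ℝ)
    (h : ∀ j : Fin k, A (Fin.last k) j.castSucc = 0) :
    A.det = A (Fin.last k) (Fin.last k) * (A.submatrix Fin.castSucc Fin.castSucc).det := by
  rw [det_succ_row A (Fin.last k), Fin.sum_univ_castSucc]
  simp [h, ← two_mul, Fin.succAbove_last]

open Matrix in
theorem det_eq_of_last_col {k : ℕ} (A : Matrix (Fin (k + 1)) (Fin (k + 1)) ℝ)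
    (h : ∀ i : Fin k, A i.castSucc (Fin.last k) = 0) :
    A.det = A (Fin.last k) (Fin.last k) * (A.submatrix Fin.castSucc Fin.castSucc).det := by
  rw [← det_transpose, det_eq_of_last_row Aᵀ h, ← det_transpose (A.submatrix _ _)]
  rfl

open Matrix in
theorem exists_mul_eq_of_col_mem_span {m d e : ℕ} (X : Matrix (Fin m) (Fin e) ℝ)
    (Y : Matrix (Fin m) (Fin d) ℝ)
    (h : ∀ j, (fun i => X i j) ∈ Submodule.span ℝ (Set.range fun j i => Y i j)) :
    ∃ P : Matrix (Fin d) (Fin e) ℝ, X = Y * P := by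
  choose c hc using fun j => (Submodule.mem_span_range_iff_exists_fun ℝ).1 (h j)
  refine ⟨Matrix.of fun i j => c j i, ?_⟩
  ext i j
  have := congrFun (hc j) i
  simp only [Finset.sum_apply, Pi.smul_apply, smul_eq_mul] at this
  rw [← this, Matrix.mul_apply]
  exact Finset.sum_congr rfl fun l _ => mul_comm _ _

open Matrix in
theorem det_submatrix_mul {m d : ℕ} (Y : Matrix (Fin m) (Fin d) ℝ)
    (P : Matrix (Fin d) (Fin d) ℝ) (s : Fin d → Fin m) :
    ((Y * P).submatrix s id).det = (Y.submatrix s id).det * P.det := by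
  rw [← det_mul]
  rfl

open Matrix in
/-- The minors of `[A | e₀]` have the sign `(-1) ^ k` or vanish, for totally positive `A`. -/
theorem det_appendCol_single_nonneg {m k : ℕ} (A : Matrix (Fin (m + 1)) (Fin k) ℝ)
    (hA : ∀ s : Fin k → Fin (m + 1), StrictMono s → 0 < (A.submatrix s id).det)
    (s : Fin (k + 1) → Fin (m + 1)) (hs : StrictMono s) :
    0 ≤ (-1) ^ k * ((appendCol A (Pi.single 0 1)).submatrix s id).det := by
  have htail (i : Fin k) : s i.succ ≠ 0 :=
    ((Fin.zero_le _).trans_lt (hs i.succ_pos)).ne'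
  have hminor : 0 < (A.submatrix (s ∘ Fin.succ) id).det :=
    hA _ (hs.comp (Fin.strictMono_succ))
  have hdet : ((appendCol A (Pi.single 0 1)).submatrix s id).det =
      (-1) ^ k * (Pi.single (M := fun _ => ℝ) 0 1 (s 0)) *
        (A.submatrix (s ∘ Fin.succ) id).det := by
    rw [det_succ_column _ (Fin.last k), Fin.sum_univ_succ]
    have hsub : (((appendCol A (Pi.single 0 1)).submatrix s id).submatrix Fin.succ
        Fin.castSucc) = A.submatrix (s ∘ Fin.succ) id := by
      ext i j
      simp
    simp [htail, Fin.succAbove_last, hsub]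
  rw [hdet, ← mul_assoc, ← mul_assoc, ← pow_add, ← two_mul, pow_mul]
  have : (0 : ℝ) ≤ Pi.single (M := fun _ => ℝ) 0 1 (s 0) := by
    rw [Pi.single_apply]
    split_ifs <;> norm_num
  simp only [even_two, Even.neg_pow, one_pow, one_mul]
  positivity

open Matrix in
/-- The sign of the minors of `[A | u]` is forced to be `(-1) ^ k` when `u` is orthogonal to the
columns of `A` and has a positive first coordinate. -/
theorem det_appendCol_pos {m k : ℕ} (hk : k ≤ m) (A : Matrix (Fin (m + 1)) (Fin k) ℝ)
    (hA : ∀ s : Fin k → Fin (m + 1), StrictMono s → 0 < (A.submatrix s id).det)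
    (B : Matrix (Fin (m + 1)) (Fin (k + 1)) ℝ)
    (hB : ∀ s : Fin (k + 1) → Fin (m + 1), StrictMono s → 0 < (B.submatrix s id).det)
    (u : Fin (m + 1) → ℝ) (hu : ∀ j, ∑ i, A i j * u i = 0) (hu0 : 0 < u 0)
    (P : Matrix (Fin (k + 1)) (Fin (k + 1)) ℝ) (hP : appendCol A u = B * P)
    (s : Fin (k + 1) → Fin (m + 1)) (hs : StrictMono s) :
    0 < (-1) ^ k * ((appendCol A u).submatrix s id).det := by
  set X := appendCol A (Pi.single 0 1) with hX
  have hXu : 0 < (Xᵀ * appendCol A u).det := by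
    rw [det_eq_of_last_col _ (by intro i; simpa [Matrix.mul_apply, hX] using hu i)]
    refine mul_pos (by simpa [Matrix.mul_apply, hX, Pi.single_apply] using hu0) ?_
    have : (Xᵀ * appendCol A u).submatrix Fin.castSucc Fin.castSucc = Aᵀ * A := by
      ext i j
      simp [Matrix.mul_apply, hX]
    rw [this]
    exact det_transpose_mul_self_pos A (Fin.castLE (by omega))
      (hA _ (Fin.strictMono_castLE _)).ne'
  have hXB : 0 ≤ (-1) ^ k * (Xᵀ * B).det := by
    refine det_transpose_mul_nonneg _ _ _ fun t ht => ?_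
    rw [← mul_assoc]
    exact mul_nonneg (det_appendCol_single_nonneg A hA t ht) (hB t ht).le
  have hdetP : 0 < (-1) ^ k * P.det := by
    have hsq : ((-1 : ℝ) ^ k) * (-1) ^ k = 1 := by simp [← mul_pow]
    rw [hP, ← Matrix.mul_assoc, det_mul] at hXu
    refine pos_of_mul_pos_right (a := (-1) ^ k * (Xᵀ * B).det) ?_ hXB
    linear_combination hXu - (Xᵀ * B).det * P.det * hsq
  rw [hP, det_submatrix_mul]
  nlinarith [mul_pos hdetP (hB s hs)]

/-- The common sign pattern of the Plücker coordinates of lifted cyclic arrangements. -/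
def cyclicSign {m k : ℕ} (s : Fin (k + 1) → Fin (m + 1)) : ℝ :=
  if s (Fin.last k) = Fin.last m then 1 else (-1) ^ k

theorem cyclicSign_eq_or {m k : ℕ} (s : Fin (k + 1) → Fin (m + 1)) :
    cyclicSign s = 1 ∨ cyclicSign s = -1 := by
  unfold cyclicSign
  split_ifs
  · exact Or.inl rfl
  · exact neg_one_pow_eq_or ℝ k

open Matrix in
theorem cyclicSign_mul_det_liftMatrix_pos {n k : ℕ} (A : Matrix (Fin n) (Fin k) ℝ)
    (hA : ∀ s : Fin k → Fin n, StrictMono s → 0 < (A.submatrix s id).det)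
    (u : Fin n → ℝ)
    (hAu : ∀ s : Fin (k + 1) → Fin n, StrictMono s →
      0 < (-1) ^ k * ((appendCol A u).submatrix s id).det)
    (s : Fin (k + 1) → Fin (n + 1)) (hs : StrictMono s) :
    0 < cyclicSign s * ((liftMatrix A u).submatrix s id).det := by
  unfold cyclicSign
  split_ifs with hlast
  · have hne (i : Fin k) : s i.castSucc ≠ Fin.last n :=
      ((hs i.castSucc_lt_last).trans_le (Fin.le_last _)).ne
    rw [det_eq_of_last_row _ (by simp [hlast, Fin.castSucc_ne_last])]
    have hsub : ((liftMatrix A u).submatrix s id).submatrix Fin.castSucc Fin.castSucc =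
        A.submatrix (fun i => (s i.castSucc).castPred (hne i)) id := by
      ext i j
      have := liftMatrix_castSucc A u ((s i.castSucc).castPred (hne i)) j.castSucc
      simpa using this
    rw [hsub]
    simpa [hlast] using hA _ fun i j hij =>
      Fin.castPred_lt_castPred (hs (Fin.castSucc_lt_castSucc_iff.2 hij)) (hne j)
  · have hne (i : Fin (k + 1)) : s i ≠ Fin.last n := fun h =>
      hlast (Fin.last_le_iff.1 (h ▸ hs.monotone (Fin.le_last i)))
    have hsub : (liftMatrix A u).submatrix s id =
        (appendCol A u).submatrix (fun i => (s i).castPred (hne i)) id := by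
      ext i j
      have := liftMatrix_castSucc A u ((s i).castPred (hne i)) j
      simpa using this
    rw [hsub]
    exact hAu _ fun i j hij => Fin.castPred_lt_castPred (hs hij) (hne j)

open Matrix in
/-- Up to a global sign, the minors of any matrix spanning the lift of a cyclic arrangement have
the signs prescribed by `cyclicSign`. -/
theorem exists_sign_det_submatrix_eq {n k : ℕ} (hk1 : 1 ≤ k) (hkn : k ≤ n - 1)
    (V : Submodule ℝ (Fin n → ℝ)) (w : Fin n → ℝ)
    (hcyc : IsCyclicArr n k (V : Set (Fin n → ℝ)) w)
    (M : Matrix (Fin (n + 1)) (Fin (k + 1)) ℝ)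
    (hM : (Submodule.span ℝ (Set.range fun j i => M i j) : Set (Fin (n + 1) → ℝ)) =
      {y | ∃ v ∈ V, ∃ t : ℝ, y = Fin.snoc (v + t • w) t}) :
    ∃ ε : ℝ, (ε = 1 ∨ ε = -1) ∧ ∀ s : Fin (k + 1) → Fin (n + 1), StrictMono s →
      Real.sign (M.submatrix s id).det = ε * cyclicSign s := by
  obtain ⟨m, rfl⟩ : ∃ m, n = m + 1 := ⟨n - 1, by omega⟩
  obtain ⟨⟨A, hAV, hA⟩, ⟨B, hBV, hB⟩, u, huV, hu, hu0⟩ := hcyc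
  have hAmem (j : Fin k) : (fun i => A i j) ∈ V := by
    rw [← SetLike.mem_coe, ← hAV]
    exact Submodule.subset_span ⟨j, rfl⟩
  have huw : u - w ∈ V := by simpa using V.neg_mem huV
  obtain ⟨P, hP⟩ := exists_mul_eq_of_col_mem_span (appendCol A u) B fun j => by
    rw [← SetLike.mem_coe, hBV]
    refine Fin.lastCases ⟨u - w, huw, 1, ?_⟩ (fun j => ⟨_, hAmem j, 0, ?_⟩) j <;>
      · ext i
        simp
  have hAu := det_appendCol_pos (by omega) A hA B hB u
    (fun j => by simpa [mul_comm] using hu _ (hAmem j)) (hu0 0 rfl) P hP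
  have hpos := cyclicSign_mul_det_liftMatrix_pos A hA u hAu
  obtain ⟨Q, hQ⟩ := exists_mul_eq_of_col_mem_span (liftMatrix A u) M fun j => by
    rw [← SetLike.mem_coe, hM]
    refine Fin.lastCases ⟨u - w, huw, 1, ?_⟩ (fun j => ⟨_, hAmem j, 0, ?_⟩) j <;>
      · ext i
        refine Fin.lastCases ?_ (fun i => ?_) i <;> simp [Fin.castSucc_ne_last]
  have hQpos (s : Fin (k + 1) → Fin (m + 1 + 1)) (hs : StrictMono s) :
      0 < cyclicSign s * ((M.submatrix s id).det * Q.det) := by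
    rw [← det_submatrix_mul, ← hQ]
    exact hpos s hs
  have hQ0 : Q.det ≠ 0 := fun h => by
    simpa [h] using hQpos _ (Fin.strictMono_castLE (by omega : k + 1 ≤ m + 1 + 1))
  refine ⟨Real.sign Q.det, (Real.sign_apply_eq_of_ne_zero _ hQ0).symm, fun s hs => ?_⟩
  have h := hQpos s hs
  rcases cyclicSign_eq_or s with h1 | h1 <;> rcases hQ0.lt_or_gt with h2 | h2
  · rw [h1, Real.sign_of_neg h2, Real.sign_of_neg (by rw [h1] at h; nlinarith)]; norm_num
  · rw [h1, Real.sign_of_pos h2, Real.sign_of_pos (by rw [h1] at h; nlinarith)]; norm_num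
  · rw [h1, Real.sign_of_neg h2, Real.sign_of_pos (by rw [h1] at h; nlinarith)]; norm_num
  · rw [h1, Real.sign_of_pos h2, Real.sign_of_neg (by rw [h1] at h; nlinarith)]; norm_num

/-- any two cyclic arrangements of `n` hyperplanes in `k`-space are
equivalent: the lifted `(k+1)`-dimensional subspaces `{(v + t·w, t)} ⊆ ℝ^{n+1}` have
Plücker coordinates with the same projective signs. -/
theorem cyclic_arrangements_equivalent
    (n k : ℕ) (hk1 : 1 ≤ k) (hkn : k ≤ n - 1)
    (V V' : Submodule ℝ (Fin n → ℝ))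
    (hV : Module.finrank ℝ V = k) (hV' : Module.finrank ℝ V' = k)
    (w w' : Fin n → ℝ) (hw : w ∉ V) (hw' : w' ∉ V')
    (hcyc : IsCyclicArr n k (V : Set (Fin n → ℝ)) w)
    (hcyc' : IsCyclicArr n k (V' : Set (Fin n → ℝ)) w')
    (M M' : Matrix (Fin (n + 1)) (Fin (k + 1)) ℝ)
    (hM : (Submodule.span ℝ (Set.range fun j i => M i j) : Set (Fin (n + 1) → ℝ)) =
      {y | ∃ v ∈ V, ∃ t : ℝ, y = Fin.snoc (v + t • w) t})
    (hM' : (Submodule.span ℝ (Set.range fun j i => M' i j) : Set (Fin (n + 1) → ℝ)) =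
      {y | ∃ v ∈ V', ∃ t : ℝ, y = Fin.snoc (v + t • w') t}) :
    (∀ s : Fin (k + 1) → Fin (n + 1), StrictMono s →
      (M.submatrix s id).det ≠ 0 ∧ (M'.submatrix s id).det ≠ 0) ∧
    ∃ ε : ℝ, (ε = 1 ∨ ε = -1) ∧
      ∀ s : Fin (k + 1) → Fin (n + 1), StrictMono s →
        Real.sign ((M.submatrix s id).det) = ε * Real.sign ((M'.submatrix s id).det) := by
  obtain ⟨ε, hε, h⟩ := exists_sign_det_submatrix_eq hk1 hkn V w hcyc M hM
  obtain ⟨ε', hε', h'⟩ := exists_sign_det_submatrix_eq hk1 hkn V' w' hcyc' M' hM'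
  refine ⟨fun s hs => ⟨fun h0 => ?_, fun h0 => ?_⟩, ε * ε', ?_, fun s hs => ?_⟩
  · have := h s hs
    rcases hε with rfl | rfl <;> rcases cyclicSign_eq_or s with h1 | h1 <;> simp [h0, h1] at this
  · have := h' s hs
    rcases hε' with rfl | rfl <;> rcases cyclicSign_eq_or s with h1 | h1 <;> simp [h0, h1] at this
  · rcases hε with rfl | rfl <;> rcases hε' with rfl | rfl <;> simp
  · rw [h s hs, h' s hs]
    rcases hε' with rfl | rfl <;> ring
end

section
/- Let 1 ≤ k ≤ n−1, let V ⊆ ℝ^n be a k-dimensional linear subspace, let w ∈ ℝ^n ∖ V represent η ∈ ℝ^n/V, and let ξ be a nonzero linear functional on V. Then: (V,η,ξ) is left cyclic if and only if {(v + t·w, (−1)^k·t) : v ∈ V, t ∈ ℝ} ∈ Gr^{>0}_{k+1,n+1} and {(ξ(v), v) : v ∈ V} ∈ Gr^{>0}_{k,n+1}; and (V,η,ξ) is right cyclic if and only if {(t, v + t·w) : v ∈ V, t ∈ ℝ} ∈ Gr^{>0}_{k+1,n+1} and {(v, (−1)^k·ξ(v)) : v ∈ V} ∈ Gr^{>0}_{k,n+1}.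 -/
open scoped BigOperators

open Matrix

namespace TotallyPositive

theorem isTotallyPositive_iff {d m : ℕ} {W : Set (Fin m → ℝ)} :
    IsTotallyPositive d m W ↔ ∃ M : Matrix (Fin m) (Fin d) ℝ,
      (∀ y, y ∈ W ↔ ∃ c, M *ᵥ c = y) ∧
      ∀ s : Fin d → Fin m, StrictMono s → 0 < (M.submatrix s id).det := by
  have key (M : Matrix (Fin m) (Fin d) ℝ) :
      (Submodule.span ℝ (Set.range fun j i => M i j) : Set (Fin m → ℝ)) = W ↔
        ∀ y, y ∈ W ↔ ∃ c, M *ᵥ c = y := by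
    have h : Submodule.span ℝ (Set.range fun j i => M i j) = LinearMap.range M.mulVecLin :=
      (Matrix.range_mulVecLin M).symm
    rw [h, eq_comm, Set.ext_iff]
    rfl
  simp only [IsTotallyPositive, key]

/-- Two matrices with the same column space have proportional maximal minors. -/
theorem exists_det_submatrix_eq_mul {d m : ℕ} {M N : Matrix (Fin m) (Fin d) ℝ}
    (h : ∀ c, ∃ c', N *ᵥ c' = M *ᵥ c) :
    ∃ a : ℝ, ∀ s : Fin d → Fin m,
      (M.submatrix s id).det = a * (N.submatrix s id).det := by
  choose f hf using fun j => h (Pi.single j 1)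
  refine ⟨(Matrix.of fun i j => f j i).det, fun s => ?_⟩
  have hM : M = N * Matrix.of fun i j => f j i := by
    ext i j
    have := congrFun (hf j) i
    simp only [mulVec_single_one, col_apply] at this
    rw [← this]
    rfl
  rw [mul_comm, ← det_mul, hM]
  rfl

/-- A symmetrized form of the Cauchy–Binet formula. -/
theorem factorial_mul_det_transpose_mul {d m : ℕ} (A B : Matrix (Fin m) (Fin d) ℝ) :
    (d.factorial : ℝ) * (Aᵀ * B).det =
      ∑ p : Fin d → Fin m, (A.submatrix p id).det * (B.submatrix p id).det := by
  have expand : (Aᵀ * B).det =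
      ∑ p : Fin d → Fin m, (∏ i, A (p i) i) * (B.submatrix p id).det := by
    have h := (detRowAlternating : (Fin d → ℝ) [⋀^Fin d]→ₗ[ℝ] ℝ).toMultilinearMap.map_sum
      (fun i (j : Fin m) => A j i • B j)
    have h' : (fun i => ∑ j, A j i • B j) = Aᵀ * B := by
      ext i j
      simp [Matrix.mul_apply]
    rw [h'] at h
    refine h.trans (Finset.sum_congr rfl fun p _ => ?_)
    exact (detRowAlternating : (Fin d → ℝ) [⋀^Fin d]→ₗ[ℝ] ℝ).toMultilinearMap.map_smul_univ
      (fun i => A (p i) i) (fun i => B (p i))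
  have perm (σ : Equiv.Perm (Fin d)) : (Aᵀ * B).det =
      ∑ p : Fin d → Fin m,
        ((Equiv.Perm.sign σ : ℤ) : ℝ) * (∏ i, A (p (σ i)) i) * (B.submatrix p id).det := by
    rw [expand, ← Equiv.sum_comp (Equiv.arrowCongr σ.symm (Equiv.refl (Fin m)))]
    refine Finset.sum_congr rfl fun p _ => ?_
    have h := det_permute σ (B.submatrix p id)
    rw [submatrix_submatrix] at h
    have hp : (Equiv.arrowCongr σ.symm (Equiv.refl (Fin m))) p = p ∘ σ := rfl
    rw [hp]
    simp only [Function.comp_id] at h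
    rw [h]
    simp only [Function.comp_apply]
    ring
  have hcard : (d.factorial : ℝ) * (Aᵀ * B).det = ∑ _σ : Equiv.Perm (Fin d), (Aᵀ * B).det := by
    simp [Finset.card_univ, Fintype.card_perm]
  rw [hcard, Finset.sum_congr rfl fun σ _ => perm σ, Finset.sum_comm]
  refine Finset.sum_congr rfl fun p _ => ?_
  rw [← Finset.sum_mul, det_apply' (A.submatrix p id)]
  rfl

theorem mul_det_transpose_mul_pos {d m : ℕ} (A B : Matrix (Fin m) (Fin d) ℝ) (c : ℝ)
    (h : ∀ s : Fin d → Fin m, StrictMono s →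
      0 ≤ c * ((A.submatrix s id).det * (B.submatrix s id).det))
    (h' : ∃ s : Fin d → Fin m, StrictMono s ∧
      0 < c * ((A.submatrix s id).det * (B.submatrix s id).det)) :
    0 < c * (Aᵀ * B).det := by
  have nonneg (p : Fin d → Fin m) :
      0 ≤ c * ((A.submatrix p id).det * (B.submatrix p id).det) := by
    by_cases hp : Function.Injective p
    · have hs : StrictMono (p ∘ Tuple.sort p) :=
        (Tuple.monotone_sort p).strictMono_of_injective
          (hp.comp (Tuple.sort p).injective)
      have key := h _ hs
      have hA := det_permute (Tuple.sort p) (A.submatrix p id)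
      have hB := det_permute (Tuple.sort p) (B.submatrix p id)
      rw [submatrix_submatrix, Function.comp_id] at hA hB
      rw [hA, hB] at key
      have hsq : ((Equiv.Perm.sign (Tuple.sort p) : ℤ) : ℝ) *
          ((Equiv.Perm.sign (Tuple.sort p) : ℤ) : ℝ) = 1 := by
        rcases Int.units_eq_one_or (Equiv.Perm.sign (Tuple.sort p)) with e | e <;> simp [e]
      calc (0 : ℝ) ≤ _ := key
        _ = c * ((((Equiv.Perm.sign (Tuple.sort p) : ℤ) : ℝ) *
          ((Equiv.Perm.sign (Tuple.sort p) : ℤ) : ℝ)) *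
            ((A.submatrix p id).det * (B.submatrix p id).det)) := by ring
        _ = _ := by rw [hsq, one_mul]
    · obtain ⟨i, j, hij, hne⟩ := Function.not_injective_iff.mp hp
      rw [det_zero_of_row_eq (M := A.submatrix p id) hne (by ext; simp [hij])]
      simp
  have hpos : 0 < (d.factorial : ℝ) * (c * (Aᵀ * B).det) := by
    rw [mul_left_comm, factorial_mul_det_transpose_mul, Finset.mul_sum]
    obtain ⟨s, -, hs⟩ := h'
    exact Finset.sum_pos' (fun p _ => nonneg p) ⟨s, Finset.mem_univ _, hs⟩
  exact pos_of_mul_pos_right hpos (by positivity)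

theorem det_transpose_mul_self_pos {k n : ℕ} (hkn : k ≤ n) {M : Matrix (Fin n) (Fin k) ℝ}
    (hM : ∀ s : Fin k → Fin n, StrictMono s → 0 < (M.submatrix s id).det) :
    0 < (Mᵀ * M).det := by
  have := mul_det_transpose_mul_pos M M 1
    (fun s _ => by rw [one_mul]; exact mul_self_nonneg _)
    ⟨Fin.castLE hkn, Fin.strictMono_castLE hkn, by
      have := hM _ (Fin.strictMono_castLE hkn)
      positivity⟩
  simpa using this

/-- The matrix obtained from `M` by adding `u` as a new first column. -/
def consCol {n k : ℕ} (u : Fin n → ℝ) (M : Matrix (Fin n) (Fin k) ℝ) :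
    Matrix (Fin n) (Fin (k + 1)) ℝ :=
  Matrix.of fun i => Fin.cons (u i) (M i)

@[simp] theorem consCol_zero {n k : ℕ} (u : Fin n → ℝ) (M : Matrix (Fin n) (Fin k) ℝ)
    (i : Fin n) : consCol u M i 0 = u i := rfl

@[simp] theorem consCol_succ {n k : ℕ} (u : Fin n → ℝ) (M : Matrix (Fin n) (Fin k) ℝ)
    (i : Fin n) (j : Fin k) : consCol u M i j.succ = M i j := rfl

theorem consCol_mulVec {n k : ℕ} (u : Fin n → ℝ) (M : Matrix (Fin n) (Fin k) ℝ)
    (c : Fin (k + 1) → ℝ) :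
    consCol u M *ᵥ c = M *ᵥ (fun j => c j.succ) + c 0 • u := by
  ext i
  simp [Matrix.mulVec, dotProduct, Fin.sum_univ_succ, mul_comm, add_comm]

theorem exists_consCol_mulVec {n k : ℕ} {u : Fin n → ℝ} {M : Matrix (Fin n) (Fin k) ℝ}
    {y : Fin n → ℝ} :
    (∃ c, consCol u M *ᵥ c = y) ↔ ∃ (c : Fin k → ℝ) (t : ℝ), M *ᵥ c + t • u = y := by
  simp only [consCol_mulVec]
  exact ⟨fun ⟨c, h⟩ => ⟨_, _, h⟩, fun ⟨c, t, h⟩ => ⟨Fin.cons t c, by simpa using h⟩⟩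

/-- The sign of the first coordinate of a vector orthogonal to a totally positive subspace
is determined by the minors of the augmented matrix. -/
theorem mul_apply_zero_pos {n k : ℕ} (hkn : k ≤ n) {M : Matrix (Fin (n + 1)) (Fin k) ℝ}
    (hM : ∀ s : Fin k → Fin (n + 1), StrictMono s → 0 < (M.submatrix s id).det)
    {u : Fin (n + 1) → ℝ} (hu : Mᵀ *ᵥ u = 0) {c : ℝ}
    (hc : ∀ s : Fin (k + 1) → Fin (n + 1), StrictMono s →
      0 < c * ((consCol u M).submatrix s id).det) :
    0 < c * u 0 := by
  have hdet : ((consCol (Pi.single 0 1) M)ᵀ * consCol u M).det = u 0 * (Mᵀ * M).det := by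
    rw [det_succ_column_zero, Fin.sum_univ_succ, Finset.sum_eq_zero, add_zero]
    · have h0 : ((consCol (Pi.single 0 1) M)ᵀ * consCol u M) 0 0 = u 0 := by
        simp [Matrix.mul_apply, Pi.single_apply]
      rw [h0]
      simp only [Fin.val_zero, pow_zero, one_mul]
      rfl
    · intro i _
      have h0 : ((consCol (Pi.single 0 1) M)ᵀ * consCol u M) i.succ 0 = 0 :=
        congrFun hu i
      rw [h0]
      simp
  have minor (s : Fin (k + 1) → Fin (n + 1)) :
      ((consCol (Pi.single 0 1) M).submatrix s id).det =
        ∑ i : Fin (k + 1), (-1) ^ (i : ℕ) * (Pi.single 0 1 : Fin (n + 1) → ℝ) (s i) *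
          (M.submatrix (s ∘ i.succAbove) id).det := by
    rw [det_succ_column_zero]
    rfl
  have minor_pos (s : Fin (k + 1) → Fin (n + 1)) (hs : StrictMono s) (h0 : s 0 = 0) :
      0 < ((consCol (Pi.single 0 1) M).submatrix s id).det := by
    rw [minor, Fin.sum_univ_succ, Finset.sum_eq_zero]
    · simp only [h0]
      simpa using hM (s ∘ Fin.succ) (hs.comp Fin.strictMono_succ)
    · intro i _
      have : s i.succ ≠ 0 := ((Fin.zero_le _).trans_lt (hs (Fin.succ_pos i))).ne'
      simp [this]
  have minor_nonneg (s : Fin (k + 1) → Fin (n + 1)) (hs : StrictMono s) :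
      0 ≤ ((consCol (Pi.single 0 1) M).submatrix s id).det := by
    by_cases h0 : s 0 = 0
    · exact (minor_pos s hs h0).le
    · rw [minor, Finset.sum_eq_zero]
      intro i _
      have : s i ≠ 0 :=
        ((Fin.pos_of_ne_zero h0).trans_le (hs.monotone (Fin.zero_le i))).ne'
      simp [this]
  have hle : k + 1 ≤ n + 1 := by lia
  have key := mul_det_transpose_mul_pos (consCol (Pi.single 0 1) M) (consCol u M) c
    (fun s hs => by
      rw [mul_left_comm]
      exact mul_nonneg (minor_nonneg s hs) (hc s hs).le)
    ⟨Fin.castLE hle, Fin.strictMono_castLE hle, by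
      rw [mul_left_comm]
      exact mul_pos (minor_pos _ (Fin.strictMono_castLE hle) rfl)
        (hc _ (Fin.strictMono_castLE hle))⟩
  rw [hdet, ← mul_assoc] at key
  exact pos_of_mul_pos_left key (det_transpose_mul_self_pos (by lia) hM).le

theorem exists_orthogonal {n k : ℕ} {M : Matrix (Fin n) (Fin k) ℝ} (hM : 0 < (Mᵀ * M).det)
    (w : Fin n → ℝ) : ∃ c, Mᵀ *ᵥ (w - M *ᵥ c) = 0 := by
  refine ⟨(Mᵀ * M)⁻¹ *ᵥ (Mᵀ *ᵥ w), ?_⟩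
  rw [mulVec_sub, mulVec_mulVec, mulVec_mulVec, Matrix.mul_nonsing_inv _ hM.ne'.isUnit,
    one_mulVec, sub_self]

theorem orthogonal_iff {n k : ℕ} {M : Matrix (Fin n) (Fin k) ℝ} {V : Set (Fin n → ℝ)}
    (hV : ∀ y, y ∈ V ↔ ∃ c, M *ᵥ c = y) (u : Fin n → ℝ) :
    (∀ v ∈ V, ∑ i, u i * v i = 0) ↔ Mᵀ *ᵥ u = 0 := by
  constructor
  · intro h
    ext j
    have := h (M *ᵥ Pi.single j 1) ((hV _).2 ⟨_, rfl⟩)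
    simp only [mulVec_single_one, col_apply] at this
    simpa [mulVec, dotProduct, mul_comm] using this
  · intro h v hv
    obtain ⟨c, rfl⟩ := (hV v).1 hv
    change u ⬝ᵥ M *ᵥ c = 0
    rw [dotProduct_mulVec, ← mulVec_transpose, h, zero_dotProduct]

theorem exists_add_smul_iff {n k : ℕ} {V : Submodule ℝ (Fin n → ℝ)} {u w : Fin n → ℝ}
    {M : Matrix (Fin n) (Fin k) ℝ} (hV : ∀ y, y ∈ V ↔ ∃ c, M *ᵥ c = y) (hu : w - u ∈ V)
    (P : (Fin n → ℝ) → ℝ → Prop) :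
    (∃ v ∈ V, ∃ t : ℝ, P (v + t • w) t) ↔ ∃ (c : Fin k → ℝ) (t : ℝ), P (M *ᵥ c + t • u) t := by
  constructor
  · rintro ⟨v, hv, t, h⟩
    obtain ⟨c, hc⟩ := (hV _).1 (V.add_mem hv (V.smul_mem t hu))
    refine ⟨c, t, ?_⟩
    rwa [hc, show v + t • (w - u) + t • u = v + t • w by module]
  · rintro ⟨c, t, h⟩
    refine ⟨M *ᵥ c - t • (w - u), V.sub_mem ((hV _).2 ⟨c, rfl⟩) (V.smul_mem t hu), t, ?_⟩
    rwa [show M *ᵥ c - t • (w - u) + t • w = M *ᵥ c + t • u by module]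

/-- Adding a row to `[u | M]`, all of whose new maximal minors are positive, yields a totally
positive subspace exactly when `V + ⟨w⟩` is totally positive and `w` is positively oriented. -/
theorem isTotallyPositive_and_posOriented_iff {n k : ℕ} (hkn : k ≤ n)
    {V : Submodule ℝ (Fin (n + 1) → ℝ)} {w : Fin (n + 1) → ℝ}
    {M : Matrix (Fin (n + 1)) (Fin k) ℝ} (hV : ∀ y, y ∈ V ↔ ∃ c, M *ᵥ c = y)
    (hM : ∀ s : Fin k → Fin (n + 1), StrictMono s → 0 < (M.submatrix s id).det)
    {W : Set (Fin (n + 2) → ℝ)}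
    (N : (Fin (n + 1) → ℝ) → Matrix (Fin (n + 2)) (Fin (k + 1)) ℝ)
    (hW : ∀ u, w - u ∈ V → ∀ y, y ∈ W ↔ ∃ c, N u *ᵥ c = y)
    {f : Fin (n + 1) → Fin (n + 2)} (hf : StrictMono f)
    (hNf : ∀ u, (N u).submatrix f id = consCol u M)
    (hN : ∀ s : Fin (k + 1) → Fin (n + 2), StrictMono s →
      (∀ u, 0 < ((N u).submatrix s id).det) ∨ ∃ s', StrictMono s' ∧ s = f ∘ s')
    (hN' : ∃ s : Fin (k + 1) → Fin (n + 2), StrictMono s ∧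
      ∀ u, 0 < ((N u).submatrix s id).det) :
    (IsTotallyPositive (k + 1) (n + 1) {y | ∃ v ∈ V, ∃ t : ℝ, y = v + t • w} ∧
      PosOriented (V : Set (Fin (n + 1) → ℝ)) w) ↔ IsTotallyPositive (k + 1) (n + 2) W := by
  have hminor (u : Fin (n + 1) → ℝ) (s : Fin (k + 1) → Fin (n + 1)) :
      ((N u).submatrix (f ∘ s) id).det = ((consCol u M).submatrix s id).det := by
    rw [← hNf, submatrix_submatrix]
    rfl
  have hspan (u : Fin (n + 1) → ℝ) (hu : w - u ∈ V) (y : Fin (n + 1) → ℝ) :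
      y ∈ {y | ∃ v ∈ V, ∃ t : ℝ, y = v + t • w} ↔ ∃ c, consCol u M *ᵥ c = y := by
    rw [exists_consCol_mulVec]
    simp only [eq_comm (b := y)]
    exact exists_add_smul_iff hV hu fun x _ => y = x
  constructor
  · rintro ⟨h, u, huV, hu, hu0⟩
    obtain ⟨M', hM', hpos⟩ := isTotallyPositive_iff.1 h
    obtain ⟨a, ha⟩ := exists_det_submatrix_eq_mul (M := M') (N := consCol u M)
      fun c => (hspan u huV _).1 ((hM' _).2 ⟨c, rfl⟩)
    have hau := mul_apply_zero_pos hkn hM ((orthogonal_iff hV u).1 hu)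
      fun s hs => (ha s).subst (motive := fun x => 0 < x) (hpos s hs)
    have ha0 : 0 < a := pos_of_mul_pos_left hau (hu0 0 rfl).le
    refine isTotallyPositive_iff.2 ⟨N u, hW u huV, fun s hs => ?_⟩
    rcases hN s hs with h | ⟨s', hs', rfl⟩
    · exact h u
    · rw [hminor]
      have := hpos s' hs'
      rw [ha] at this
      exact pos_of_mul_pos_right this ha0.le
  · intro h
    obtain ⟨c, hc⟩ := exists_orthogonal (det_transpose_mul_self_pos (by lia) hM) w
    set u := w - M *ᵥ c with hu
    have huV : w - u ∈ V := (hV _).2 ⟨c, by rw [hu]; abel⟩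
    obtain ⟨M', hM', hpos⟩ := isTotallyPositive_iff.1 h
    obtain ⟨a, ha⟩ := exists_det_submatrix_eq_mul (M := M') (N := N u)
      fun c => (hW u huV _).1 ((hM' _).2 ⟨c, rfl⟩)
    obtain ⟨s₀, hs₀, hs₀'⟩ := hN'
    have ha0 : 0 < a := by
      have := hpos s₀ hs₀
      rw [ha] at this
      exact pos_of_mul_pos_left this (hs₀' u).le
    have hU (s : Fin (k + 1) → Fin (n + 1)) (hs : StrictMono s) :
        0 < ((consCol u M).submatrix s id).det := by
      have := hpos _ (hf.comp hs)
      rw [ha, hminor] at this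
      exact pos_of_mul_pos_right this ha0.le
    refine ⟨isTotallyPositive_iff.2 ⟨consCol u M, hspan u huV, hU⟩, u, huV,
      (orthogonal_iff hV u).2 hc, fun i hi => ?_⟩
    obtain rfl : i = 0 := Fin.ext hi
    simpa using mul_apply_zero_pos hkn hM hc (c := 1) (by simpa using hU)

theorem cons_graph_iff {n k : ℕ} (hkn : k ≤ n)
    {V : Submodule ℝ (Fin (n + 1) → ℝ)} {w : Fin (n + 1) → ℝ}
    (hV : IsTotallyPositive k (n + 1) V) :
    (IsTotallyPositive (k + 1) (n + 1) {y | ∃ v ∈ V, ∃ t : ℝ, y = v + t • w} ∧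
      PosOriented (V : Set (Fin (n + 1) → ℝ)) w) ↔
    IsTotallyPositive (k + 1) (n + 2)
      {y : Fin (n + 2) → ℝ | ∃ v ∈ V, ∃ t : ℝ, y = Fin.cons t (v + t • w)} := by
  obtain ⟨M, hMV, hM⟩ := isTotallyPositive_iff.1 hV
  let R : Matrix (Fin (n + 2)) (Fin k) ℝ :=
    Matrix.of fun i j => Fin.cons (α := fun _ => ℝ) 0 (fun l => M l j) i
  let N (u : Fin (n + 1) → ℝ) : Matrix (Fin (n + 2)) (Fin (k + 1)) ℝ :=
    consCol (Fin.cons (α := fun _ => ℝ) 1 u) R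
  have hR_zero (j : Fin k) : R 0 j = 0 := rfl
  have hR_succ (i : Fin (n + 1)) (j : Fin k) : R i.succ j = M i j := rfl
  have hNpos (s : Fin (k + 1) → Fin (n + 2)) (hs : StrictMono s) (h0 : s 0 = 0)
      (u : Fin (n + 1) → ℝ) :
      0 < ((N u).submatrix s id).det := by
    have hne (i : Fin k) : s i.succ ≠ 0 := ((Fin.zero_le _).trans_lt (hs (Fin.succ_pos i))).ne'
    rw [det_succ_row_zero, Fin.sum_univ_succ, Finset.sum_eq_zero]
    · have h := hM (fun i => (s i.succ).pred (hne i)) fun i j hij => by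
        simpa using hs (Fin.succ_lt_succ_iff.2 hij)
      have hsub : ((N u).submatrix s id).submatrix
          Fin.succ (Fin.succAbove 0) = M.submatrix (fun i => (s i.succ).pred (hne i)) id := by
        ext i j
        obtain ⟨l, hl⟩ := Fin.exists_succ_eq.2 (hne i)
        simp [← hl, N, hR_succ]
      rw [hsub]
      simpa [h0, N] using h
    · intro i _
      simp [h0, N, hR_zero]
  refine isTotallyPositive_and_posOriented_iff hkn hMV hM
    N ?_ Fin.strictMono_succ ?_ ?_ ?_
  · intro u hu y
    rw [exists_consCol_mulVec]
    have hcons (c : Fin k → ℝ) (t : ℝ) :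
        R *ᵥ c + t • (Fin.cons 1 u : Fin (n + 2) → ℝ) = Fin.cons t (M *ᵥ c + t • u) := by
      ext i
      refine Fin.cases ?_ (fun i => ?_) i <;> simp [mulVec, dotProduct, hR_zero, hR_succ]
    simp only [hcons, eq_comm (b := y)]
    exact exists_add_smul_iff hMV hu fun x t => y = Fin.cons t x
  · intro u
    ext i j
    refine Fin.cases ?_ (fun j => ?_) j <;> simp [N, hR_succ]
  · intro s hs
    by_cases h0 : s 0 = 0
    · exact .inl (hNpos s hs h0)
    · have hne (i : Fin (k + 1)) : s i ≠ 0 :=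
        ((Fin.pos_of_ne_zero h0).trans_le (hs.monotone (Fin.zero_le i))).ne'
      exact .inr ⟨fun i => (s i).pred (hne i), fun i j hij => by simpa using hs hij,
        by ext i; simp⟩
  · have hle : k + 1 ≤ n + 2 := by lia
    exact ⟨Fin.castLE hle, Fin.strictMono_castLE hle, hNpos _ (Fin.strictMono_castLE hle) rfl⟩

theorem snoc_graph_iff {n k : ℕ} (hkn : k ≤ n)
    {V : Submodule ℝ (Fin (n + 1) → ℝ)} {w : Fin (n + 1) → ℝ}
    (hV : IsTotallyPositive k (n + 1) V) :
    (IsTotallyPositive (k + 1) (n + 1) {y | ∃ v ∈ V, ∃ t : ℝ, y = v + t • w} ∧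
      PosOriented (V : Set (Fin (n + 1) → ℝ)) w) ↔
    IsTotallyPositive (k + 1) (n + 2)
      {y : Fin (n + 2) → ℝ | ∃ v ∈ V, ∃ t : ℝ, y = Fin.snoc (v + t • w) ((-1) ^ k * t)} := by
  obtain ⟨M, hMV, hM⟩ := isTotallyPositive_iff.1 hV
  let R : Matrix (Fin (n + 2)) (Fin k) ℝ :=
    Matrix.of fun i j => Fin.snoc (α := fun _ => ℝ) (fun l => M l j) 0 i
  let N (u : Fin (n + 1) → ℝ) : Matrix (Fin (n + 2)) (Fin (k + 1)) ℝ :=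
    consCol (Fin.snoc (α := fun _ => ℝ) u ((-1) ^ k)) R
  have hR_last (j : Fin k) : R (Fin.last _) j = 0 := by simp [R]
  have hR_castSucc (i : Fin (n + 1)) (j : Fin k) : R i.castSucc j = M i j := by simp [R]
  have hNpos (s : Fin (k + 1) → Fin (n + 2)) (hs : StrictMono s)
      (hl : s (Fin.last k) = Fin.last (n + 1)) (u : Fin (n + 1) → ℝ) :
      0 < ((N u).submatrix s id).det := by
    have hne (i : Fin k) : s i.castSucc ≠ Fin.last (n + 1) :=
      ((hs (Fin.castSucc_lt_last i)).trans_le (Fin.le_last _)).ne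
    rw [det_succ_row _ (Fin.last k), Fin.sum_univ_succ, Finset.sum_eq_zero]
    · have h := hM (fun i => (s i.castSucc).castPred (hne i)) fun i j hij => by
        simpa using hs (Fin.castSucc_lt_castSucc_iff.2 hij)
      have hsub : ((N u).submatrix s id).submatrix
          (Fin.last k).succAbove (Fin.succAbove 0) =
          M.submatrix (fun i => (s i.castSucc).castPred (hne i)) id := by
        ext i j
        obtain ⟨l, hl⟩ := Fin.exists_castSucc_eq.2 (hne i)
        simp [← hl, N, hR_castSucc]
      rw [hsub]
      simpa [hl, N, ← mul_pow] using h
    · intro i _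
      simp [hl, N, hR_last]
  refine isTotallyPositive_and_posOriented_iff hkn hMV hM N ?_ Fin.strictMono_castSucc ?_ ?_ ?_
  · intro u hu y
    rw [exists_consCol_mulVec]
    have hsnoc (c : Fin k → ℝ) (t : ℝ) :
        R *ᵥ c + t • (Fin.snoc u ((-1) ^ k) : Fin (n + 2) → ℝ) =
          Fin.snoc (M *ᵥ c + t • u) ((-1) ^ k * t) := by
      ext i
      refine Fin.lastCases ?_ (fun i => ?_) i
      · simp [mulVec, dotProduct, hR_last, mul_comm]
      · simp [mulVec, dotProduct, hR_castSucc]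
    simp only [hsnoc, eq_comm (b := y)]
    exact exists_add_smul_iff hMV hu fun x t => y = Fin.snoc x ((-1) ^ k * t)
  · intro u
    ext i j
    refine Fin.cases ?_ (fun j => ?_) j <;> simp [N, hR_castSucc]
  · intro s hs
    by_cases hl : s (Fin.last k) = Fin.last (n + 1)
    · exact .inl (hNpos s hs hl)
    · have hne (i : Fin (k + 1)) : s i ≠ Fin.last (n + 1) :=
        ((hs.monotone (Fin.le_last i)).trans_lt (Fin.lt_last_iff_ne_last.2 hl)).ne
      exact .inr ⟨fun i => (s i).castPred (hne i), fun i j hij => by simpa using hs hij,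
        by ext i; simp⟩
  · have hs : StrictMono fun i : Fin (k + 1) => (⟨n + 1 - k + i, by lia⟩ : Fin (n + 2)) :=
      fun i j hij => by simpa using hij
    exact ⟨_, hs, hNpos _ hs (by ext; simp; lia)⟩

/-- Deleting coordinates preserves total positivity. -/
theorem isTotallyPositive_comp {d m n : ℕ} {W : Set (Fin m → ℝ)} (h : IsTotallyPositive d m W)
    {f : Fin n → Fin m} (hf : StrictMono f) {W' : Set (Fin n → ℝ)}
    (hW : ∀ y, y ∈ W' ↔ ∃ x ∈ W, x ∘ f = y) : IsTotallyPositive d n W' := by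
  obtain ⟨M, hMW, hM⟩ := isTotallyPositive_iff.1 h
  refine isTotallyPositive_iff.2 ⟨M.submatrix f id, fun y => ?_, fun s hs => hM _ (hf.comp hs)⟩
  rw [hW]
  constructor
  · rintro ⟨x, hx, rfl⟩
    obtain ⟨c, rfl⟩ := (hMW x).1 hx
    exact ⟨c, rfl⟩
  · rintro ⟨c, rfl⟩
    exact ⟨M *ᵥ c, (hMW _).2 ⟨c, rfl⟩, rfl⟩

theorem of_cons_graph {n k : ℕ} {V : Submodule ℝ (Fin n → ℝ)} {g : (Fin n → ℝ) → ℝ}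
    (h : IsTotallyPositive k (n + 1) {y : Fin (n + 1) → ℝ | ∃ v ∈ V, y = Fin.cons (g v) v}) :
    IsTotallyPositive k n V := by
  refine isTotallyPositive_comp h Fin.strictMono_succ fun y => ⟨fun hy => ?_, ?_⟩
  · exact ⟨_, ⟨y, hy, rfl⟩, by ext i; simp⟩
  · rintro ⟨_, ⟨v, hv, rfl⟩, rfl⟩
    exact hv

theorem of_snoc_graph {n k : ℕ} {V : Submodule ℝ (Fin n → ℝ)} {g : (Fin n → ℝ) → ℝ}
    (h : IsTotallyPositive k (n + 1) {y : Fin (n + 1) → ℝ | ∃ v ∈ V, y = Fin.snoc v (g v)}) :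
    IsTotallyPositive k n V := by
  refine isTotallyPositive_comp h Fin.strictMono_castSucc fun y => ⟨fun hy => ?_, ?_⟩
  · exact ⟨_, ⟨y, hy, rfl⟩, by ext i; simp⟩
  · rintro ⟨_, ⟨v, hv, rfl⟩, rfl⟩
    have hcomp : (Fin.snoc v (g v) : Fin (n + 1) → ℝ) ∘ Fin.castSucc = v := by ext i; simp
    rwa [hcomp]

end TotallyPositive

/-- Corollary 3.11: characterizations of left and right cyclic polarized
arrangements via totally positive graph subspaces of `ℝ^{n+1}`. -/
theorem leftRightCyclic_iff_graphs_totallyPositive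
    (n k : ℕ) (hk1 : 1 ≤ k) (hkn : k ≤ n - 1)
    (V : Submodule ℝ (Fin n → ℝ)) (hV : Module.finrank ℝ V = k)
    (w : Fin n → ℝ) (hw : w ∉ V)
    (ξ : (Fin n → ℝ) →ₗ[ℝ] ℝ) (hξ : ∃ v ∈ V, ξ v ≠ 0) :
    (IsLeftCyclic n k (V : Set (Fin n → ℝ)) w ξ ↔
      (IsTotallyPositive (k + 1) (n + 1)
          {y : Fin (n + 1) → ℝ | ∃ v ∈ V, ∃ t : ℝ, y = Fin.snoc (v + t • w) ((-1) ^ k * t)} ∧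
        IsTotallyPositive k (n + 1)
          {y : Fin (n + 1) → ℝ | ∃ v ∈ V, y = Fin.cons (ξ v) v})) ∧
    (IsRightCyclic n k (V : Set (Fin n → ℝ)) w ξ ↔
      (IsTotallyPositive (k + 1) (n + 1)
          {y : Fin (n + 1) → ℝ | ∃ v ∈ V, ∃ t : ℝ, y = Fin.cons t (v + t • w)} ∧
        IsTotallyPositive k (n + 1)
          {y : Fin (n + 1) → ℝ | ∃ v ∈ V, y = Fin.snoc v ((-1) ^ k * ξ v)})) := by
  obtain _ | n := n
  · lia
  have hkn' : k ≤ n := by lia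
  constructor
  · constructor
    · rintro ⟨h₁, h₂, h₃⟩
      exact ⟨(TotallyPositive.snoc_graph_iff hkn' (TotallyPositive.of_cons_graph h₂)).1 ⟨h₁, h₃⟩,
        h₂⟩
    · rintro ⟨h₁, h₂⟩
      have h := (TotallyPositive.snoc_graph_iff hkn' (TotallyPositive.of_cons_graph h₂)).2 h₁
      exact ⟨h.1, h₂, h.2⟩
  · constructor
    · rintro ⟨h₁, h₂, h₃⟩
      exact ⟨(TotallyPositive.cons_graph_iff hkn' (TotallyPositive.of_snoc_graph h₂)).1 ⟨h₁, h₃⟩,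
        h₂⟩
    · rintro ⟨h₁, h₂⟩
      have h := (TotallyPositive.cons_graph_iff hkn' (TotallyPositive.of_snoc_graph h₂)).2 h₁
      exact ⟨h.1, h₂, h.2⟩
end

section
/- Let 1 ≤ k ≤ n−1, let V ⊆ ℝ^n be a k-dimensional linear subspace, let w ∈ ℝ^n ∖ V represent η ∈ ℝ^n/V, and let ξ be a nonzero linear functional on V. Then: (V,η,ξ) is left cyclic if and only if there exists c ∈ ℝ such that the (k+1)-dimensional subspace {(ξ(v) + t·c, v + t·w, (−1)^k·t) : v ∈ V, t ∈ ℝ} of ℝ^{n+2} lies in Gr^{>0}_{k+1,n+2}; and (V,η,ξ) is right cyclic if and only if there exists c ∈ ℝ such that {(t, v + t·w, (−1)^k·(ξ(v) + t·c)) : v ∈ V, t ∈ ℝ} ∈ Gr^{>0}_{k+1,n+2}. (The constant c encodes a strong lift ξ̄ of ξ to an affine-linear functional on V + η, via ξ̄(v + w) = ξ(v) + c.) -/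
open scoped BigOperators

/-- The minor, in the columns `s`, of the matrix with rows `a`. -/
noncomputable def familyMinor {d m : ℕ} (a : Fin d → Fin m → ℝ) (s : Fin d → Fin m) : ℝ :=
  (Matrix.of fun j i => a j (s i)).det

/-- The determinant of the matrix of dot products of two families of vectors. -/
noncomputable def gramDet {d m : ℕ} (a b : Fin d → Fin m → ℝ) : ℝ :=
  (Matrix.of fun i j => a i ⬝ᵥ b j).det

theorem isTotallyPositive_iff_familyMinor {d m : ℕ} {W : Set (Fin m → ℝ)} :
    IsTotallyPositive d m W ↔ ∃ a : Fin d → Fin m → ℝ,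
      (Submodule.span ℝ (Set.range a) : Set (Fin m → ℝ)) = W ∧
      ∀ s, StrictMono s → 0 < familyMinor a s := by
  constructor
  · rintro ⟨M, hM, hpos⟩
    refine ⟨fun j i => M i j, hM, fun s hs => ?_⟩
    have h := hpos s hs
    rw [← Matrix.det_transpose] at h
    exact h
  · rintro ⟨a, ha, hpos⟩
    refine ⟨Matrix.of fun i j => a j i, ha, fun s hs => ?_⟩
    rw [← Matrix.det_transpose]
    exact hpos s hs

theorem exists_familyMinor_eq_mul {d m : ℕ} {a b : Fin d → Fin m → ℝ}
    (h : Submodule.span ℝ (Set.range b) ≤ Submodule.span ℝ (Set.range a)) :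
    ∃ δ : ℝ, ∀ s, familyMinor b s = δ * familyMinor a s := by
  have hb : ∀ j, ∃ c : Fin d → ℝ, ∑ i, c i • a i = b j := fun j =>
    (Submodule.mem_span_range_iff_exists_fun ℝ).1 (h (Submodule.subset_span ⟨j, rfl⟩))
  choose P hP using hb
  refine ⟨(Matrix.of P).det, fun s => ?_⟩
  rw [familyMinor, familyMinor, ← Matrix.det_mul]
  congr 1
  ext j i
  simp [Matrix.mul_apply, ← hP]

theorem familyMinor_cons_add {k m : ℕ} (x y : Fin m → ℝ) (G : Fin k → Fin m → ℝ)
    (s : Fin (k + 1) → Fin m) :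
    familyMinor (Fin.cons (x + y) G : Fin (k + 1) → Fin m → ℝ) s =
      familyMinor (Fin.cons x G : Fin (k + 1) → Fin m → ℝ) s +
        familyMinor (Fin.cons y G : Fin (k + 1) → Fin m → ℝ) s := by
  simp only [familyMinor, Matrix.det_succ_row_zero, ← Finset.sum_add_distrib]
  refine Finset.sum_congr rfl fun i _ => ?_
  simp only [Matrix.of_apply, Fin.cons_zero, Pi.add_apply, mul_add, add_mul]
  rfl

theorem familyMinor_cons_smul {k m : ℕ} (c : ℝ) (x : Fin m → ℝ) (G : Fin k → Fin m → ℝ)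
    (s : Fin (k + 1) → Fin m) :
    familyMinor (Fin.cons (c • x) G : Fin (k + 1) → Fin m → ℝ) s =
      c * familyMinor (Fin.cons x G : Fin (k + 1) → Fin m → ℝ) s := by
  simp only [familyMinor, Matrix.det_succ_row_zero, Finset.mul_sum]
  refine Finset.sum_congr rfl fun i _ => ?_
  simp only [Matrix.of_apply, Fin.cons_zero, Pi.smul_apply, smul_eq_mul]
  rw [mul_left_comm _ c, mul_assoc c]
  rfl

theorem familyMinor_cons_eq_zero_of_mem_span {k m : ℕ} {x : Fin m → ℝ} {G : Fin k → Fin m → ℝ}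
    (hx : x ∈ Submodule.span ℝ (Set.range G)) (s : Fin (k + 1) → Fin m) :
    familyMinor (Fin.cons x G : Fin (k + 1) → Fin m → ℝ) s = 0 := by
  induction hx using Submodule.span_induction with
  | mem x hx =>
    obtain ⟨j, rfl⟩ := hx
    refine Matrix.det_zero_of_row_eq (i := 0) (j := j.succ) (Fin.succ_ne_zero j).symm ?_
    ext i
    simp
  | zero => simpa using familyMinor_cons_smul 0 0 G s
  | add x y _ _ hx hy => rw [familyMinor_cons_add, hx, hy, add_zero]
  | smul c x _ hx => rw [familyMinor_cons_smul, hx, mul_zero]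

theorem familyMinor_cons_single {k m : ℕ} {p : Fin m} {s : Fin (k + 1) → Fin m}
    (hs : Function.Injective s) {i : Fin (k + 1)} (hi : s i = p) (G : Fin k → Fin m → ℝ) :
    familyMinor (Fin.cons (Pi.single p 1) G : Fin (k + 1) → Fin m → ℝ) s =
      (-1) ^ (i : ℕ) * familyMinor G (s ∘ i.succAbove) := by
  rw [familyMinor, Matrix.det_succ_row_zero, Finset.sum_eq_single i]
  · simp [hi, familyMinor, Matrix.submatrix]
  · intro j _ hj
    have : s j ≠ p := fun h => hj (hs (h.trans hi.symm))
    simp [this]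
  · simp

theorem familyMinor_cons_single_of_ne {k m : ℕ} {p : Fin m} {s : Fin (k + 1) → Fin m}
    (hs : ∀ i, s i ≠ p) (G : Fin k → Fin m → ℝ) :
    familyMinor (Fin.cons (Pi.single p 1) G : Fin (k + 1) → Fin m → ℝ) s = 0 := by
  refine Matrix.det_eq_zero_of_row_eq_zero 0 fun i => ?_
  simp [hs i]

theorem familyMinor_cons_of_column_eq_zero {k m : ℕ} (x : Fin m → ℝ) {G : Fin k → Fin m → ℝ}
    {s : Fin (k + 1) → Fin m} {i : Fin (k + 1)} (hG : ∀ j, G j (s i) = 0) :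
    familyMinor (Fin.cons x G : Fin (k + 1) → Fin m → ℝ) s =
      x (s i) * (-1) ^ (i : ℕ) * familyMinor G (s ∘ i.succAbove) := by
  rw [familyMinor, Matrix.det_succ_column _ i, Fin.sum_univ_succ]
  simp [hG, familyMinor, Matrix.submatrix, mul_comm]

theorem span_range_cons_comp {E F : Type*} [AddCommGroup E] [Module ℝ E] [AddCommGroup F]
    [Module ℝ F] (g : E →ₗ[ℝ] F) {k : ℕ} (a : Fin k → E) (b : F) :
    (Submodule.span ℝ (Set.range (Fin.cons b (fun j => g (a j)) : Fin (k + 1) → F)) : Set F) =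
      {y | ∃ v ∈ Submodule.span ℝ (Set.range a), ∃ t : ℝ, y = g v + t • b} := by
  ext y
  have : Set.range (fun j => g (a j)) = g '' Set.range a := by
    rw [← Set.range_comp]; rfl
  rw [Fin.range_cons, SetLike.mem_coe, Submodule.mem_span_insert, this, ← Submodule.map_span]
  constructor
  · rintro ⟨t, z, ⟨v, hv, rfl⟩, rfl⟩
    exact ⟨v, hv, t, add_comm _ _⟩
  · rintro ⟨v, hv, t, rfl⟩
    exact ⟨t, g v, ⟨v, hv, rfl⟩, add_comm _ _⟩

theorem span_range_comp {E F : Type*} [AddCommGroup E] [Module ℝ E] [AddCommGroup F]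
    [Module ℝ F] (g : E →ₗ[ℝ] F) {k : ℕ} (a : Fin k → E) :
    (Submodule.span ℝ (Set.range fun j => g (a j)) : Set F) =
      {y | ∃ v ∈ Submodule.span ℝ (Set.range a), y = g v} := by
  have : Set.range (fun j => g (a j)) = g '' Set.range a := by
    rw [← Set.range_comp]; rfl
  rw [this, ← Submodule.map_span]
  ext y
  simp [eq_comm]

theorem exists_lift_of_span_range_eq {E F : Type*} [AddCommGroup E] [Module ℝ E] [AddCommGroup F]
    [Module ℝ F] {g : E →ₗ[ℝ] F} (hg : Function.Injective g) {V : Submodule ℝ E} {k : ℕ}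
    {b : Fin k → F}
    (hb : (Submodule.span ℝ (Set.range b) : Set F) = {y | ∃ v ∈ V, y = g v}) :
    ∃ a : Fin k → E, Submodule.span ℝ (Set.range a) = V ∧ b = fun j => g (a j) := by
  have h : ∀ j, ∃ v ∈ V, b j = g v := fun j => by
    have : b j ∈ (Submodule.span ℝ (Set.range b) : Set F) := Submodule.subset_span ⟨j, rfl⟩
    rwa [hb] at this
  choose a _ ha using h
  have hba : b = fun j => g (a j) := funext ha
  refine ⟨a, ?_, hba⟩
  rw [hba, span_range_comp] at hb
  ext v
  have := Set.ext_iff.1 hb (g v)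
  simpa [hg.eq_iff] using this

theorem isTotallyPositive_span_range_iff {d m : ℕ} (hd : 0 < d) (a : Fin d → Fin m → ℝ) :
    IsTotallyPositive d m (Submodule.span ℝ (Set.range a) : Set (Fin m → ℝ)) ↔
      ∃ δ : ℝ, ∀ s, StrictMono s → 0 < δ * familyMinor a s := by
  rw [isTotallyPositive_iff_familyMinor]
  constructor
  · rintro ⟨b, hb, hpos⟩
    obtain ⟨δ, hδ⟩ := exists_familyMinor_eq_mul (SetLike.coe_injective hb).le
    exact ⟨δ, fun s hs => hδ s ▸ hpos s hs⟩
  · rintro ⟨δ, hδ⟩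
    obtain ⟨k, rfl⟩ : ∃ k, d = k + 1 := ⟨d - 1, by omega⟩
    by_cases h0 : δ = 0
    · refine ⟨a, rfl, fun s hs => ?_⟩
      have := hδ s hs
      simp [h0] at this
    · refine ⟨Fin.cons (δ • a 0) (Fin.tail a), ?_, fun s hs => ?_⟩
      · conv_rhs => rw [← Fin.cons_self_tail a]
        rw [Fin.range_cons, Fin.range_cons, Submodule.span_insert, Submodule.span_insert,
          Submodule.span_singleton_smul_eq (IsUnit.mk0 δ h0)]
      · rw [familyMinor_cons_smul, Fin.cons_self_tail]
        exact hδ s hs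

section CauchyBinet

theorem familyMinor_comp_perm {d m : ℕ} (a : Fin d → Fin m → ℝ) (s : Fin d → Fin m)
    (σ : Equiv.Perm (Fin d)) :
    familyMinor a (s ∘ σ) = (Equiv.Perm.sign σ : ℤ) * familyMinor a s :=
  Matrix.det_permute' σ (Matrix.of fun j i => a j (s i))

theorem familyMinor_eq_zero_of_not_injective {d m : ℕ} (a : Fin d → Fin m → ℝ)
    {s : Fin d → Fin m} (hs : ¬ Function.Injective s) : familyMinor a s = 0 := by
  simp only [Function.Injective, not_forall] at hs
  obtain ⟨i, j, h, hij⟩ := hs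
  refine Matrix.det_zero_of_column_eq hij fun l => ?_
  simp [h]

theorem gramDet_eq_sum {d m : ℕ} (a b : Fin d → Fin m → ℝ) :
    gramDet a b = ∑ s : Fin d → Fin m, (∏ i, a i (s i)) * familyMinor b s := by
  have h := (Matrix.detRowAlternating (R := ℝ) (n := Fin d)).toMultilinearMap.map_sum
    (fun i (r : Fin m) => a i r • fun j => b j r)
  have h1 : (fun i => ∑ r : Fin m, a i r • fun j => b j r) =
      (Matrix.of fun i j => a i ⬝ᵥ b j) := by
    ext i j
    simp [dotProduct]
  rw [h1] at h
  refine Eq.trans h (Finset.sum_congr rfl fun s _ => ?_)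
  rw [MultilinearMap.map_smul_univ, smul_eq_mul]
  congr 1
  exact Matrix.det_transpose (Matrix.of fun j i => b j (s i))

/-- The Cauchy–Binet formula, summed over all (not necessarily increasing) index functions. -/
theorem factorial_mul_gramDet {d m : ℕ} (a b : Fin d → Fin m → ℝ) :
    (d.factorial : ℝ) * gramDet a b =
      ∑ s : Fin d → Fin m, familyMinor a s * familyMinor b s := by
  have hσ : ∀ σ : Equiv.Perm (Fin d), gramDet a b =
      ∑ s : Fin d → Fin m,
        ((Equiv.Perm.sign σ : ℤ) : ℝ) * (∏ i, a i (s (σ i))) * familyMinor b s := by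
    intro σ
    rw [gramDet_eq_sum, ← (Equiv.arrowCongr σ (Equiv.refl (Fin m))).symm.sum_comp]
    refine Finset.sum_congr rfl fun s _ => ?_
    have : (Equiv.arrowCongr σ (Equiv.refl (Fin m))).symm s = s ∘ σ := by
      ext i
      simp [Equiv.arrowCongr]
    rw [this, familyMinor_comp_perm]
    simp only [Function.comp_apply]
    ring
  have hsum : (d.factorial : ℝ) * gramDet a b = ∑ _σ : Equiv.Perm (Fin d), gramDet a b := by
    simp [Fintype.card_perm]
  rw [hsum, Finset.sum_congr rfl fun σ _ => hσ σ, Finset.sum_comm]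
  refine Finset.sum_congr rfl fun s _ => ?_
  rw [← Finset.sum_mul]
  congr 1
  rw [familyMinor, ← Matrix.det_transpose, Matrix.det_apply']
  rfl

theorem familyMinor_mul_comp_perm {d m : ℕ} (a b : Fin d → Fin m → ℝ) (s : Fin d → Fin m)
    (σ : Equiv.Perm (Fin d)) :
    familyMinor a (s ∘ σ) * familyMinor b (s ∘ σ) = familyMinor a s * familyMinor b s := by
  rw [familyMinor_comp_perm, familyMinor_comp_perm]
  rcases Int.units_eq_one_or (Equiv.Perm.sign σ) with h | h <;> simp [h]

theorem mul_gramDet_pos {d m : ℕ} {a b : Fin d → Fin m → ℝ} {γ : ℝ}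
    (hnonneg : ∀ s, StrictMono s → 0 ≤ γ * (familyMinor a s * familyMinor b s))
    (hpos : ∃ s, StrictMono s ∧ 0 < γ * (familyMinor a s * familyMinor b s)) :
    0 < γ * gramDet a b := by
  have key : 0 < (d.factorial : ℝ) * (γ * gramDet a b) := by
    rw [mul_left_comm, factorial_mul_gramDet, Finset.mul_sum]
    obtain ⟨s, _, hs⟩ := hpos
    refine Finset.sum_pos' (fun s _ => ?_) ⟨s, Finset.mem_univ _, hs⟩
    by_cases hinj : Function.Injective s
    · rw [← familyMinor_mul_comp_perm a b s (Tuple.sort s)]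
      exact hnonneg _ ((Tuple.monotone_sort s).strictMono_of_injective
        (hinj.comp (Tuple.sort s).injective))
    · simp [familyMinor_eq_zero_of_not_injective _ hinj]
  exact pos_of_mul_pos_right key (Nat.cast_nonneg _)

end CauchyBinet

theorem gramDet_self_pos {d m : ℕ} (hdm : d ≤ m) {a : Fin d → Fin m → ℝ} {δ : ℝ}
    (ha : ∀ s, StrictMono s → 0 < δ * familyMinor a s) : 0 < gramDet a a := by
  have h : ∀ s, StrictMono s → 0 < familyMinor a s * familyMinor a s := fun s hs =>
    mul_self_pos.2 (right_ne_zero_of_mul (ha s hs).ne')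
  have := mul_gramDet_pos (a := a) (b := a) (γ := 1)
    (fun s hs => by simpa using (h s hs).le)
    ⟨Fin.castLE hdm, Fin.strictMono_castLE hdm, by simpa using h _ (Fin.strictMono_castLE hdm)⟩
  simpa using this

theorem gramDet_cons_single {k n : ℕ} {a : Fin k → Fin n → ℝ} {u : Fin n → ℝ}
    (hu : ∀ j, u ⬝ᵥ a j = 0) (z : Fin n) :
    gramDet (Fin.cons u a : Fin (k + 1) → Fin n → ℝ) (Fin.cons (Pi.single z 1) a) =
      u z * gramDet a a := by
  rw [gramDet, Matrix.det_succ_row_zero, Fin.sum_univ_succ]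
  simp [hu, gramDet, Matrix.submatrix]

theorem orientation_mul_pos {k n : ℕ} (hkn : k + 1 ≤ n) {a : Fin k → Fin n → ℝ}
    {u w : Fin n → ℝ} (hwu : w - u ∈ Submodule.span ℝ (Set.range a))
    (hu : ∀ j, u ⬝ᵥ a j = 0) {δ δ' : ℝ}
    (hw : ∀ s, StrictMono s → 0 < δ * familyMinor (Fin.cons w a : Fin (k + 1) → Fin n → ℝ) s)
    (ha : ∀ s, StrictMono s → 0 < δ' * familyMinor a s) (z : Fin n) (hz : (z : ℕ) = 0) :
    0 < δ * δ' * u z := by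
  have hwu' : ∀ s, familyMinor (Fin.cons w a : Fin (k + 1) → Fin n → ℝ) s =
      familyMinor (Fin.cons u a : Fin (k + 1) → Fin n → ℝ) s := fun s => by
    rw [← sub_add_cancel w u, familyMinor_cons_add, familyMinor_cons_eq_zero_of_mem_span hwu,
      zero_add]
  have hzero : ∀ s : Fin (k + 1) → Fin n, StrictMono s → s 0 = z →
      0 < δ * δ' * (familyMinor (Fin.cons u a : Fin (k + 1) → Fin n → ℝ) s *
        familyMinor (Fin.cons (Pi.single z 1) a : Fin (k + 1) → Fin n → ℝ) s) := by
    intro s hs h0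
    rw [← hwu', familyMinor_cons_single hs.injective h0]
    have h1 := ha (s ∘ (0 : Fin (k + 1)).succAbove) (hs.comp (Fin.strictMono_succAbove 0))
    have := mul_pos (hw s hs) h1
    simp only [Fin.val_zero, pow_zero, one_mul]
    linarith
  have key := mul_gramDet_pos (a := (Fin.cons u a : Fin (k + 1) → Fin n → ℝ))
    (b := Fin.cons (Pi.single z 1) a) (γ := δ * δ')
    (fun s hs => by
      by_cases h0 : s 0 = z
      · exact (hzero s hs h0).le
      · rw [familyMinor_cons_single_of_ne (p := z), mul_zero, mul_zero]
        intro i hi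
        have h1 := hs.monotone (Fin.zero_le i)
        rw [hi, Fin.le_def, hz] at h1
        exact h0 (Fin.ext (by omega)))
    ⟨Fin.castLE hkn, Fin.strictMono_castLE hkn,
      hzero _ (Fin.strictMono_castLE hkn) (Fin.ext (by simp [hz]))⟩
  rw [gramDet_cons_single hu, ← mul_assoc] at key
  exact pos_of_mul_pos_left key (gramDet_self_pos (by omega) ha).le

theorem exists_sub_mem_span_dotProduct_eq_zero {k n : ℕ} {a : Fin k → Fin n → ℝ}
    (ha : gramDet a a ≠ 0) (w : Fin n → ℝ) :
    ∃ u : Fin n → ℝ, w - u ∈ Submodule.span ℝ (Set.range a) ∧ ∀ j, u ⬝ᵥ a j = 0 := by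
  set A : Matrix (Fin k) (Fin k) ℝ := Matrix.of fun i j => a i ⬝ᵥ a j with hA
  set c : Fin k → ℝ := A⁻¹.mulVec fun i => a i ⬝ᵥ w with hc
  have hAc : A.mulVec c = fun i => a i ⬝ᵥ w := by
    rw [hc, Matrix.mulVec_mulVec, Matrix.mul_nonsing_inv A (IsUnit.mk0 _ ha), Matrix.one_mulVec]
  refine ⟨w - ∑ i, c i • a i, ?_, fun j => ?_⟩
  · rw [sub_sub_cancel]
    exact Submodule.sum_mem _ fun i _ =>
      Submodule.smul_mem _ _ (Submodule.subset_span ⟨i, rfl⟩)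
  · have h := congrFun hAc j
    simp only [Matrix.mulVec, dotProduct_comm (a j) w] at h
    rw [sub_dotProduct, ← h, sum_dotProduct, sub_eq_zero]
    simp only [dotProduct, hA, Matrix.of_apply, Pi.smul_apply, smul_eq_mul, Finset.sum_mul]
    exact Finset.sum_congr rfl fun i _ => Finset.sum_congr rfl fun l _ => by ring

/-- `r` is an extreme index of `Fin m`, and `ε` is the sign with which it enters the Laplace
expansion of `(k + 1) × (k + 1)` minors. -/
structure IsSignedEnd (k : ℕ) {m : ℕ} (r : Fin (m + 1)) (ε : ℝ) : Prop where
  sign_eq : ∀ s : Fin (k + 1) → Fin (m + 1), StrictMono s → ∀ i, s i = r →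
    ε * (-1) ^ (i : ℕ) = 1
  exists_strictMono : ∀ s : Fin k → Fin m, StrictMono s →
    ∃ i : Fin (k + 1), StrictMono (i.insertNth r (r.succAbove ∘ s) : Fin (k + 1) → Fin (m + 1))

theorem isSignedEnd_zero (k m : ℕ) : IsSignedEnd k (0 : Fin (m + 1)) 1 where
  sign_eq s hs i hi := by
    have : i = 0 := by
      by_contra h
      have := hs (Fin.pos_of_ne_zero h)
      rw [hi] at this
      exact absurd this (Fin.not_lt_zero _)
    simp [this]
  exists_strictMono s hs := by
    refine ⟨0, ?_⟩
    rw [Fin.insertNth_zero', Fin.succAbove_zero]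
    intro i j hij
    induction i using Fin.cases <;> induction j using Fin.cases <;> simp_all [hs.lt_iff_lt]

theorem isSignedEnd_last (k m : ℕ) : IsSignedEnd k (Fin.last m) ((-1) ^ k) where
  sign_eq s hs i hi := by
    have : i = Fin.last k := by
      by_contra h
      have := hs (Fin.lt_last_iff_ne_last.2 h)
      rw [hi] at this
      exact absurd this (not_lt.2 (Fin.le_last _))
    simp [this, ← mul_pow]
  exists_strictMono s hs := by
    refine ⟨Fin.last k, ?_⟩
    rw [Fin.insertNth_last', Fin.succAbove_last]
    intro i j hij
    induction i using Fin.lastCases <;> induction j using Fin.lastCases <;>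
      simp_all [hs.lt_iff_lt, Fin.castSucc_lt_last]
    exact absurd hij (not_lt.2 (Fin.le_last _))

theorem exists_strictMono_succAbove_comp {d m : ℕ} {r : Fin (m + 1)} {s : Fin d → Fin (m + 1)}
    (hs : StrictMono s) (hr : ∀ i, s i ≠ r) :
    ∃ s' : Fin d → Fin m, StrictMono s' ∧ s = r.succAbove ∘ s' := by
  choose s' hs' using fun i => Fin.exists_succAbove_eq (hr i)
  refine ⟨s', fun i j hij => ?_, funext fun i => (hs' i).symm⟩
  have := hs hij
  rwa [← hs', ← hs', (Fin.strictMono_succAbove r).lt_iff_lt] at this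

section Lift

variable {n k : ℕ} (q : Fin (n + 2)) (p : Fin (n + 1)) (εq εp : ℝ)
  (η : (Fin n → ℝ) →ₗ[ℝ] ℝ)

/-- The graph of `η`, with the value of `η` inserted in position `p`. -/
def graphInsert : (Fin n → ℝ) →ₗ[ℝ] (Fin (n + 1) → ℝ) where
  toFun v := p.insertNth (η v) v
  map_add' x y := by
    ext i
    induction i using Fin.succAboveCases p <;> simp
  map_smul' c x := by
    ext i
    induction i using Fin.succAboveCases p <;> simp

/-- The map `graphInsert`, extended by a zero in position `q`. -/
def graphInsertZero : (Fin n → ℝ) →ₗ[ℝ] (Fin (n + 2) → ℝ) where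
  toFun v := q.insertNth 0 (graphInsert p η v)
  map_add' x y := by
    ext i
    induction i using Fin.succAboveCases q <;> simp
  map_smul' c x := by
    ext i
    induction i using Fin.succAboveCases q <;> simp

/-- The vector added to `graphInsertZero` to span the lift with constant `c`. -/
noncomputable def liftVector (w : Fin n → ℝ) (c : ℝ) : Fin (n + 2) → ℝ :=
  q.insertNth εq (p.insertNth 0 w) + c • εp • Pi.single (q.succAbove p) 1

/-- A family spanning the lift with constant `c`. -/
noncomputable def liftFamily (w : Fin n → ℝ) (a : Fin k → Fin n → ℝ) (c : ℝ) :
    Fin (k + 1) → Fin (n + 2) → ℝ :=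
  Fin.cons (liftVector q p εq εp w c) fun j => graphInsertZero q p η (a j)

variable {q p εq εp} (w : Fin n → ℝ) (a : Fin k → Fin n → ℝ) (c : ℝ)

theorem familyMinor_graphInsertZero (s : Fin k → Fin (n + 1)) :
    familyMinor (fun j => graphInsertZero q p η (a j)) (q.succAbove ∘ s) =
      familyMinor (fun j => graphInsert p η (a j)) s := by
  simp [familyMinor, graphInsertZero]

theorem familyMinor_graphInsert (s : Fin k → Fin n) :
    familyMinor (fun j => graphInsert p η (a j)) (p.succAbove ∘ s) = familyMinor a s := by
  simp [familyMinor, graphInsert]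

theorem familyMinor_liftFamily_of_eq (hq : IsSignedEnd k q εq) {s : Fin (k + 1) → Fin (n + 2)}
    (hs : StrictMono s) {i : Fin (k + 1)} (hi : s i = q) {s' : Fin k → Fin (n + 1)}
    (hs' : s ∘ i.succAbove = q.succAbove ∘ s') :
    familyMinor (liftFamily q p εq εp η w a c) s =
      familyMinor (fun j => graphInsert p η (a j)) s' := by
  rw [liftFamily, familyMinor_cons_of_column_eq_zero (i := i), hs', familyMinor_graphInsertZero,
    hi]
  · have : liftVector q p εq εp w c q = εq := by simp [liftVector]
    rw [this, hq.sign_eq s hs i hi, one_mul]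
  · simp [hi, graphInsertZero]

theorem familyMinor_liftFamily_succAbove (s : Fin (k + 1) → Fin n) :
    familyMinor (liftFamily q p εq εp η w a c) (q.succAbove ∘ p.succAbove ∘ s) =
      familyMinor (Fin.cons w a : Fin (k + 1) → Fin n → ℝ) s := by
  rw [familyMinor, familyMinor]
  congr 1
  ext j i
  induction j using Fin.cases <;>
    simp [liftFamily, liftVector, graphInsertZero, graphInsert,
      Fin.succAbove_right_injective.eq_iff]

theorem exists_familyMinor_liftFamily_eq (hp : IsSignedEnd k (q.succAbove p) εp)
    {s : Fin (k + 1) → Fin (n + 1)} (hs : StrictMono s) {i : Fin (k + 1)} (hi : s i = p) :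
    ∃ β : ℝ, ∀ c, familyMinor (liftFamily q p εq εp η w a c) (q.succAbove ∘ s) =
      β + c * familyMinor (fun j => graphInsert p η (a j)) (s ∘ i.succAbove) := by
  have hqs : StrictMono (q.succAbove ∘ s) := (Fin.strictMono_succAbove q).comp hs
  have hi' : (q.succAbove ∘ s) i = q.succAbove p := by simp [hi]
  refine ⟨familyMinor (Fin.cons (q.insertNth εq (p.insertNth 0 w))
    fun j => graphInsertZero q p η (a j) : Fin (k + 1) → Fin (n + 2) → ℝ) (q.succAbove ∘ s),
    fun c => ?_⟩
  rw [liftFamily, liftVector, familyMinor_cons_add, familyMinor_cons_smul, familyMinor_cons_smul,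
    familyMinor_cons_single hqs.injective hi', ← mul_assoc εp, hp.sign_eq _ hqs i hi', one_mul,
    Function.comp_assoc, familyMinor_graphInsertZero]

theorem exists_familyMinor_liftFamily_pos (hq : IsSignedEnd k q εq)
    (hp : IsSignedEnd k (q.succAbove p) εp)
    (hw : ∀ s, StrictMono s → 0 < familyMinor (Fin.cons w a : Fin (k + 1) → Fin n → ℝ) s)
    (ha : ∀ s, StrictMono s → 0 < familyMinor (fun j => graphInsert p η (a j)) s) :
    ∃ c, ∀ s, StrictMono s → 0 < familyMinor (liftFamily q p εq εp η w a c) s := by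
  suffices h : ∀ s : Fin (k + 1) → Fin (n + 2), ∀ᶠ c in Filter.atTop, StrictMono s →
      0 < familyMinor (liftFamily q p εq εp η w a c) s from
    (Filter.eventually_all.2 h).exists
  intro s
  by_cases hs : StrictMono s
  swap
  · exact Filter.Eventually.of_forall fun c h => absurd h hs
  by_cases hsq : ∃ i, s i = q
  · obtain ⟨i, hi⟩ := hsq
    obtain ⟨s', hs', hs'eq⟩ := exists_strictMono_succAbove_comp (r := q)
      (hs.comp (Fin.strictMono_succAbove i)) fun j h =>
        Fin.succAbove_ne i j (hs.injective (h.trans hi.symm))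
    refine Filter.Eventually.of_forall fun c _ => ?_
    rw [familyMinor_liftFamily_of_eq η w a c hq hs hi hs'eq]
    exact ha s' hs'
  obtain ⟨s, hs', rfl⟩ := exists_strictMono_succAbove_comp hs (not_exists.1 hsq)
  by_cases hsp : ∃ i, s i = p
  · obtain ⟨i, hi⟩ := hsp
    obtain ⟨β, hβ⟩ := exists_familyMinor_liftFamily_eq (εq := εq) η w a hp hs' hi
    have hpos := ha _ (hs'.comp (Fin.strictMono_succAbove i))
    have := Filter.tendsto_atTop_add_const_left _ β
      (Filter.tendsto_id.atTop_mul_const hpos)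
    filter_upwards [this.eventually_gt_atTop 0] with c hc _
    rw [hβ]
    exact hc
  · obtain ⟨s, hs'', rfl⟩ := exists_strictMono_succAbove_comp hs' (not_exists.1 hsp)
    refine Filter.Eventually.of_forall fun c _ => ?_
    rw [familyMinor_liftFamily_succAbove]
    exact hw s hs''

theorem familyMinor_graphInsert_pos_of_liftFamily (hq : IsSignedEnd k q εq) {δ : ℝ}
    (h : ∀ s, StrictMono s → 0 < δ * familyMinor (liftFamily q p εq εp η w a c) s)
    {s : Fin k → Fin (n + 1)} (hs : StrictMono s) :
    0 < δ * familyMinor (fun j => graphInsert p η (a j)) s := by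
  obtain ⟨i, hi⟩ := hq.exists_strictMono s hs
  have := h _ hi
  rwa [familyMinor_liftFamily_of_eq η w a c hq hi (i := i) (s' := s) (by simp)
    (by ext j; simp)] at this

/-- Both the left and the right cyclic characterizations are instances of this statement, with
`(q, q.succAbove p)` the last and first, respectively the first and last, indices. -/
theorem cyclic_iff_exists_lift_isTotallyPositive (hk : 0 < k) (hkn : k + 1 ≤ n)
    (hq : IsSignedEnd k q εq) (hp : IsSignedEnd k (q.succAbove p) εp)
    (V : Submodule ℝ (Fin n → ℝ)) (hV : Module.finrank ℝ V = k) :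
    (IsTotallyPositive (k + 1) n {y | ∃ v ∈ (V : Set (Fin n → ℝ)), ∃ t : ℝ, y = v + t • w} ∧
      IsTotallyPositive k (n + 1)
        {y | ∃ v ∈ (V : Set (Fin n → ℝ)), y = p.insertNth (η v) v} ∧
      PosOriented (V : Set (Fin n → ℝ)) w) ↔
    ∃ c : ℝ, IsTotallyPositive (k + 1) (n + 2)
      {y | ∃ v ∈ V, ∃ t : ℝ, y = graphInsertZero q p η v + t • liftVector q p εq εp w c} := by
  have hginj : Function.Injective (graphInsert p η) := fun x y hxy => by
    ext i
    simpa [graphInsert] using congrFun hxy (p.succAbove i)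
  have hpsucc : ∀ {s : Fin k → Fin n}, StrictMono s → StrictMono (p.succAbove ∘ s) :=
    fun hs => (Fin.strictMono_succAbove p).comp hs
  constructor
  · rintro ⟨h1, h2, u, hwu, hu, hu0⟩
    obtain ⟨b, hb, hbpos⟩ := isTotallyPositive_iff_familyMinor.1 h2
    obtain ⟨a, rfl, rfl⟩ := exists_lift_of_span_range_eq hginj hb
    have hspan := span_range_cons_comp LinearMap.id a w
    obtain ⟨δ, hδ⟩ := (isTotallyPositive_span_range_iff (Nat.succ_pos k) _).1 (hspan ▸ h1)
    have hau : ∀ j, u ⬝ᵥ a j = 0 := fun j => hu _ (Submodule.subset_span ⟨j, rfl⟩)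
    have hδu := orientation_mul_pos (δ' := 1) hkn hwu hau hδ
      (fun s hs => by
        simpa [familyMinor_graphInsert] using hbpos _ (hpsucc hs))
      ⟨0, by omega⟩ rfl
    rw [mul_one] at hδu
    have hδ0 : 0 < δ := pos_of_mul_pos_left hδu (hu0 _ rfl).le
    obtain ⟨c, hc⟩ := exists_familyMinor_liftFamily_pos η w a hq hp
      (fun s hs => pos_of_mul_pos_right (hδ s hs) hδ0.le) hbpos
    exact ⟨c, isTotallyPositive_iff_familyMinor.2 ⟨_, span_range_cons_comp _ a _, hc⟩⟩
  · rintro ⟨c, hc⟩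
    obtain ⟨a, rfl⟩ : ∃ a : Fin k → Fin n → ℝ, Submodule.span ℝ (Set.range a) = V := by
      let B := Module.finBasisOfFinrankEq ℝ V hV
      refine ⟨fun j => B j, ?_⟩
      have := congrArg (Submodule.map V.subtype) B.span_eq
      rwa [Submodule.map_span, ← Set.range_comp, Submodule.map_subtype_top] at this
    rw [← span_range_cons_comp] at hc
    obtain ⟨δ, hδ⟩ := (isTotallyPositive_span_range_iff (Nat.succ_pos k) _).1 hc
    have hw : ∀ s, StrictMono s →
        0 < δ * familyMinor (Fin.cons w a : Fin (k + 1) → Fin n → ℝ) s := fun s hs => by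
      rw [← familyMinor_liftFamily_succAbove (q := q) (p := p) (εq := εq) (εp := εp) η w a c]
      exact hδ _ ((Fin.strictMono_succAbove q).comp ((Fin.strictMono_succAbove p).comp hs))
    have hb : ∀ s, StrictMono s → 0 < δ * familyMinor (fun j => graphInsert p η (a j)) s :=
      fun s hs => familyMinor_graphInsert_pos_of_liftFamily η w a c hq hδ hs
    have ha : ∀ s, StrictMono s → 0 < δ * familyMinor a s := fun s hs => by
      simpa [familyMinor_graphInsert] using hb _ (hpsucc hs)
    refine ⟨?_, ?_, ?_⟩
    · have := (isTotallyPositive_span_range_iff (Nat.succ_pos k) _).2 ⟨δ, hw⟩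
      exact span_range_cons_comp LinearMap.id a w ▸ this
    · have := (isTotallyPositive_span_range_iff hk _).2 ⟨δ, hb⟩
      rwa [span_range_comp] at this
    · obtain ⟨u, hwu, hu⟩ := exists_sub_mem_span_dotProduct_eq_zero
        (gramDet_self_pos (by omega) ha).ne' w
      refine ⟨u, hwu, fun v hv => ?_, fun i hi => ?_⟩
      · change u ⬝ᵥ v = 0
        have hle : Submodule.span ℝ (Set.range a) ≤ LinearMap.ker (dotProductBilin ℝ ℝ u) :=
          Submodule.span_le.2 (by rintro _ ⟨j, rfl⟩; exact hu j)
        exact hle hv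
      · exact pos_of_mul_pos_right (orientation_mul_pos hkn hwu hu hw ha i hi)
          (mul_self_nonneg δ)

end Lift

/-- Corollary 3.12: characterizations of left and right cyclic polarized
arrangements via strong lifts: `(V,η,ξ)` is left cyclic iff some strong lift (encoded by
`c ∈ ℝ`) gives a totally positive `(k+1)`-dimensional subspace of `ℝ^{n+2}`, and similarly
in the right cyclic case. -/
theorem leftRightCyclic_iff_strongLift_totallyPositive
    (n k : ℕ) (hk1 : 1 ≤ k) (hkn : k ≤ n - 1)
    (V : Submodule ℝ (Fin n → ℝ)) (hV : Module.finrank ℝ V = k)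
    (w : Fin n → ℝ) (hw : w ∉ V)
    (ξ : (Fin n → ℝ) →ₗ[ℝ] ℝ) (hξ : ∃ v ∈ V, ξ v ≠ 0) :
    (IsLeftCyclic n k (V : Set (Fin n → ℝ)) w ξ ↔
      ∃ c : ℝ, IsTotallyPositive (k + 1) (n + 2)
        {y : Fin (n + 2) → ℝ | ∃ v ∈ V, ∃ t : ℝ,
          y = Fin.cons (ξ v + t * c) (Fin.snoc (v + t • w) ((-1) ^ k * t))}) ∧
    (IsRightCyclic n k (V : Set (Fin n → ℝ)) w ξ ↔
      ∃ c : ℝ, IsTotallyPositive (k + 1) (n + 2)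
        {y : Fin (n + 2) → ℝ | ∃ v ∈ V, ∃ t : ℝ,
          y = Fin.cons t (Fin.snoc (v + t • w) ((-1) ^ k * (ξ v + t * c)))}) := by
  have hkn' : k + 1 ≤ n := by omega
  constructor
  · have h := cyclic_iff_exists_lift_isTotallyPositive (q := Fin.last (n + 1)) (p := 0) ξ w hk1
      hkn' (isSignedEnd_last k (n + 1)) (by simpa using isSignedEnd_zero k (n + 1)) V hV
    simp only [Fin.insertNth_zero'] at h
    rw [IsLeftCyclic, h]
    refine exists_congr fun c => iff_of_eq ?_
    congr! 9 with y v hv t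
    rw [Fin.cons_snoc_eq_snoc_cons]
    ext i
    induction i using Fin.lastCases with
    | last => simp [graphInsertZero, liftVector, Fin.insertNth_last', mul_comm]
    | cast i =>
      induction i using Fin.cases <;>
        simp [graphInsertZero, graphInsert, liftVector, Fin.insertNth_last', -Fin.castSucc_succ]
  · have h := cyclic_iff_exists_lift_isTotallyPositive (q := 0) (p := Fin.last n)
      (((-1 : ℝ) ^ k) • ξ) w hk1
      hkn' (isSignedEnd_zero k (n + 1)) (by simpa using isSignedEnd_last k (n + 1)) V hV
    simp only [Fin.insertNth_last', LinearMap.smul_apply, smul_eq_mul] at h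
    rw [IsRightCyclic, h]
    refine exists_congr fun c => iff_of_eq ?_
    congr! 9 with y v hv t
    ext i
    induction i using Fin.cases with
    | zero => simp [graphInsertZero, liftVector]
    | succ i =>
      induction i using Fin.lastCases <;>
        simp [graphInsertZero, graphInsert, liftVector, Fin.insertNth_last']
      ring
end

section
/- Let 1 ≤ k ≤ n, let M be an (n+1)×k real matrix all of whose k×k minors are strictly positive, and let w ∈ ℝ^{n+1} be such that all (k+1)×(k+1) minors of the matrix [w | M] (w prepended as a first column) are strictly positive; equivalently, the arrangement of n+1 hyperplanes in k-space determined by M and w is cyclic. For x ∈ ℝ^k write g_i(x) = w_i + (Mx)_i for 1 ≤ i ≤ n+1. For a sign sequence α ∈ {+1,−1}^n set Δ_α := {x ∈ ℝ^k : α_i · g_{i+1}(x) ≥ 0 for all 1 ≤ i ≤ n} and Δ_{+α} := Δ_α ∩ {x ∈ ℝ^k : g_1(x) ≥ 0}. Then: (i) Δ_{+α} = ∅ if and only if Δ_α = ∅; (ii) Δ_{+α} is nonempty and compact if and only if Δ_α is nonempty and the function g_1 is bounded above on Δ_α; (iii) Δ_{+α} is nonempty and noncompact if and only if Δ_α is nonempty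 and g_1 is not bounded above on Δ_α. -/
open scoped BigOperators

/-- The matrix `[w | M]` obtained by prepending the column `w` to `M`. -/
def prependCol (n k : ℕ) (M : Matrix (Fin (n + 1)) (Fin k) ℝ) (w : Fin (n + 1) → ℝ) :
    Matrix (Fin (n + 1)) (Fin (k + 1)) ℝ :=
  Matrix.of fun i j => Fin.cases (w i) (fun j' : Fin k => M i j') j

/-- The region `Δ_α` of the arrangement obtained by deleting the first hyperplane:
`Δ_α = {x ∈ ℝ^k : α_i · g_{i+1}(x) ≥ 0}` where `g_i(x) = w_i + (Mx)_i`. -/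
def regionDelFirst (n k : ℕ) (M : Matrix (Fin (n + 1)) (Fin k) ℝ) (w : Fin (n + 1) → ℝ)
    (α : Fin n → ℝ) : Set (Fin k → ℝ) :=
  {x | ∀ i : Fin n, 0 ≤ α i * (w i.succ + M.mulVec x i.succ)}

/-- The region `Δ_{+α} = Δ_α ∩ {g_1 ≥ 0}`. -/
def regionPlus (n k : ℕ) (M : Matrix (Fin (n + 1)) (Fin k) ℝ) (w : Fin (n + 1) → ℝ)
    (α : Fin n → ℝ) : Set (Fin k → ℝ) :=
  {x ∈ regionDelFirst n k M w α | 0 ≤ w 0 + M.mulVec x 0}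

open Filter Topology

/-- A vector annihilated by `k` rows of a matrix with positive maximal minors vanishes. -/
lemma eq_zero_of_mulVec_eq_zero_of_card_le {m k : ℕ} (M : Matrix (Fin m) (Fin k) ℝ)
    (hM : ∀ s : Fin k → Fin m, StrictMono s → 0 < (M.submatrix s id).det)
    (Z : Finset (Fin m)) (hZ : k ≤ Z.card) (v : Fin k → ℝ)
    (hv : ∀ i ∈ Z, M.mulVec v i = 0) : v = 0 := by
  obtain ⟨Y, hYZ, hY⟩ := Finset.exists_subset_card_eq hZ
  refine Matrix.eq_zero_of_mulVec_eq_zero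
    (hM (Y.orderEmbOfFin hY) (Y.orderEmbOfFin hY).strictMono).ne' ?_
  funext i
  exact hv _ (hYZ (Y.orderEmbOfFin_mem hY i))

/-- At most `k` rows of a matrix with positive maximal minors can take prescribed values. -/
lemma exists_mulVec_eq_of_card_le {m k : ℕ} (hkm : k ≤ m) (M : Matrix (Fin m) (Fin k) ℝ)
    (hM : ∀ s : Fin k → Fin m, StrictMono s → 0 < (M.submatrix s id).det)
    (Z : Finset (Fin m)) (hZ : Z.card ≤ k) (c : Fin m → ℝ) :
    ∃ u : Fin k → ℝ, ∀ i ∈ Z, M.mulVec u i = c i := by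
  obtain ⟨Y, hZY, hY⟩ := Finset.exists_superset_card_eq hZ (by simpa using hkm)
  set s := Y.orderEmbOfFin hY with hs
  have hdet : IsUnit (M.submatrix s id).det := (hM s s.strictMono).ne'.isUnit
  refine ⟨(M.submatrix s id)⁻¹.mulVec (c ∘ s), fun i hi => ?_⟩
  have hi' : i ∈ Set.range s := by
    rw [hs, Finset.range_orderEmbOfFin]; exact hZY hi
  obtain ⟨j, rfl⟩ := hi'
  have h : (M.submatrix s id).mulVec ((M.submatrix s id)⁻¹.mulVec (c ∘ s)) = c ∘ s := by
    rw [Matrix.mulVec_mulVec, Matrix.mul_nonsing_inv _ hdet, Matrix.one_mulVec]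
  exact congrFun h j

/-- A nonempty polyhedron cut out by an injective system of affine inequalities has a vertex. -/
lemma exists_vertex_of_nonempty {ι E : Type*} [Fintype ι] [AddCommGroup E] [Module ℝ E]
    (A : E →ₗ[ℝ] ι → ℝ) (hA : Function.Injective A) (b : ι → ℝ)
    (hne : ∃ x, ∀ i, 0 ≤ b i + A x i) :
    ∃ x, (∀ i, 0 ≤ b i + A x i) ∧ ∀ v, (∀ i, b i + A x i = 0 → A v i = 0) → v = 0 := by
  classical
  let c : E → ℕ := fun x => (Finset.univ.filter fun i => b i + A x i = 0).card
  have hbdd : ∀ x, c x ≤ Fintype.card ι := fun x => Finset.card_le_univ _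
  obtain ⟨x, hx, hmax⟩ : ∃ x, (∀ i, 0 ≤ b i + A x i) ∧
      ∀ y, (∀ i, 0 ≤ b i + A y i) → c y ≤ c x := by
    obtain ⟨x, hx, hmin⟩ := (measure fun x => Fintype.card ι - c x).wf.has_min
      {x | ∀ i, 0 ≤ b i + A x i} hne
    refine ⟨x, hx, fun y hy => ?_⟩
    have h : ¬ Fintype.card ι - c y < Fintype.card ι - c x := hmin y hy
    have := hbdd x
    have := hbdd y
    omega
  refine ⟨x, hx, fun v hv => ?_⟩
  by_contra hv0
  obtain ⟨u, hu, j, hj⟩ : ∃ u, (∀ i, b i + A x i = 0 → A u i = 0) ∧ ∃ j, A u j < 0 := by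
    have : A v ≠ 0 := fun h => hv0 (hA (by rw [h, map_zero]))
    obtain ⟨j, hj⟩ := Function.ne_iff.1 this
    rcases lt_or_gt_of_ne hj with h | h
    · exact ⟨v, hv, j, h⟩
    · refine ⟨-v, fun i hi => by simp [hv i hi], j, ?_⟩
      simpa using h
  obtain ⟨l, hl, hlmin⟩ := Finset.exists_min_image (Finset.univ.filter fun i => A u i < 0)
    (fun i => (b i + A x i) / -A u i) ⟨j, by simpa using hj⟩
  have hl0 : A u l < 0 := by simpa using hl
  set t := (b l + A x l) / -A u l with ht
  have ht0 : 0 ≤ t := div_nonneg (hx l) (by linarith)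
  have hval : ∀ i, b i + A (x + t • u) i = b i + A x i + t * A u i := fun i => by
    simp [add_assoc]
  have hmem : ∀ i, 0 ≤ b i + A (x + t • u) i := by
    intro i
    rw [hval]
    rcases lt_or_ge (A u i) 0 with h | h
    · have := hlmin i (by simpa using h)
      rw [le_div_iff₀ (by linarith)] at this
      linarith
    · have := hx i
      positivity
  have hlt : c x < c (x + t • u) := by
    refine Finset.card_lt_card (Finset.ssubset_iff_of_subset ?_ |>.2 ⟨l, ?_, ?_⟩)
    · intro i hi
      simp only [Finset.mem_filter, Finset.mem_univ, true_and] at hi ⊢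
      rw [hval, hi, hu i hi]; simp
    · simp only [Finset.mem_filter, Finset.mem_univ, true_and]
      rw [hval, ht]
      have := hl0.ne
      field_simp
      ring
    · simp only [Finset.mem_filter, Finset.mem_univ, true_and]
      exact fun h => hl0.ne (hu l h)
  exact absurd (hmax _ hmem) (not_le.2 hlt)

/-- A polyhedron with trivial recession cone is bounded. -/
lemma isBounded_of_recession_trivial {ι E : Type*} [NormedAddCommGroup E] [NormedSpace ℝ E]
    [FiniteDimensional ℝ E] (A : E →ₗ[ℝ] ι → ℝ) (b : ι → ℝ)
    (hA : ∀ v, (∀ i, 0 ≤ A v i) → v = 0) :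
    Bornology.IsBounded {x | ∀ i, 0 ≤ b i + A x i} := by
  by_contra hunb
  have hex : ∀ m : ℕ, ∃ x, (∀ i, 0 ≤ b i + A x i) ∧ (m : ℝ) + 1 < ‖x‖ := by
    intro m
    by_contra! h
    exact hunb (isBounded_iff_forall_norm_le.2 ⟨m + 1, fun x hx => h x hx⟩)
  choose x hx hxn using hex
  have hpos : ∀ m, 0 < ‖x m‖ := fun m => 
    lt_trans (by positivity) (hxn m)
  have : ProperSpace E := FiniteDimensional.proper ℝ E
  obtain ⟨v, hv, φ, hφ, hlim⟩ := (isCompact_sphere (0 : E) 1).tendsto_subseq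
    (x := fun m => ‖x m‖⁻¹ • x m) (fun m => by simp [norm_smul, (hpos m).ne'])
  have hv1 : ‖v‖ = 1 := by simpa using hv
  have hnorm : Tendsto (fun m => ‖x m‖) atTop atTop :=
    tendsto_atTop_mono (fun m => by have := hxn m; linarith) tendsto_natCast_atTop_atTop
  have hinv : Tendsto (fun m => ‖x (φ m)‖⁻¹) atTop (𝓝 0) :=
    tendsto_inv_atTop_zero.comp (hnorm.comp hφ.tendsto_atTop)
  have hv0 : v = 0 := by
    refine hA v fun i => ?_
    have hcont : Continuous fun y : E => A y i :=
      LinearMap.continuous_of_finiteDimensional ((LinearMap.proj i).comp A)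
    have h := (hinv.mul_const (b i)).add ((hcont.tendsto v).comp hlim)
    rw [zero_mul, zero_add] at h
    refine ge_of_tendsto' h fun m => ?_
    have := mul_nonneg (inv_nonneg.2 (hpos (φ m)).le) (hx (φ m) i)
    simpa [mul_add] using this
  rw [hv0, norm_zero] at hv1
  exact zero_ne_one hv1

/-- Every vertex of the affine arrangement that avoids the first hyperplane lies strictly on its
positive side. -/
lemma pos_of_vertex {n k : ℕ} (M : Matrix (Fin (n + 1)) (Fin k) ℝ) (w : Fin (n + 1) → ℝ)
    (hM : ∀ s : Fin k → Fin (n + 1), StrictMono s → 0 < (M.submatrix s id).det)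
    (hMw : ∀ s : Fin (k + 1) → Fin (n + 1), StrictMono s →
      0 < ((prependCol n k M w).submatrix s id).det)
    (s : Fin k → Fin n) (hs : StrictMono s) (x : Fin k → ℝ)
    (hx : ∀ i, w (s i).succ + M.mulVec x (s i).succ = 0) :
    0 < w 0 + M.mulVec x 0 := by
  have hs' : StrictMono fun i => (s i).succ := fun i j h => Fin.succ_lt_succ_iff.2 (hs h)
  set t : Fin (k + 1) → Fin (n + 1) := Fin.cons 0 fun i => (s i).succ with ht
  have htm : StrictMono t := by
    intro i j hij
    cases j using Fin.cases with
    | zero => exact absurd hij (Fin.not_lt_zero i)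
    | succ j =>
      cases i using Fin.cases with
      | zero => simp [ht]
      | succ i => simpa [ht] using hs (Fin.succ_lt_succ_iff.1 hij)
  have h1 := hMw t htm
  have h2 := hM _ hs'
  set N := (prependCol n k M w).submatrix t id with hN
  have hcol : ∀ i, ∑ j, (Fin.cons 1 x : Fin (k + 1) → ℝ) j • N i j =
      w (t i) + M.mulVec x (t i) := by
    intro i
    rw [Fin.sum_univ_succ]
    simp [hN, prependCol, Matrix.mulVec, dotProduct, mul_comm]
  have h3 := Matrix.det_updateCol_sum N 0 (Fin.cons 1 x : Fin (k + 1) → ℝ)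
  simp only [hcol, Fin.cons_zero, one_smul] at h3
  rw [Matrix.det_succ_column_zero, Fin.sum_univ_succ] at h3
  have hsub : (N.updateCol 0 fun i => w (t i) + M.mulVec x (t i)).submatrix
      (Fin.succAbove 0) Fin.succ = M.submatrix (fun i => (s i).succ) id := by
    ext i j
    simp [hN, ht, prependCol]
  rw [hsub, Finset.sum_eq_zero (fun i _ => by simp [ht, hx])] at h3
  simp [ht] at h3
  rw [← h3] at h1
  exact pos_of_mul_pos_left h1 h2.le

/-- A nonzero recession direction of `Δ_{+α}` can be perturbed to a recession direction of `Δ_α`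
along which `g_1` strictly increases. -/
lemma exists_increasing_recession {n k : ℕ} (hkn : k ≤ n + 1) (M : Matrix (Fin (n + 1)) (Fin k) ℝ)
    (hM : ∀ s : Fin k → Fin (n + 1), StrictMono s → 0 < (M.submatrix s id).det)
    (α : Fin n → ℝ) (v : Fin k → ℝ) (hv : v ≠ 0) (hv0 : 0 ≤ M.mulVec v 0)
    (hvα : ∀ i, 0 ≤ α i * M.mulVec v i.succ) :
    ∃ u, 0 < M.mulVec u 0 ∧ ∀ i, 0 ≤ α i * M.mulVec u i.succ := by
  classical
  rcases hv0.lt_or_eq with h0 | h0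
  · exact ⟨v, h0, hvα⟩
  set Z := Finset.univ.filter fun i => M.mulVec v i = 0 with hZ
  have hcard : Z.card ≤ k := by
    by_contra! h
    exact hv (eq_zero_of_mulVec_eq_zero_of_card_le M hM Z h.le v fun i hi => by
      simpa [hZ] using hi)
  obtain ⟨u, hu⟩ := exists_mulVec_eq_of_card_le hkn M hM Z hcard (Pi.single 0 1)
  have hval : ∀ (ε : ℝ) i, M.mulVec (v + ε • u) i = M.mulVec v i + ε * M.mulVec u i :=
    fun ε i => by simp [Matrix.mulVec_add, Matrix.mulVec_smul]
  have hev : ∀ᶠ ε : ℝ in 𝓝[>] 0, ∀ i, 0 ≤ α i * M.mulVec (v + ε • u) i.succ := by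
    refine eventually_all.2 fun i => ?_
    simp only [hval]
    rcases (hvα i).lt_or_eq with h | h
    · have hc : Continuous fun ε : ℝ => α i * (M.mulVec v i.succ + ε * M.mulVec u i.succ) := by
        fun_prop
      refine nhdsWithin_le_nhds ?_
      filter_upwards [(hc.tendsto 0).eventually_const_lt (by simpa using h)] with ε hε using hε.le
    · refine Eventually.of_forall fun ε => ?_
      rcases mul_eq_zero.1 h.symm with h | h
      · simp [h]
      · rw [h, hu i.succ (by simp [hZ, h])]
        simp
  obtain ⟨ε, hε, hε0⟩ := (hev.and self_mem_nhdsWithin).exists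
  refine ⟨v + ε • u, ?_, hε⟩
  rw [hval, ← h0, hu 0 (by simp [hZ, ← h0])]
  simpa using hε0

/-- A nonempty region `Δ_α` contains a point with `g_1 > 0`. -/
lemma regionPlus_nonempty {n k : ℕ} (hkn : k ≤ n)
    (M : Matrix (Fin (n + 1)) (Fin k) ℝ) (w : Fin (n + 1) → ℝ)
    (hM : ∀ s : Fin k → Fin (n + 1), StrictMono s → 0 < (M.submatrix s id).det)
    (hMw : ∀ s : Fin (k + 1) → Fin (n + 1), StrictMono s →
      0 < ((prependCol n k M w).submatrix s id).det)
    (α : Fin n → ℝ) (hα : ∀ i, α i ≠ 0) (hne : (regionDelFirst n k M w α).Nonempty) :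
    (regionPlus n k M w α).Nonempty := by
  classical
  let A : (Fin k → ℝ) →ₗ[ℝ] Fin n → ℝ :=
    LinearMap.pi fun i => α i • (LinearMap.proj i.succ ∘ₗ M.mulVecLin)
  have hAv : ∀ v i, A v i = α i * M.mulVec v i.succ := fun v i => rfl
  have hA : Function.Injective A := by
    refine (injective_iff_map_eq_zero A).2 fun v hv => ?_
    refine eq_zero_of_mulVec_eq_zero_of_card_le M hM
      (Finset.univ.map (Fin.succEmb n)) (by simpa using hkn) v fun i hi => ?_
    obtain ⟨j, -, rfl⟩ := Finset.mem_map.1 hi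
    have h := congrFun hv j
    rw [hAv] at h
    exact (mul_eq_zero.1 h).resolve_left (hα j)
  obtain ⟨x, hx, hvert⟩ := exists_vertex_of_nonempty A hA (fun i => α i * w i.succ) (by
    obtain ⟨x, hx⟩ := hne
    exact ⟨x, fun i => by rw [hAv, ← mul_add]; exact hx i⟩)
  have hxα : x ∈ regionDelFirst n k M w α := fun i => by rw [mul_add]; exact hx i
  set Z := Finset.univ.filter fun i : Fin n => w i.succ + M.mulVec x i.succ = 0 with hZ
  have hcard : k ≤ Z.card := by
    by_contra! h
    let B : (Fin k → ℝ) →ₗ[ℝ] Z → ℝ := LinearMap.pi fun i => LinearMap.proj i.1 ∘ₗ A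
    have hker : LinearMap.ker B ≠ ⊥ := LinearMap.ker_ne_bot_of_finrank_lt (by simpa using h)
    obtain ⟨v, hv, hv0⟩ := Submodule.exists_mem_ne_zero_of_ne_bot hker
    refine hv0 (hvert v fun i hi => ?_)
    rw [hAv, ← mul_add] at hi
    exact congrFun (LinearMap.mem_ker.1 hv)
      ⟨i, by simpa [hZ] using (mul_eq_zero.1 hi).resolve_left (hα i)⟩
  obtain ⟨Y, hYZ, hY⟩ := Finset.exists_subset_card_eq hcard
  refine ⟨x, hxα, (pos_of_vertex M w hM hMw (Y.orderEmbOfFin hY)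
    (Y.orderEmbOfFin hY).strictMono x fun i => ?_).le⟩
  simpa [hZ] using hYZ (Y.orderEmbOfFin_mem hY i)

/-- If `g_1` is bounded above on a nonempty `Δ_α`, then `Δ_{+α}` is bounded. -/
lemma isBounded_regionPlus {n k : ℕ} (hkn : k ≤ n)
    (M : Matrix (Fin (n + 1)) (Fin k) ℝ) (w : Fin (n + 1) → ℝ)
    (hM : ∀ s : Fin k → Fin (n + 1), StrictMono s → 0 < (M.submatrix s id).det)
    (α : Fin n → ℝ) (hne : (regionDelFirst n k M w α).Nonempty)
    (hb : BddAbove ((fun x => w 0 + M.mulVec x 0) '' regionDelFirst n k M w α)) :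
    Bornology.IsBounded (regionPlus n k M w α) := by
  let β : Fin (n + 1) → ℝ := Fin.cons 1 α
  let A : (Fin k → ℝ) →ₗ[ℝ] Fin (n + 1) → ℝ :=
    LinearMap.pi fun i => β i • (LinearMap.proj i ∘ₗ M.mulVecLin)
  have hAv : ∀ v i, A v i = β i * M.mulVec v i := fun v i => rfl
  refine (isBounded_of_recession_trivial A (fun i => β i * w i) fun v hv => ?_).subset
    fun x hx i => ?_
  · by_contra hv0
    have h0 : 0 ≤ M.mulVec v 0 := by simpa [hAv, β] using hv 0
    obtain ⟨u, hu0, hu⟩ := exists_increasing_recession (by omega) M hM α v hv0 h0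
      fun i => by simpa [hAv, β] using hv i.succ
    obtain ⟨x, hx⟩ := hne
    obtain ⟨C, hC⟩ := hb
    have hval : ∀ (t : ℝ) i, M.mulVec (x + t • u) i = M.mulVec x i + t * M.mulVec u i :=
      fun t i => by simp [Matrix.mulVec_add, Matrix.mulVec_smul]
    have hray : ∀ t : ℝ, 0 ≤ t → w 0 + (M.mulVec x 0 + t * M.mulVec u 0) ≤ C := by
      intro t ht
      rw [← hval]
      refine hC ⟨x + t • u, fun i => ?_, rfl⟩
      rw [hval]
      have h1 := hx i
      have h2 := mul_nonneg ht (hu i)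
      linarith
    have h1 := hray 0 le_rfl
    have h2 := hray ((C - (w 0 + M.mulVec x 0) + 1) / M.mulVec u 0)
      (div_nonneg (by linarith) hu0.le)
    rw [div_mul_cancel₀ _ hu0.ne'] at h2
    linarith
  · rw [hAv, ← mul_add]
    cases i using Fin.cases with
    | zero => simpa [β] using hx.2
    | succ i => simpa [β] using hx.1 i

lemma isClosed_regionPlus (n k : ℕ) (M : Matrix (Fin (n + 1)) (Fin k) ℝ) (w : Fin (n + 1) → ℝ)
    (α : Fin n → ℝ) : IsClosed (regionPlus n k M w α) := by
  have hc : ∀ i, Continuous fun x => w i + M.mulVec x i := fun i =>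
    continuous_const.add ((continuous_apply i).comp (Continuous.matrix_mulVec continuous_const
      continuous_id))
  have h1 : IsClosed (regionDelFirst n k M w α) := by
    simp only [regionDelFirst, Set.ofPred_forall]
    exact isClosed_iInter fun i => isClosed_le continuous_const (continuous_const.mul (hc i.succ))
  exact h1.inter (isClosed_le continuous_const (hc 0))

/-- Lemma 3.17: for a cyclic arrangement of `n+1` hyperplanes in `k`-space
(given by a totally positive matrix `M` and a vector `w` with `[w | M]` totally positive),
and any sign sequence `α ∈ {+1,−1}^n`: (i) `Δ_{+α}` is empty iff `Δ_α` is empty;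
(ii) `Δ_{+α}` is nonempty and compact iff `Δ_α` is nonempty and `g_1` is bounded above on it;
(iii) `Δ_{+α}` is nonempty and noncompact iff `Δ_α` is nonempty and `g_1` is unbounded above
on it. -/
theorem regionPlus_empty_compact_characterization
    (n k : ℕ) (hk1 : 1 ≤ k) (hkn : k ≤ n)
    (M : Matrix (Fin (n + 1)) (Fin k) ℝ) (w : Fin (n + 1) → ℝ)
    (hM : ∀ s : Fin k → Fin (n + 1), StrictMono s → 0 < (M.submatrix s id).det)
    (hMw : ∀ s : Fin (k + 1) → Fin (n + 1), StrictMono s →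
      0 < ((prependCol n k M w).submatrix s id).det)
    (α : Fin n → ℝ) (hα : ∀ i, α i = 1 ∨ α i = -1) :
    (regionPlus n k M w α = ∅ ↔ regionDelFirst n k M w α = ∅) ∧
    ((regionPlus n k M w α).Nonempty ∧ IsCompact (regionPlus n k M w α) ↔
      (regionDelFirst n k M w α).Nonempty ∧
        BddAbove ((fun x => w 0 + M.mulVec x 0) '' regionDelFirst n k M w α)) ∧
    ((regionPlus n k M w α).Nonempty ∧ ¬ IsCompact (regionPlus n k M w α) ↔
      (regionDelFirst n k M w α).Nonempty ∧
        ¬ BddAbove ((fun x => w 0 + M.mulVec x 0) '' regionDelFirst n k M w α)) := by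
  have hα0 : ∀ i, α i ≠ 0 := fun i => by rcases hα i with h | h <;> simp [h]
  have hne : (regionPlus n k M w α).Nonempty ↔ (regionDelFirst n k M w α).Nonempty :=
    ⟨fun ⟨x, hx⟩ => ⟨x, hx.1⟩, regionPlus_nonempty hkn M w hM hMw α hα0⟩
  have hcpt : (regionDelFirst n k M w α).Nonempty → (IsCompact (regionPlus n k M w α) ↔
      BddAbove ((fun x => w 0 + M.mulVec x 0) '' regionDelFirst n k M w α)) := by
    refine fun h => ⟨fun hK => ?_, fun hb => Metric.isCompact_of_isClosed_isBounded
      (isClosed_regionPlus n k M w α) (isBounded_regionPlus hkn M w hM α h hb)⟩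
    have hc : Continuous fun x : Fin k → ℝ => w 0 + M.mulVec x 0 :=
      continuous_const.add ((continuous_apply 0).comp (Continuous.matrix_mulVec continuous_const
        continuous_id))
    obtain ⟨C, hC⟩ := hK.bddAbove_image hc.continuousOn
    refine ⟨max C 0, ?_⟩
    rintro _ ⟨x, hx, rfl⟩
    rcases le_total 0 (w 0 + M.mulVec x 0) with h0 | h0
    · exact le_max_of_le_left (hC ⟨x, ⟨hx, h0⟩, rfl⟩)
    · exact le_max_of_le_right h0
  refine ⟨?_, ?_, ?_⟩
  · rw [← not_iff_not, ← ne_eq, ← ne_eq, ← Set.nonempty_iff_ne_empty,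
      ← Set.nonempty_iff_ne_empty]
    exact hne
  · rw [hne]
    exact and_congr_right hcpt
  · rw [hne]
    exact and_congr_right fun h => not_congr (hcpt h)
end

section
/- Let 1 ≤ k ≤ n, let M be an (n+1)×k real matrix all of whose k×k minors are strictly positive, and let w ∈ ℝ^{n+1} be such that all (k+1)×(k+1) minors of the matrix [w | M] (w prepended as a first column) are strictly positive; equivalently, the arrangement of n+1 hyperplanes in k-space determined by M and w is cyclic. For x ∈ ℝ^k write g_i(x) = w_i + (Mx)_i for 1 ≤ i ≤ n+1. For a sign sequence α ∈ {+1,−1}^n set Δ_α := {x ∈ ℝ^k : α_i · g_i(x) ≥ 0 for all 1 ≤ i ≤ n} and Δ_{α(−1)^k} := Δ_α ∩ {x ∈ ℝ^k : (−1)^k · g_{n+1}(x) ≥ 0}. Then: (i) Δ_{α(−1)^k} = ∅ if and only if Δ_α = ∅; (ii) Δ_{α(−1)^k} is nonempty and compact if and only if Δ_α is nonempty and the function (−1)^k · g_{n+1} is bounded above on Δ_α; (iii) Δ_{α(−1)^k} is nonempty and noncompact if and only if Δ_α is nonempty and (−1)^k · g_{n+1} is not bounded above on Δ_α. -/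
open scoped BigOperators

/-- The region `Δ_α` of the arrangement obtained by deleting the last hyperplane:
`Δ_α = {x ∈ ℝ^k : α_i · g_i(x) ≥ 0, 1 ≤ i ≤ n}` where `g_i(x) = w_i + (Mx)_i`. -/
def regionDelLast (n k : ℕ) (M : Matrix (Fin (n + 1)) (Fin k) ℝ) (w : Fin (n + 1) → ℝ)
    (α : Fin n → ℝ) : Set (Fin k → ℝ) :=
  {x | ∀ i : Fin n, 0 ≤ α i * (w i.castSucc + M.mulVec x i.castSucc)}

/-- The region `Δ_{α(−1)^k} = Δ_α ∩ {(−1)^k · g_{n+1} ≥ 0}`. -/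
def regionSnocSign (n k : ℕ) (M : Matrix (Fin (n + 1)) (Fin k) ℝ) (w : Fin (n + 1) → ℝ)
    (α : Fin n → ℝ) : Set (Fin k → ℝ) :=
  {x ∈ regionDelLast n k M w α |
    0 ≤ (-1 : ℝ) ^ k * (w (Fin.last n) + M.mulVec x (Fin.last n))}

open Matrix in
/-- A matrix with nonvanishing maximal minors takes arbitrary values on any `k` rows. -/
theorem exists_mulVec_eq_on_of_minors_ne_zero {m k : ℕ} {A : Matrix (Fin m) (Fin k) ℝ}
    (hA : ∀ s : Fin k → Fin m, StrictMono s → (A.submatrix s id).det ≠ 0)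
    {t : Finset (Fin m)} (ht : t.card = k) (b : Fin m → ℝ) :
    ∃ y, ∀ i ∈ t, (A *ᵥ y) i = b i := by
  set e := t.orderEmbOfFin ht
  have hdet : IsUnit (A.submatrix e id).det := (hA e e.strictMono).isUnit
  refine ⟨(A.submatrix e id)⁻¹ *ᵥ (b ∘ e), fun i hi => ?_⟩
  obtain ⟨j, rfl⟩ : i ∈ Set.range e := by
    rw [Finset.range_orderEmbOfFin]
    exact hi
  have h : A.submatrix e id *ᵥ ((A.submatrix e id)⁻¹ *ᵥ (b ∘ e)) = b ∘ e := by
    rw [mulVec_mulVec, mul_nonsing_inv _ hdet, one_mulVec]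
  exact congrFun h j

open Matrix in
/-- A nonzero vector in the column span of a matrix with nonvanishing maximal minors has fewer
than `k` zeros. -/
theorem card_zeros_mulVec_lt_of_minors_ne_zero {m k : ℕ} {A : Matrix (Fin m) (Fin k) ℝ}
    (hA : ∀ s : Fin k → Fin m, StrictMono s → (A.submatrix s id).det ≠ 0)
    {y : Fin k → ℝ} (hy : y ≠ 0) :
    (Finset.univ.filter fun i => (A *ᵥ y) i = 0).card < k := by
  by_contra! hle
  obtain ⟨t, hts, ht⟩ := Finset.exists_subset_card_eq hle
  set e := t.orderEmbOfFin ht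
  refine hy (eq_zero_of_mulVec_eq_zero (hA e e.strictMono) (funext fun j => ?_))
  exact (Finset.mem_filter.1 (hts (t.orderEmbOfFin_mem ht j))).2

open Matrix in
/-- If the column span of a matrix with nonvanishing maximal minors contains a nonzero vector
weakly compatible with the signs `σ`, then it contains one which is moreover strictly compatible
at a prescribed index. -/
theorem exists_mulVec_sign_pos_of_minors_ne_zero {m k : ℕ} (hkm : k ≤ m)
    {A : Matrix (Fin m) (Fin k) ℝ}
    (hA : ∀ s : Fin k → Fin m, StrictMono s → (A.submatrix s id).det ≠ 0)
    {σ : Fin m → ℝ} {y : Fin k → ℝ} (hy : y ≠ 0) (hσy : ∀ i, 0 ≤ σ i * (A *ᵥ y) i)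
    {j : Fin m} (hj : σ j ≠ 0) :
    ∃ z, (∀ i, 0 ≤ σ i * (A *ᵥ z) i) ∧ 0 < σ j * (A *ᵥ z) j := by
  obtain ⟨t, hZt, -, ht⟩ := Finset.exists_subsuperset_card_eq
    (Finset.subset_univ (Finset.univ.filter fun i => (A *ᵥ y) i = 0))
    (card_zeros_mulVec_lt_of_minors_ne_zero hA hy).le (by simpa using hkm)
  obtain ⟨v, hv⟩ := exists_mulVec_eq_on_of_minors_ne_zero hA ht σ
  have key : ∀ i, ∀ᶠ δ in nhdsWithin (0 : ℝ) (Set.Ioi 0),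
      0 ≤ σ i * (A *ᵥ (y + δ • v)) i ∧ (σ i ≠ 0 → 0 < σ i * (A *ᵥ (y + δ • v)) i) := by
    intro i
    simp only [mulVec_add, mulVec_smul, Pi.add_apply, Pi.smul_apply, smul_eq_mul]
    by_cases hσ : σ i = 0
    · simp [hσ]
    suffices ∀ᶠ δ in nhdsWithin (0 : ℝ) (Set.Ioi 0),
        0 < σ i * ((A *ᵥ y) i + δ * (A *ᵥ v) i) from this.mono fun δ h => ⟨h.le, fun _ => h⟩
    by_cases hi : (A *ᵥ y) i = 0
    · rw [hi, hv i (hZt (by simpa using hi))]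
      filter_upwards [self_mem_nhdsWithin] with δ hδ
      have : 0 < δ * (σ i * σ i) := mul_pos hδ (mul_self_pos.2 hσ)
      linarith
    · have hpos : 0 < σ i * (A *ᵥ y) i := (hσy i).lt_of_ne' (mul_ne_zero hσ hi)
      have hcont : Continuous fun δ : ℝ => σ i * ((A *ᵥ y) i + δ * (A *ᵥ v) i) := by fun_prop
      exact nhdsWithin_le_nhds (hcont.continuousAt.eventually_const_lt (by simpa using hpos))
  obtain ⟨δ, hδ⟩ := (Filter.eventually_all.2 key).exists
  exact ⟨y + δ • v, fun i => (hδ i).1, (hδ j).2 hj⟩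

open Matrix in
/-- A polyhedron with trivial recession cone is bounded. -/
theorem isBounded_of_recession_cone_trivial {ι : Type*} [Fintype ι] {k : ℕ}
    (A : Matrix ι (Fin k) ℝ) (w σ : ι → ℝ)
    (h : ∀ y, (∀ i, 0 ≤ σ i * (A *ᵥ y) i) → y = 0) :
    Bornology.IsBounded {x | ∀ i, 0 ≤ σ i * (w i + (A *ᵥ x) i)} := by
  set f : (Fin k → ℝ) → ℝ := fun y => ∑ i, max 0 (-(σ i * (A *ᵥ y) i)) with hf
  have hf0 : ∀ y, 0 ≤ f y := fun y => Finset.sum_nonneg fun i _ => le_max_left _ _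
  have hcont : Continuous f := by
    refine continuous_finsetSum _ fun i _ => continuous_const.max ?_
    exact (continuous_const.mul
      ((continuous_apply i).comp (continuous_const.matrix_mulVec continuous_id))).neg
  have hpos : ∀ y ∈ Metric.sphere (0 : Fin k → ℝ) 1, 0 < f y := by
    intro y hy
    refine (hf0 y).lt_of_ne' fun h0 => ?_
    have hy0 : y = 0 := h y fun i => by
      have := (Finset.sum_eq_zero_iff_of_nonneg fun i _ => le_max_left _ _).1 h0 i
        (Finset.mem_univ i)
      linarith [le_max_right 0 (-(σ i * (A *ᵥ y) i))]
    simp [hy0] at hy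
  obtain ⟨δ, hδ, hδf⟩ : ∃ δ > 0, ∀ y ∈ Metric.sphere (0 : Fin k → ℝ) 1, δ ≤ f y := by
    rcases (Metric.sphere (0 : Fin k → ℝ) 1).eq_empty_or_nonempty with he | hne
    · exact ⟨1, one_pos, by simp [he]⟩
    · obtain ⟨y, hy, hmin⟩ :=
        (isCompact_sphere (0 : Fin k → ℝ) 1).exists_isMinOn hne hcont.continuousOn
      exact ⟨f y, hpos y hy, fun z hz => hmin hz⟩
  have hhom : ∀ c : ℝ, 0 ≤ c → ∀ y, f (c • y) = c * f y := by
    intro c hc y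
    simp only [hf, Finset.mul_sum, mulVec_smul, Pi.smul_apply, smul_eq_mul]
    refine Finset.sum_congr rfl fun i _ => ?_
    rw [mul_max_of_nonneg _ _ hc, mul_zero]
    ring_nf
  refine (Metric.isBounded_closedBall (x := (0 : Fin k → ℝ))
    (r := (∑ i, |σ i * w i|) / δ)).subset fun x hx => ?_
  rw [mem_closedBall_zero_iff, le_div_iff₀ hδ]
  rcases eq_or_ne x 0 with rfl | hx0
  · simpa using Finset.sum_nonneg fun i _ => abs_nonneg (σ i * w i)
  have hn : 0 < ‖x‖ := norm_pos_iff.2 hx0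
  calc ‖x‖ * δ ≤ ‖x‖ * f (‖x‖⁻¹ • x) :=
        mul_le_mul_of_nonneg_left (hδf _ (by simp [norm_smul, hn.ne'])) hn.le
    _ = f x := by rw [← hhom _ hn.le, smul_smul, mul_inv_cancel₀ hn.ne', one_smul]
    _ ≤ ∑ i, |σ i * w i| := Finset.sum_le_sum fun i _ => max_le (abs_nonneg _) (by
        have := hx i
        rw [mul_add] at this
        linarith [le_abs_self (σ i * w i)])

open Matrix in
/-- The region `Δ_{α(−1)^k}` as the region of the full arrangement. -/
theorem regionSnocSign_eq (n k : ℕ) (M : Matrix (Fin (n + 1)) (Fin k) ℝ) (w : Fin (n + 1) → ℝ)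
    (α : Fin n → ℝ) :
    regionSnocSign n k M w α =
      {x | ∀ i, 0 ≤ Fin.snoc (α := fun _ => ℝ) α ((-1) ^ k) i * (w i + (M *ᵥ x) i)} := by
  ext x
  simp [regionSnocSign, regionDelLast, Fin.forall_fin_succ']

open Matrix in
/-- At a point on the hyperplanes indexed by `s 0 < ⋯ < s (k - 1)`, the value of `(-1)^k g_{s k}` is
the quotient of a maximal minor of `[w | M]` by one of `M`. -/
theorem det_prependCol_submatrix_eq {n k : ℕ} (M : Matrix (Fin (n + 1)) (Fin k) ℝ)
    (w : Fin (n + 1) → ℝ) (s : Fin (k + 1) → Fin (n + 1)) {x : Fin k → ℝ}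
    (hx : ∀ j : Fin k, w (s j.castSucc) + (M *ᵥ x) (s j.castSucc) = 0) :
    ((prependCol n k M w).submatrix s id).det =
      (M.submatrix (s ∘ Fin.castSucc) id).det *
        ((-1) ^ k * (w (s (Fin.last k)) + (M *ᵥ x) (s (Fin.last k)))) := by
  set B := (prependCol n k M w).submatrix s id with hB
  have hmul : ∀ i, (B *ᵥ Fin.cons 1 x) i = w (s i) + (M *ᵥ x) (s i) := by
    intro i
    simp [hB, prependCol, mulVec, dotProduct, Fin.sum_univ_succ]
  have hBx : B *ᵥ Fin.cons 1 x =
      Pi.single (Fin.last k) (w (s (Fin.last k)) + (M *ᵥ x) (s (Fin.last k))) := by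
    funext i
    rw [hmul]
    refine Fin.lastCases ?_ (fun j => ?_) i
    · simp
    · rw [hx j, Pi.single_eq_of_ne (Fin.castSucc_lt_last j).ne]
  have hsub : B.submatrix Fin.castSucc Fin.succ = M.submatrix (s ∘ Fin.castSucc) id := by
    ext i j
    simp [hB, prependCol]
  have h := congrFun (congrArg (B.adjugate *ᵥ ·) hBx) 0
  simp only [mulVec_mulVec, adjugate_mul, smul_mulVec, one_mulVec, mulVec_single,
    Pi.smul_apply, Fin.cons_zero, smul_eq_mul, mul_one, col_apply,
    adjugate_fin_succ_eq_det_submatrix, Fin.succAbove_last, MulOpposite.smul_eq_mul_unop,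
    MulOpposite.unop_op] at h
  rw [Fin.succAbove_zero, hsub] at h
  rw [h]
  simp
  ring

open Matrix in
/-- In a cyclic arrangement, a nonempty region of the arrangement without the last hyperplane
meets the half-space `(−1)^k g_{n+1} ≥ 0`. -/
theorem regionSnocSign_nonempty_of_regionDelLast_nonempty {n k : ℕ} (hkn : k ≤ n)
    {M : Matrix (Fin (n + 1)) (Fin k) ℝ} {w : Fin (n + 1) → ℝ}
    (hM : ∀ s : Fin k → Fin (n + 1), StrictMono s → 0 < (M.submatrix s id).det)
    (hMw : ∀ s : Fin (k + 1) → Fin (n + 1), StrictMono s →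
      0 < ((prependCol n k M w).submatrix s id).det)
    {α : Fin n → ℝ} (h : (regionDelLast n k M w α).Nonempty) :
    (regionSnocSign n k M w α).Nonempty := by
  rw [regionSnocSign_eq]
  set σ : Fin (n + 1) → ℝ := Fin.snoc (α := fun _ => ℝ) α ((-1) ^ k) with hσ
  have hconv : ∀ i ∈ (Finset.univ : Finset (Fin (n + 1))),
      Convex ℝ {x : Fin k → ℝ | 0 ≤ σ i * (w i + (M *ᵥ x) i)} := by
    intro i _ x hx y hy a b ha hb hab
    simp only [Set.mem_ofPred_eq, mulVec_add, mulVec_smul, Pi.add_apply, Pi.smul_apply,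
      smul_eq_mul] at hx hy ⊢
    have := add_nonneg (mul_nonneg ha hx) (mul_nonneg hb hy)
    obtain rfl : b = 1 - a := by linarith
    linarith
  have hne := Convex.helly_theorem (𝕜 := ℝ) (by simpa using hkn) hconv fun I _ hI => by
    rw [Module.finrank_fin_fun] at hI
    by_cases hl : Fin.last n ∈ I
    · set e := I.orderEmbOfFin hI
      have hel : e (Fin.last k) = Fin.last n := by
        obtain ⟨j, hj⟩ : Fin.last n ∈ Set.range e := by
          rw [Finset.range_orderEmbOfFin]
          exact hl
        exact le_antisymm (Fin.le_last _) (hj ▸ e.monotone (Fin.le_last j))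
      have hs : StrictMono (e ∘ Fin.castSucc) := e.strictMono.comp Fin.strictMono_castSucc
      have hdet := hM _ hs
      set N := M.submatrix (e ∘ Fin.castSucc) id with hN
      set x := N⁻¹ *ᵥ fun j => -w (e j.castSucc) with hx
      have hNx : N *ᵥ x = fun j => -w (e j.castSucc) := by
        rw [hx, mulVec_mulVec, mul_nonsing_inv _ hdet.ne'.isUnit, one_mulVec]
      have hx0 : ∀ j : Fin k, w (e j.castSucc) + (M *ᵥ x) (e j.castSucc) = 0 := by
        intro j
        have : (M *ᵥ x) (e j.castSucc) = -w (e j.castSucc) := congrFun hNx j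
        rw [this, add_neg_cancel]
      have hlast := hMw e e.strictMono
      rw [det_prependCol_submatrix_eq M w e hx0, hel] at hlast
      refine ⟨x, Set.mem_iInter₂.2 fun i hi => ?_⟩
      obtain ⟨j, rfl⟩ : i ∈ Set.range e := by
        rw [Finset.range_orderEmbOfFin]
        exact hi
      refine Fin.lastCases ?_ (fun j => ?_) j
      · rw [Set.mem_ofPred_eq, hel, hσ, Fin.snoc_last]
        exact (pos_of_mul_pos_right hlast hdet.le).le
      · rw [Set.mem_ofPred_eq, hx0, mul_zero]
    · obtain ⟨x, hx⟩ := h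
      refine ⟨x, Set.mem_iInter₂.2 fun i hi => ?_⟩
      obtain ⟨j, rfl⟩ := Fin.exists_castSucc_eq.2 fun h : i = Fin.last n => hl (h ▸ hi)
      simpa [hσ] using hx j
  obtain ⟨x, hx⟩ := hne
  exact ⟨x, by simpa using hx⟩

open Matrix in
/-- If `(−1)^k g_{n+1}` is bounded above on a nonempty region `Δ_α`, then `Δ_{α(−1)^k}` is
compact. -/
theorem isCompact_regionSnocSign_of_bddAbove {n k : ℕ} (hkn : k ≤ n + 1)
    {M : Matrix (Fin (n + 1)) (Fin k) ℝ} {w : Fin (n + 1) → ℝ}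
    (hM : ∀ s : Fin k → Fin (n + 1), StrictMono s → (M.submatrix s id).det ≠ 0)
    {α : Fin n → ℝ} (hne : (regionDelLast n k M w α).Nonempty)
    (hbdd : BddAbove ((fun x => (-1 : ℝ) ^ k * (w (Fin.last n) + (M *ᵥ x) (Fin.last n))) ''
      regionDelLast n k M w α)) :
    IsCompact (regionSnocSign n k M w α) := by
  rw [regionSnocSign_eq]
  refine Metric.isCompact_of_isClosed_isBounded ?_
    (isBounded_of_recession_cone_trivial M w _ fun y hy => ?_)
  · simp only [Set.ofPred_forall]
    refine isClosed_iInter fun i => isClosed_le continuous_const (continuous_const.mul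
      (continuous_const.add
        ((continuous_apply i).comp (continuous_const.matrix_mulVec continuous_id))))
  by_contra hy0
  obtain ⟨z, hz, hzl⟩ := exists_mulVec_sign_pos_of_minors_ne_zero hkn hM hy0 hy
    (j := Fin.last n) (by simp)
  simp only [Fin.forall_fin_succ', Fin.snoc_castSucc, Fin.snoc_last] at hz hzl
  obtain ⟨x, hx⟩ := hne
  obtain ⟨C, hC⟩ := hbdd
  have hray : ∀ r : ℝ, 0 ≤ r → (-1 : ℝ) ^ k * (w (Fin.last n) + (M *ᵥ x) (Fin.last n)) +
      r * ((-1 : ℝ) ^ k * (M *ᵥ z) (Fin.last n)) ≤ C := by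
    intro r hr
    refine le_trans (le_of_eq ?_) (hC ⟨x + r • z, fun i => ?_, rfl⟩)
    · simp only [mulVec_add, mulVec_smul, Pi.add_apply, Pi.smul_apply, smul_eq_mul]
      ring
    · have h1 := hx i
      have h2 := mul_nonneg hr (hz.1 i)
      simp only [mulVec_add, mulVec_smul, Pi.add_apply, Pi.smul_apply, smul_eq_mul]
      linarith
  obtain ⟨m, hm⟩ := Archimedean.arch
    (C - (-1 : ℝ) ^ k * (w (Fin.last n) + (M *ᵥ x) (Fin.last n)) + 1) hzl
  have := hray m (Nat.cast_nonneg m)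
  rw [nsmul_eq_mul] at hm
  linarith

/-- If `Δ_{α(−1)^k}` is compact, then `(−1)^k g_{n+1}` is bounded above on `Δ_α`. -/
theorem bddAbove_of_isCompact_regionSnocSign {n k : ℕ}
    {M : Matrix (Fin (n + 1)) (Fin k) ℝ} {w : Fin (n + 1) → ℝ} {α : Fin n → ℝ}
    (h : IsCompact (regionSnocSign n k M w α)) :
    BddAbove ((fun x => (-1 : ℝ) ^ k * (w (Fin.last n) + M.mulVec x (Fin.last n))) ''
      regionDelLast n k M w α) := by
  have hcont : Continuous fun x : Fin k → ℝ =>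
      (-1 : ℝ) ^ k * (w (Fin.last n) + M.mulVec x (Fin.last n)) :=
    continuous_const.mul (continuous_const.add
      ((continuous_apply _).comp (continuous_const.matrix_mulVec continuous_id)))
  obtain ⟨C, hC⟩ := h.bddAbove_image hcont.continuousOn
  refine ⟨max C 0, ?_⟩
  rintro _ ⟨x, hx, rfl⟩
  rcases le_total 0 ((-1 : ℝ) ^ k * (w (Fin.last n) + M.mulVec x (Fin.last n))) with h0 | h0
  · exact le_max_of_le_left (hC ⟨x, ⟨hx, h0⟩, rfl⟩)
  · exact le_max_of_le_right h0

/-- Lemma 3.19: for a cyclic arrangement of `n+1` hyperplanes in `k`-space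
(given by a totally positive matrix `M` and a vector `w` with `[w | M]` totally positive),
and any sign sequence `α ∈ {+1,−1}^n`: (i) `Δ_{α(−1)^k}` is empty iff `Δ_α` is empty;
(ii) `Δ_{α(−1)^k}` is nonempty and compact iff `Δ_α` is nonempty and `(−1)^k·g_{n+1}` is
bounded above on it; (iii) `Δ_{α(−1)^k}` is nonempty and noncompact iff `Δ_α` is nonempty
and `(−1)^k·g_{n+1}` is unbounded above on it. -/
theorem regionSnocSign_empty_compact_characterization
    (n k : ℕ) (hk1 : 1 ≤ k) (hkn : k ≤ n)
    (M : Matrix (Fin (n + 1)) (Fin k) ℝ) (w : Fin (n + 1) → ℝ)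
    (hM : ∀ s : Fin k → Fin (n + 1), StrictMono s → 0 < (M.submatrix s id).det)
    (hMw : ∀ s : Fin (k + 1) → Fin (n + 1), StrictMono s →
      0 < ((prependCol n k M w).submatrix s id).det)
    (α : Fin n → ℝ) (hα : ∀ i, α i = 1 ∨ α i = -1) :
    (regionSnocSign n k M w α = ∅ ↔ regionDelLast n k M w α = ∅) ∧
    ((regionSnocSign n k M w α).Nonempty ∧ IsCompact (regionSnocSign n k M w α) ↔
      (regionDelLast n k M w α).Nonempty ∧
        BddAbove ((fun x => (-1 : ℝ) ^ k * (w (Fin.last n) + M.mulVec x (Fin.last n))) ''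
          regionDelLast n k M w α)) ∧
    ((regionSnocSign n k M w α).Nonempty ∧ ¬ IsCompact (regionSnocSign n k M w α) ↔
      (regionDelLast n k M w α).Nonempty ∧
        ¬ BddAbove ((fun x => (-1 : ℝ) ^ k * (w (Fin.last n) + M.mulVec x (Fin.last n))) ''
          regionDelLast n k M w α)) := by
  have hne : (regionSnocSign n k M w α).Nonempty ↔ (regionDelLast n k M w α).Nonempty :=
    ⟨fun ⟨x, hx⟩ => ⟨x, hx.1⟩, regionSnocSign_nonempty_of_regionDelLast_nonempty hkn hM hMw⟩
  have hcompact : (regionDelLast n k M w α).Nonempty → (IsCompact (regionSnocSign n k M w α) ↔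
      BddAbove ((fun x => (-1 : ℝ) ^ k * (w (Fin.last n) + M.mulVec x (Fin.last n))) ''
        regionDelLast n k M w α)) := fun h =>
    ⟨bddAbove_of_isCompact_regionSnocSign,
      isCompact_regionSnocSign_of_bddAbove (by lia) (fun s hs => (hM s hs).ne') h⟩
  refine ⟨?_, ?_, ?_⟩
  · simpa only [Set.not_nonempty_iff_eq_empty] using not_congr hne
  · rw [hne]
    exact and_congr_right hcompact
  · rw [hne]
    exact and_congr_right fun h => not_congr (hcompact h)
end
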